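/- Let V be a MOSVA and W a V-bimodule, both satisfying the pole-order condition. Let u_1,…,u_m ∈ V and let f ∈ W̃_{z_{m+1},…,z_{m+n}} be such that Y_W^{s(R)}(u_m,z_m)⋯Y_W^{s(R)}(u_1,z_1)f(z_{m+1},…,z_{m+n}) converges absolutely to a \overline{W}-valued rational function for every (z_1,…,z_{m+n}) ∈ F_{m+n}ℂ with |z_m| > ⋯ > |z_1| > |z_i| (i = m+1,…,m+n). Then the series Y_W^{s(R)}(Y_V(u_1,z_1−ζ)⋯Y_V(u_m,z_m−ζ)𝟏, ζ)f(z_{m+1},…,z_{m+n}) also converges absolutely to the same \overline{W}-valued rational function whenever (z_1,…,z_{m+n}) ∈ F_{m+n}ℂ, |ζ| > |z_1−ζ| + |z_i| (i = m+1,…,m+n) and |z_1−ζ| > ⋯ > |z_m−ζ|, and E(Y_W^{s(R)}(u_m,z_m)⋯Y_W^{s(R)}(u_1,z_1)f(z_{m+1},…,z_{m+n})) = E(Y_W^{s(R)}(Y_V(u_1,z_1−ζ)⋯Y_V(u_m,z_m−ζ)𝟏,ζ)f(z_{m+1},…,z_{m+n})) as elements of W̃_{z_1,…,z_{m+n}}.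 -/

import Mathlib

set_option autoImplicit false
set_option maxHeartbeats 1000000

open scoped BigOperators

noncomputable section

namespace VA

/-- Absolute convergence of a series of complex numbers indexed by `ι` to the sum `s`. -/
def AbsConvTo {ι : Type*} (f : ι → ℂ) (s : ℂ) : Prop :=
  Summable (fun i => ‖f i‖) ∧ HasSum f s

/-- The configuration-space condition: the entries of `z` are pairwise distinct. -/
def Conf {ι : Type*} (z : ι → ℂ) : Prop := ∀ i j : ι, i ≠ j → z i ≠ z j

/-- `‖z 0‖ > ‖z 1‖ > ⋯ > ‖z (n-1)‖`. -/
def Ordered {n : ℕ} (z : Fin n → ℂ) : Prop := ∀ i j : Fin n, i < j → ‖z j‖ < ‖z i‖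

/-- `‖z 0‖ > ‖z 1‖ > ⋯ > ‖z (n-1)‖ > 0`. -/
def OrderedPos {n : ℕ} (z : Fin n → ℂ) : Prop := Ordered z ∧ ∀ i, 0 < ‖z i‖

/-- A rational function in the variables `z i`, `i : ι`, whose only possible poles are
at `z i = 0` and on the diagonals `z i = z j` (`i ≠ j`); it is recorded as a numerator
polynomial together with the orders of the poles. -/
structure RatFn (ι : Type*) [Fintype ι] [DecidableEq ι] where
  num : MvPolynomial ι ℂ
  a : ι → ℕ
  b : ι → ι → ℕ

def RatFn.eval {ι : Type*} [Fintype ι] [DecidableEq ι] (R : RatFn ι) (z : ι → ℂ) : ℂ :=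
  MvPolynomial.eval z R.num /
    ((∏ i, z i ^ R.a i) * ∏ q ∈ Finset.univ.offDiag, (z q.1 - z q.2) ^ R.b q.1 q.2)

/-- A rational function in the variables `z i`, `i : ι`, whose only possible poles are
on the diagonals `z i = z j` (`i ≠ j`). -/
structure DiagRatFn (ι : Type*) [Fintype ι] [DecidableEq ι] where
  num : MvPolynomial ι ℂ
  b : ι → ι → ℕ

def DiagRatFn.eval {ι : Type*} [Fintype ι] [DecidableEq ι] (R : DiagRatFn ι) (z : ι → ℂ) : ℂ :=
  MvPolynomial.eval z R.num / ∏ q ∈ Finset.univ.offDiag, (z q.1 - z q.2) ^ R.b q.1 q.2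

/-- A linear functional belongs to the graded dual iff its restriction to all but
finitely many homogeneous components vanishes. -/
def InGradedDual {ι : Type*} {M : Type*} [AddCommGroup M] [Module ℂ M]
    (proj : ι → M →ₗ[ℂ] M) (φ : M →ₗ[ℂ] ℂ) : Prop :=
  (Function.support fun i => φ ∘ₗ proj i).Finite

/-- Iterated application: `compApply n f w = f 0 (f 1 (⋯ (f (n-1) w)))`. -/
def compApply {M : Type*} : (n : ℕ) → (Fin n → (M → M)) → M → M
  | 0, _, w => w
  | n+1, f, w => f 0 (compApply n (fun i => f i.succ) w)

section Graded

variable (W : Type*) [AddCommGroup W] [Module ℂ W]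

/-- A `ℂ`-grading of `W`, recorded via the projections onto the homogeneous
subspaces, whose weights have lower-bounded real parts. -/
structure CGrading where
  proj : ℂ → W →ₗ[ℂ] W
  proj_comp : ∀ m n : ℂ, proj m ∘ₗ proj n = if m = n then proj n else 0
  proj_finite : ∀ w : W, (Function.support fun n => proj n w).Finite
  proj_sum : ∀ w : W, (∑ᶠ n : ℂ, proj n w) = w
  lower_bound : ∃ B : ℝ, ∀ n : ℂ, n.re < B → proj n = 0

/-- A `ℤ`-grading of `V` with lower-bounded weights. -/
structure ZGrading where
  proj : ℤ → W →ₗ[ℂ] W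
  proj_comp : ∀ m n : ℤ, proj m ∘ₗ proj n = if m = n then proj n else 0
  proj_finite : ∀ w : W, (Function.support fun n => proj n w).Finite
  proj_sum : ∀ w : W, (∑ᶠ n : ℤ, proj n w) = w
  lower_bound : ∃ B : ℤ, ∀ n : ℤ, n < B → proj n = 0

variable {W}

/-- The grading operator `d` of a `ℂ`-graded space. -/
def CGrading.d (G : CGrading W) (w : W) : W := ∑ᶠ n : ℂ, n • G.proj n w

/-- The grading operator `d` of a `ℤ`-graded space. -/
def ZGrading.d (G : ZGrading W) (v : W) : W := ∑ᶠ n : ℤ, (n : ℂ) • G.proj n v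

/-- The operator `z^d` on a `ℤ`-graded space. -/
def ZGrading.zd (G : ZGrading W) (z : ℂ) (v : W) : W := ∑ᶠ n : ℤ, (z ^ n) • G.proj n v

/-- The algebraic completion `∏ₙ W_[n]`, realized as the submodule of functions
`ℂ → W` recording a homogeneous component in each weight. -/
def CGrading.compSub (G : CGrading W) : Submodule ℂ (ℂ → W) where
  carrier := {f | ∀ n, G.proj n (f n) = f n}
  add_mem' := by
    intro a b ha hb n
    simp only [Pi.add_apply, map_add, ha n, hb n]
  zero_mem' := by
    intro n
    simp
  smul_mem' := by
    intro c f hf n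
    simp only [Pi.smul_apply, map_smul, hf n]

/-- The algebraic completion of a graded space. -/
abbrev CGrading.Comp (G : CGrading W) : Type _ := ↥G.compSub

/-- The pairing between the graded dual and the algebraic completion. -/
def CGrading.pair (G : CGrading W) (φ : W →ₗ[ℂ] ℂ) (f : G.Comp) : ℂ :=
  ∑ᶠ n : ℂ, φ (f.1 n)

/-- The embedding of `W` into its algebraic completion. -/
def CGrading.emb (G : CGrading W) (w : W) : G.Comp :=
  ⟨fun n => G.proj n w, by
    intro n
    have h := congrArg (fun T : W →ₗ[ℂ] W => T w) (G.proj_comp n n)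
    simpa using h⟩

/-- The componentwise extension of an operator on `W` to the algebraic completion. -/
def CGrading.ext (G : CGrading W) (L : W → W) (f : G.Comp) : G.Comp :=
  ⟨fun m => ∑ᶠ n : ℂ, G.proj m (L (f.1 n)), by
    intro m
    show G.proj m (∑ᶠ n : ℂ, G.proj m (L (f.1 n))) = ∑ᶠ n : ℂ, G.proj m (L (f.1 n))
    by_cases h : (Function.support fun n => G.proj m (L (f.1 n))).Finite
    · have h1 := AddMonoidHom.map_finsum (G.proj m).toAddMonoidHom h
      simp only [LinearMap.toAddMonoidHom_coe] at h1
      rw [h1]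
      refine finsum_congr fun n => ?_
      have h2 := congrArg (fun T : W →ₗ[ℂ] W => T (L (f.1 n))) (G.proj_comp m m)
      simpa using h2
    · rw [finsum_of_infinite_support h]
      simp⟩

/-- The operator `z^d` on the algebraic completion, acting on the component of
weight `n` by `z ^ n` (complex power). -/
def CGrading.zd (G : CGrading W) (z : ℂ) (f : G.Comp) : G.Comp :=
  ⟨fun n => (z ^ n) • f.1 n, by
    intro n
    rw [map_smul, f.2 n]⟩

end Graded


section VOA

/-- A meromorphic open-string vertex algebra (MOSVA): a lower-bounded `ℤ`-graded
space with a vertex operator map (recorded through its coefficients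
`Y u v k = (Y_V)_k(u)v`, the coefficient of `x^{-k-1}` in `Y_V(u,x)v`) and a
vacuum, satisfying the grading, vacuum, `D`-derivative/commutator, rationality and
associativity axioms. -/
structure MOSVA (V : Type*) [AddCommGroup V] [Module ℂ V] where
  gr : ZGrading V
  Y : V →ₗ[ℂ] V →ₗ[ℂ] (ℤ → V)
  vac : V
  /-- lower truncation of vertex operators -/
  trunc : ∀ u v : V, ∃ N : ℤ, ∀ k : ℤ, N ≤ k → Y u v k = 0
  /-- identity property `Y(𝟏,x) = 1` -/
  identity : ∀ (v : V) (k : ℤ), Y vac v k = if k = -1 then v else 0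
  /-- creation property: `Y(u,x)𝟏 ∈ V[[x]]` and `lim_{x→0} Y(u,x)𝟏 = u` -/
  creation : ∀ (u : V) (k : ℤ), 0 ≤ k → Y u vac k = 0
  creation_lim : ∀ u : V, Y u vac (-1) = u
  /-- the `d`-commutator formula, written in terms of coefficients -/
  d_comm : ∀ (u v : V) (k : ℤ),
    gr.d (Y u v k) = Y (gr.d u) v k + (-(k : ℂ) - 1) • Y u v k + Y u (gr.d v) k
  /-- the `D`-derivative property (`D_V u = (Y_V)_{-2}(u)𝟏`) -/
  D_deriv : ∀ (u v : V) (k : ℤ),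
    Y (Y u vac (-2)) v k = (-(k : ℂ)) • Y u v (k - 1)
  /-- the `D`-commutator formula -/
  D_comm : ∀ (u v : V) (k : ℤ),
    Y (Y u v k) vac (-2) - Y u (Y v vac (-2)) k = (-(k : ℂ)) • Y u v (k - 1)
  /-- rationality of products: matrix coefficients of products of vertex operators
  converge absolutely in the ordered region to rational functions with the only
  possible poles at `z i = 0` and `z i = z j` -/
  rationality : ∀ (n : ℕ) (u : Fin n → V) (v : V) (φ : V →ₗ[ℂ] ℂ),
    InGradedDual gr.proj φ → ∃ R : RatFn (Fin n), ∀ z : Fin n → ℂ, OrderedPos z →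
      AbsConvTo (fun k : Fin n → ℤ =>
          φ (compApply n (fun i x => Y (u i) x (k i)) v) * ∏ i, z i ^ (-(k i) - 1))
        (R.eval z)
  /-- rationality of iterates and associativity: products and iterates converge to a
  common rational function -/
  associativity : ∀ (u₁ u₂ v : V) (φ : V →ₗ[ℂ] ℂ), InGradedDual gr.proj φ →
    ∃ R : RatFn (Fin 2),
      (∀ z₁ z₂ : ℂ, ‖z₂‖ < ‖z₁‖ → 0 < ‖z₂‖ →
        AbsConvTo (fun k : ℤ × ℤ =>
            φ (Y u₁ (Y u₂ v k.2) k.1) * z₁ ^ (-k.1 - 1) * z₂ ^ (-k.2 - 1))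
          (R.eval ![z₁, z₂])) ∧
      (∀ z₁ z₂ : ℂ, ‖z₁ - z₂‖ < ‖z₂‖ → 0 < ‖z₁ - z₂‖ →
        AbsConvTo (fun k : ℤ × ℤ =>
            φ (Y (Y u₁ u₂ k.1) v k.2) * (z₁ - z₂) ^ (-k.1 - 1) * z₂ ^ (-k.2 - 1))
          (R.eval ![z₁, z₂]))

variable {V : Type*} [AddCommGroup V] [Module ℂ V]

/-- The operator `D_V`. -/
def MOSVA.D (A : MOSVA V) (v : V) : V := A.Y v A.vac (-2)

/-- The pole-order condition for a MOSVA. -/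
def MOSVA.PoleOrder (A : MOSVA V) : Prop :=
  ∀ u₁ v : V, ∃ C : ℕ, ∀ φ : V →ₗ[ℂ] ℂ, InGradedDual A.gr.proj φ → ∀ u₂ : V,
    ∃ R : RatFn (Fin 2), R.a 0 ≤ C ∧
      ∀ z₁ z₂ : ℂ, ‖z₂‖ < ‖z₁‖ → 0 < ‖z₂‖ →
        AbsConvTo (fun k : ℤ × ℤ =>
            φ (A.Y u₁ (A.Y u₂ v k.2) k.1) * z₁ ^ (-k.1 - 1) * z₂ ^ (-k.2 - 1))
          (R.eval ![z₁, z₂])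

/-- A bimodule for a MOSVA: a `ℂ`-graded space with left and right vertex operator
maps (recorded through their coefficients), satisfying the left module, right module
and compatibility axioms. -/
structure Bimod (A : MOSVA V) (W : Type*) [AddCommGroup W] [Module ℂ W] where
  gr : CGrading W
  YL : V →ₗ[ℂ] W →ₗ[ℂ] (ℤ → W)
  YR : W →ₗ[ℂ] V →ₗ[ℂ] (ℤ → W)
  DW : W →ₗ[ℂ] W
  /-- `D_W` has weight one -/
  DW_wt : ∀ n : ℂ, DW ∘ₗ gr.proj n = gr.proj (n + 1) ∘ₗ DW ∘ₗ gr.proj n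
  truncL : ∀ (u : V) (w : W), ∃ N : ℤ, ∀ k : ℤ, N ≤ k → YL u w k = 0
  truncR : ∀ (w : W) (u : V), ∃ N : ℤ, ∀ k : ℤ, N ≤ k → YR w u k = 0
  identityL : ∀ (w : W) (k : ℤ), YL A.vac w k = if k = -1 then w else 0
  creationR : ∀ (w : W) (k : ℤ), 0 ≤ k → YR w A.vac k = 0
  creationR_lim : ∀ w : W, YR w A.vac (-1) = w
  d_commL : ∀ (u : V) (w : W) (k : ℤ),
    gr.d (YL u w k) = YL (A.gr.d u) w k + (-(k : ℂ) - 1) • YL u w k + YL u (gr.d w) k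
  d_commR : ∀ (w : W) (u : V) (k : ℤ),
    gr.d (YR w u k) = YR (gr.d w) u k + (-(k : ℂ) - 1) • YR w u k + YR w (A.gr.d u) k
  D_derivL : ∀ (u : V) (w : W) (k : ℤ),
    YL (A.D u) w k = (-(k : ℂ)) • YL u w (k - 1)
  D_commL : ∀ (u : V) (w : W) (k : ℤ),
    DW (YL u w k) - YL u (DW w) k = (-(k : ℂ)) • YL u w (k - 1)
  D_derivR : ∀ (w : W) (u : V) (k : ℤ),
    YR (DW w) u k = (-(k : ℂ)) • YR w u (k - 1)
  D_commR : ∀ (w : W) (u : V) (k : ℤ),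
    DW (YR w u k) - YR w (A.D u) k = (-(k : ℂ)) • YR w u (k - 1)
  /-- rationality for products of left vertex operators -/
  rationalityL : ∀ (n : ℕ) (u : Fin n → V) (w : W) (φ : W →ₗ[ℂ] ℂ),
    InGradedDual gr.proj φ → ∃ R : RatFn (Fin n), ∀ z : Fin n → ℂ, OrderedPos z →
      AbsConvTo (fun k : Fin n → ℤ =>
          φ (compApply n (fun i x => YL (u i) x (k i)) w) * ∏ i, z i ^ (-(k i) - 1))
        (R.eval z)
  /-- rationality of iterates and associativity for the left vertex operator map -/
  associativityL : ∀ (u₁ u₂ : V) (w : W) (φ : W →ₗ[ℂ] ℂ), InGradedDual gr.proj φ →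
    ∃ R : RatFn (Fin 2),
      (∀ z₁ z₂ : ℂ, ‖z₂‖ < ‖z₁‖ → 0 < ‖z₂‖ →
        AbsConvTo (fun k : ℤ × ℤ =>
            φ (YL u₁ (YL u₂ w k.2) k.1) * z₁ ^ (-k.1 - 1) * z₂ ^ (-k.2 - 1))
          (R.eval ![z₁, z₂])) ∧
      (∀ z₁ z₂ : ℂ, ‖z₁ - z₂‖ < ‖z₂‖ → 0 < ‖z₁ - z₂‖ →
        AbsConvTo (fun k : ℤ × ℤ =>
            φ (YL (A.Y u₁ u₂ k.1) w k.2) * (z₁ - z₂) ^ (-k.1 - 1) * z₂ ^ (-k.2 - 1))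
          (R.eval ![z₁, z₂]))
  /-- rationality for products `Y_W^R(w,z₁)Y_V(u₁,z₂)⋯Y_V(u_{n-1},z_n)u_n` -/
  rationalityR : ∀ (n : ℕ) (w : W) (v : Fin (n+1) → V) (φ : W →ₗ[ℂ] ℂ),
    InGradedDual gr.proj φ → ∃ R : RatFn (Fin (n+1)),
      ∀ z : Fin (n+1) → ℂ, OrderedPos z →
        AbsConvTo (fun k : Fin (n+1) → ℤ =>
            φ (YR w (compApply n (fun i x => A.Y (v i.castSucc) x (k i.succ))
                (v (Fin.last n))) (k 0)) * ∏ i, z i ^ (-(k i) - 1))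
          (R.eval z)
  /-- rationality of iterates and associativity for the right vertex operator map -/
  associativityR : ∀ (w : W) (u₁ u₂ : V) (φ : W →ₗ[ℂ] ℂ), InGradedDual gr.proj φ →
    ∃ R : RatFn (Fin 2),
      (∀ z₁ z₂ : ℂ, ‖z₂‖ < ‖z₁‖ → 0 < ‖z₂‖ →
        AbsConvTo (fun k : ℤ × ℤ =>
            φ (YR w (A.Y u₁ u₂ k.2) k.1) * z₁ ^ (-k.1 - 1) * z₂ ^ (-k.2 - 1))
          (R.eval ![z₁, z₂])) ∧
      (∀ z₁ z₂ : ℂ, ‖z₁ - z₂‖ < ‖z₂‖ → 0 < ‖z₁ - z₂‖ →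
        AbsConvTo (fun k : ℤ × ℤ =>
            φ (YR (YR w u₁ k.1) u₂ k.2) * (z₁ - z₂) ^ (-k.1 - 1) * z₂ ^ (-k.2 - 1))
          (R.eval ![z₁, z₂]))
  /-- compatibility: rationality of mixed products
  `Y_W^L(u₁,z₁)⋯Y_W^L(u_p,z_p)Y_W^R(w,z₀)Y_V(v₁,⋅)⋯Y_V(v_{q},⋅)v_{q+1}` -/
  compatRat : ∀ (p q : ℕ) (u : Fin p → V) (w : W) (v : Fin (q+1) → V)
      (φ : W →ₗ[ℂ] ℂ), InGradedDual gr.proj φ →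
    ∃ R : RatFn (Fin p ⊕ Fin (q+1)),
      ∀ (zL : Fin p → ℂ) (z0 : ℂ) (zR : Fin q → ℂ),
        Ordered zL → (∀ i, ‖z0‖ < ‖zL i‖) → (∀ j, ‖zR j‖ < ‖z0‖) → Ordered zR →
        0 < ‖z0‖ → (∀ j, 0 < ‖zR j‖) →
        AbsConvTo (fun K : (Fin p → ℤ) × ℤ × (Fin q → ℤ) =>
            φ (compApply p (fun i x => YL (u i) x (K.1 i))
                (YR w (compApply q (fun j x => A.Y (v j.castSucc) x (K.2.2 j))
                  (v (Fin.last q))) K.2.1))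
              * (∏ i, zL i ^ (-(K.1 i) - 1)) * z0 ^ (-K.2.1 - 1)
              * ∏ j, zR j ^ (-(K.2.2 j) - 1))
          (R.eval (Sum.elim zL (Fin.cons z0 zR)))
  /-- compatibility: associativity for the left and right vertex operator maps -/
  compatAssoc : ∀ (u v : V) (w : W) (φ : W →ₗ[ℂ] ℂ), InGradedDual gr.proj φ →
    ∃ R : RatFn (Fin 2),
      (∀ z₁ z₂ : ℂ, ‖z₂‖ < ‖z₁‖ → 0 < ‖z₂‖ →
        AbsConvTo (fun k : ℤ × ℤ =>
            φ (YL u (YR w v k.2) k.1) * z₁ ^ (-k.1 - 1) * z₂ ^ (-k.2 - 1))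
          (R.eval ![z₁, z₂])) ∧
      (∀ z₁ z₂ : ℂ, ‖z₁ - z₂‖ < ‖z₂‖ → 0 < ‖z₁ - z₂‖ →
        AbsConvTo (fun k : ℤ × ℤ =>
            φ (YR (YL u w k.1) v k.2) * (z₁ - z₂) ^ (-k.1 - 1) * z₂ ^ (-k.2 - 1))
          (R.eval ![z₁, z₂]))

variable {W : Type*} [AddCommGroup W] [Module ℂ W] {A : MOSVA V}

/-- The opposite right vertex operator map
`Y_W^{s(R)}(v,x)w = e^{xD_W}Y_W^R(w,-x)v`, through its coefficients. -/
def Bimod.YsR (B : Bimod A W) (v : V) (w : W) (k : ℤ) : W :=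
  ∑ᶠ m : ℕ, (((-1 : ℂ) ^ (k + (m : ℤ) + 1)) * ((m.factorial : ℂ))⁻¹) •
    ((B.DW ^ m) (B.YR w v (k + (m : ℤ))))

/-- The pole-order condition for a bimodule over a MOSVA. -/
def Bimod.PoleOrder (B : Bimod A W) : Prop :=
  (∀ (u₁ : V) (w : W), ∃ C : ℕ, ∀ φ : W →ₗ[ℂ] ℂ, InGradedDual B.gr.proj φ → ∀ u₂ : V,
    ∃ R : RatFn (Fin 2), R.a 0 ≤ C ∧
      ∀ z₁ z₂ : ℂ, ‖z₂‖ < ‖z₁‖ → 0 < ‖z₂‖ →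
        AbsConvTo (fun k : ℤ × ℤ =>
            φ (B.YL u₁ (B.YL u₂ w k.2) k.1) * z₁ ^ (-k.1 - 1) * z₂ ^ (-k.2 - 1))
          (R.eval ![z₁, z₂])) ∧
  (∀ (u₂ : V) (w : W), ∃ C : ℕ, ∀ φ : W →ₗ[ℂ] ℂ, InGradedDual B.gr.proj φ → ∀ u₁ : V,
    ∃ R : RatFn (Fin 2), R.a 0 ≤ C ∧
      ∀ z₁ z₂ : ℂ, ‖z₂‖ < ‖z₁‖ → 0 < ‖z₂‖ →
        AbsConvTo (fun k : ℤ × ℤ =>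
            φ (B.YR w (A.Y u₁ u₂ k.2) k.1) * z₁ ^ (-k.1 - 1) * z₂ ^ (-k.2 - 1))
          (R.eval ![z₁, z₂])) ∧
  (∀ (u₁ u₂ : V), ∃ C : ℕ, ∀ φ : W →ₗ[ℂ] ℂ, InGradedDual B.gr.proj φ → ∀ w : W,
    ∃ R : RatFn (Fin 2), R.a 0 ≤ C ∧
      ∀ z₁ z₂ : ℂ, ‖z₂‖ < ‖z₁‖ → 0 < ‖z₂‖ →
        AbsConvTo (fun k : ℤ × ℤ =>
            φ (B.YL u₁ (B.YR w u₂ k.2) k.1) * z₁ ^ (-k.1 - 1) * z₂ ^ (-k.2 - 1))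
          (R.eval ![z₁, z₂]))

end VOA


section Cochains

variable {V : Type*} [AddCommGroup V] [Module ℂ V]
variable {W : Type*} [AddCommGroup W] [Module ℂ W] {A : MOSVA V}

/-- A `W̄`-valued rational function in the variables `z i`, `i : ι`, with the only
possible poles at `z i = z j`: a map from configuration space to the algebraic
completion whose pairings with graded-dual functionals are such rational functions,
with pole orders uniform in the functional, as witnessed by a formal power series
with coefficients in `W` (condition (ii)). -/
def CGrading.WTilde (G : CGrading W) {ι : Type*} [Fintype ι] [DecidableEq ι]
    (f : (ι → ℂ) → G.Comp) : Prop :=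
  (∀ φ : W →ₗ[ℂ] ℂ, InGradedDual G.proj φ →
      ∃ R : DiagRatFn ι, ∀ z : ι → ℂ, Conf z → G.pair φ (f z) = R.eval z) ∧
  ∃ (p : ι → ι → ℤ) (b : (ι → ℕ) → W),
    ∀ φ : W →ₗ[ℂ] ℂ, InGradedDual G.proj φ →
      (Function.support fun k => φ (b k)).Finite ∧
      ∀ z : ι → ℂ, Conf z →
        (∏ q ∈ Finset.univ.offDiag, (z q.1 - z q.2) ^ (p q.1 q.2)) * G.pair φ (f z)
          = ∑ᶠ k : ι → ℕ, φ (b k) * ∏ i, z i ^ (k i)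

/-- The pattern of left/right vertex operators: the `i`-th operator is
`Y_W^L(u i, z i)` if `isL i`, and `Y_W^{s(R)}(u i, z i)` otherwise; `k` records the
coefficient extracted from each operator. -/
def patOps (B : Bimod A W) {n : ℕ} (isL : Fin n → Bool) (u : Fin n → V)
    (k : Fin n → ℤ) : Fin n → (W → W) :=
  fun i => if isL i then fun x => B.YL (u i) x (k i) else fun x => B.YsR (u i) x (k i)

/-- The pattern with `l` left operators followed by `n - l` opposite right operators. -/
def prefixPat (n l : ℕ) : Fin n → Bool := fun i => decide ((i : ℕ) < l)

/-- A vector `w` such that `Y_W^L(u,x)w ∈ W[[x]]` and `Y_W^{s(R)}(u,x)w ∈ W[[x]]`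
for every `u ∈ V`. -/
def Bimod.RegVec (B : Bimod A W) (w : W) : Prop :=
  ∀ (u : V) (k : ℤ), 0 ≤ k → B.YL u w k = 0 ∧ B.YsR u w k = 0

/-- `f` represents the `W̄`-valued rational function
`E(Y^{L/sR}(u 0, z 0)⋯Y^{L/sR}(u (n-1), z (n-1)) w)` (with the operators prescribed
by the pattern `isL`): `f` is a `W̄`-valued rational function with only diagonal
poles whose pairings are the sums of the corresponding series of matrix coefficients
on the region `|z 0| > ⋯ > |z (n-1)| > 0`. -/
def RepEPat (B : Bimod A W) {n : ℕ} (isL : Fin n → Bool) (u : Fin n → V) (w : W)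
    (f : (Fin n → ℂ) → B.gr.Comp) : Prop :=
  B.gr.WTilde f ∧
  ∀ φ : W →ₗ[ℂ] ℂ, InGradedDual B.gr.proj φ → ∀ z : Fin n → ℂ, OrderedPos z →
    AbsConvTo (fun k : Fin n → ℤ =>
        φ (compApply n (patOps B isL u k) w) * ∏ i, z i ^ (-(k i) - 1))
      (B.gr.pair φ (f z))

/-- `f` represents the `W̄`-valued rational function given by a product of groups of
vertex operators, with group `i` of size `α i` and left/right pattern `isL`;
the variables are indexed by the sigma type `(i : Fin N) × Fin (α i)`. -/
def RepESig (B : Bimod A W) {N : ℕ} (α : Fin N → ℕ)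
    (isL : (i : Fin N) → Fin (α i) → Bool)
    (u : (i : Fin N) → Fin (α i) → V) (w : W)
    (f : (((i : Fin N) × Fin (α i)) → ℂ) → B.gr.Comp) : Prop :=
  B.gr.WTilde f ∧
  ∀ φ : W →ₗ[ℂ] ℂ, InGradedDual B.gr.proj φ →
    ∀ Z : (i : Fin N) → Fin (α i) → ℂ,
      (∀ (i : Fin N) (s t : Fin (α i)), s < t → ‖Z i t‖ < ‖Z i s‖) →
      (∀ (i j : Fin N), i < j → ∀ (s : Fin (α i)) (t : Fin (α j)), ‖Z j t‖ < ‖Z i s‖) →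
      (∀ (i : Fin N) (s : Fin (α i)), 0 < ‖Z i s‖) →
      AbsConvTo (fun K : (i : Fin N) → Fin (α i) → ℤ =>
          φ (compApply N (fun i x => compApply (α i) (fun s y =>
              if isL i s then B.YL (u i s) y (K i s) else B.YsR (u i s) y (K i s)) x) w)
            * ∏ i, ∏ s, Z i s ^ (-(K i s) - 1))
        (B.gr.pair φ (f (fun q => Z q.1 q.2)))

/-- Multilinearity of a map on `n`-tuples of vectors. -/
def IsMultilinear {M : Type*} [AddCommMonoid M] [Module ℂ M] {n : ℕ}
    (Φ : (Fin n → V) → M) : Prop :=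
  (∀ (v : Fin n → V) (i : Fin n) (x y : V),
      Φ (Function.update v i (x + y)) = Φ (Function.update v i x) + Φ (Function.update v i y)) ∧
  ∀ (v : Fin n → V) (i : Fin n) (c : ℂ) (x : V),
      Φ (Function.update v i (c • x)) = c • Φ (Function.update v i x)

/-- The `D`-derivative property of a map `Φ : V^{⊗n} → W̃_{z₁,…,zₙ}`. -/
def DDerivProp (A : MOSVA V) (B : Bimod A W) {n : ℕ}
    (Φ : (Fin n → V) → (Fin n → ℂ) → B.gr.Comp) : Prop :=
  (∀ (v : Fin n → V) (i : Fin n) (φ : W →ₗ[ℂ] ℂ), InGradedDual B.gr.proj φ →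
    ∀ z : Fin n → ℂ, Conf z →
      HasDerivAt (fun t : ℂ => B.gr.pair φ (Φ v (Function.update z i t)))
        (B.gr.pair φ (Φ (Function.update v i (A.D (v i))) z)) (z i)) ∧
  (∀ (v : Fin n → V) (φ : W →ₗ[ℂ] ℂ), InGradedDual B.gr.proj φ →
    ∀ z : Fin n → ℂ, Conf z →
      B.gr.pair φ (B.gr.ext (⇑B.DW) (Φ v z)) =
        ∑ i, B.gr.pair φ (Φ (Function.update v i (A.D (v i))) z))

/-- The `d`-conjugation property of a map `Φ : V^{⊗n} → W̃_{z₁,…,zₙ}`. -/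
def DConjProp (A : MOSVA V) (B : Bimod A W) {n : ℕ}
    (Φ : (Fin n → V) → (Fin n → ℂ) → B.gr.Comp) : Prop :=
  ∀ (v : Fin n → V) (φ : W →ₗ[ℂ] ℂ), InGradedDual B.gr.proj φ →
    ∀ (z : Fin n → ℂ) (c : ℂ), c ≠ 0 → Conf z → Conf (fun i => c * z i) →
      B.gr.pair φ (B.gr.zd c (Φ v z)) =
        B.gr.pair φ (Φ (fun i => A.gr.zd c (v i)) (fun i => c * z i))

/-- Composability of `Φ : V^{⊗n} → W̃` with `m` vertex operators. -/
def ComposableWith (A : MOSVA V) (B : Bimod A W) (n m : ℕ)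
    (Φ : (Fin n → V) → (Fin n → ℂ) → B.gr.Comp) : Prop :=
  ∃ Cb : V → V → ℕ,
  ∀ (α : Fin (n+1) → ℕ), (∑ i, α i) = m + n →
  ∀ l₀ : ℕ, l₀ ≤ α 0 →
  ∀ u : (i : Fin (n+1)) → Fin (α i) → V,
  ∀ φ : W →ₗ[ℂ] ℂ, InGradedDual B.gr.proj φ →
  ∃ R : DiagRatFn ((i : Fin (n+1)) × Fin (α i)),
    (∀ q q' : (i : Fin (n+1)) × Fin (α i), R.b q q' ≤ Cb (u q.1 q.2) (u q'.1 q'.2)) ∧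
    ∀ (z : (i : Fin (n+1)) → Fin (α i) → ℂ) (ζ : Fin n → ℂ),
      (∀ s t : Fin (α 0), s < t → ‖z 0 t‖ < ‖z 0 s‖) →
      (∀ (j : Fin (α 0)) (i : Fin n) (t : Fin (α i.succ)),
          ‖ζ i‖ + ‖z i.succ t - ζ i‖ < ‖z 0 j‖) →
      (∀ (i : Fin n) (s t : Fin (α i.succ)), s < t →
          ‖z i.succ t - ζ i‖ < ‖z i.succ s - ζ i‖) →
      (∀ (i j : Fin n), i < j → ∀ (s : Fin (α i.succ)) (t : Fin (α j.succ)),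
          ‖(z i.succ s - ζ i) - (z j.succ t - ζ j)‖ < ‖ζ i - ζ j‖) →
      AbsConvTo (fun K : (i : Fin (n+1)) → Fin (α i) → ℤ =>
          B.gr.pair φ
            (compApply (α 0) (fun j => B.gr.ext (fun x =>
                if (j : ℕ) < l₀ then B.YL (u 0 j) x (K 0 j) else B.YsR (u 0 j) x (K 0 j)))
              (Φ (fun i => compApply (α i.succ)
                    (fun s x => A.Y (u i.succ s) x (K i.succ s)) A.vac) ζ))
            * (∏ j, z 0 j ^ (-(K 0 j) - 1))
            * ∏ i : Fin n, ∏ s, (z i.succ s - ζ i) ^ (-(K i.succ s) - 1))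
        (R.eval (fun q => z q.1 q.2))

/-- The set `Ĉ^n_m(V,W)`: maps `V^{⊗n} → W̃_{z₁,…,zₙ}` that are linear, satisfy the
`D`-derivative and `d`-conjugation properties and are composable with `m` vertex
operators. -/
def IsCochain (A : MOSVA V) (B : Bimod A W) (n m : ℕ)
    (Φ : (Fin n → V) → (Fin n → ℂ) → B.gr.Comp) : Prop :=
  IsMultilinear Φ ∧ (∀ v, B.gr.WTilde (Φ v)) ∧ DDerivProp A B Φ ∧ DConjProp A B Φ ∧
    ComposableWith A B n m Φ

/-- `Ψ` represents `E_W^{(1,0)} ∘₂ Φ`, i.e. the map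
`v ↦ E(Y_W^L(v 0, z 0) Φ(v 1 ⊗ ⋯ ⊗ v n)(z 1,…,z n))`. -/
def RepLeft (A : MOSVA V) (B : Bimod A W) {n : ℕ}
    (Φ : (Fin n → V) → (Fin n → ℂ) → B.gr.Comp)
    (Ψ : (Fin (n+1) → V) → (Fin (n+1) → ℂ) → B.gr.Comp) : Prop :=
  (∀ v, B.gr.WTilde (Ψ v)) ∧
  ∀ (v : Fin (n+1) → V) (φ : W →ₗ[ℂ] ℂ), InGradedDual B.gr.proj φ →
    ∀ (z₀ : ℂ) (zt : Fin n → ℂ), Conf (Fin.cons z₀ zt) →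
      (∀ i, ‖zt i‖ < ‖z₀‖) → (∀ i, 0 < ‖zt i‖) →
      AbsConvTo (fun k : ℤ =>
          B.gr.pair φ (B.gr.ext (fun x => B.YL (v 0) x k) (Φ (Fin.tail v) zt))
            * z₀ ^ (-k - 1))
        (B.gr.pair φ (Ψ v (Fin.cons z₀ zt)))

/-- `Ψ` represents `E_W^{(0,1)} ∘₂ Φ`, i.e. the map
`v ↦ E(Y_W^{s(R)}(v (n+1), z (n+1)) Φ(v 1 ⊗ ⋯ ⊗ v n)(z 1,…,z n))`. -/
def RepRight (A : MOSVA V) (B : Bimod A W) {n : ℕ}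
    (Φ : (Fin n → V) → (Fin n → ℂ) → B.gr.Comp)
    (Ψ : (Fin (n+1) → V) → (Fin (n+1) → ℂ) → B.gr.Comp) : Prop :=
  (∀ v, B.gr.WTilde (Ψ v)) ∧
  ∀ (v : Fin (n+1) → V) (φ : W →ₗ[ℂ] ℂ), InGradedDual B.gr.proj φ →
    ∀ (zl : ℂ) (zi : Fin n → ℂ), Conf (Fin.snoc zi zl) →
      (∀ i, ‖zi i‖ < ‖zl‖) → (∀ i, 0 < ‖zi i‖) →
      AbsConvTo (fun k : ℤ =>
          B.gr.pair φ (B.gr.ext (fun x => B.YsR (v (Fin.last n)) x k) (Φ (Fin.init v) zi))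
            * zl ^ (-k - 1))
        (B.gr.pair φ (Ψ v (Fin.snoc zi zl)))

/-- Replace the two adjacent entries `i, i+1` of an `(n+1)`-tuple by a single entry. -/
def mergeAt {M : Type*} {n : ℕ} (i : Fin n) (v : Fin (n+1) → M) (a : M) : Fin n → M :=
  fun j => if j < i then v j.castSucc else if j = i then a else v j.succ

/-- `Ψ` represents `Φ ∘ᵢ E_V^{(2)}`, i.e. the map
`v ↦ E(Φ(v 1 ⊗ ⋯ ⊗ Y_V(v i, z i − ζ)Y_V(v (i+1), z (i+1) − ζ)𝟏 ⊗ ⋯ ⊗ v (n+1))(…,ζ,…))`. -/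
def RepCirc (A : MOSVA V) (B : Bimod A W) {n : ℕ} (i : Fin n)
    (Φ : (Fin n → V) → (Fin n → ℂ) → B.gr.Comp)
    (Ψ : (Fin (n+1) → V) → (Fin (n+1) → ℂ) → B.gr.Comp) : Prop :=
  (∀ v, B.gr.WTilde (Ψ v)) ∧
  ∀ (v : Fin (n+1) → V) (φ : W →ₗ[ℂ] ℂ), InGradedDual B.gr.proj φ →
    ∀ (z : Fin (n+1) → ℂ) (ζ : ℂ), Conf z → Conf (mergeAt i z ζ) →
      ‖z i.succ - ζ‖ < ‖z i.castSucc - ζ‖ → 0 < ‖z i.succ - ζ‖ →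
      (∀ j : Fin (n+1), j ≠ i.castSucc → j ≠ i.succ →
        ‖z i.castSucc - ζ‖ < ‖z j - z i.castSucc‖ ∧ ‖z i.succ - ζ‖ < ‖z j - z i.succ‖) →
      AbsConvTo (fun k : ℤ × ℤ =>
          B.gr.pair φ
            (Φ (mergeAt i v (A.Y (v i.castSucc) (A.Y (v i.succ) A.vac k.2) k.1))
              (mergeAt i z ζ))
            * (z i.castSucc - ζ) ^ (-k.1 - 1) * (z i.succ - ζ) ^ (-k.2 - 1))
        (B.gr.pair φ (Ψ v z))

/-- `Ψ` represents the coboundary `δ̂Φ = E_W^{(1,0)}∘₂Φ + Σᵢ (−1)^i Φ∘ᵢE_V^{(2)}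
+ (−1)^{n+1} E_W^{(0,1)}∘₂Φ` of the `n`-cochain `Φ`. -/
def IsDelta (A : MOSVA V) (B : Bimod A W) {n : ℕ}
    (Φ : (Fin n → V) → (Fin n → ℂ) → B.gr.Comp)
    (Ψ : (Fin (n+1) → V) → (Fin (n+1) → ℂ) → B.gr.Comp) : Prop :=
  ∃ (gL gR : (Fin (n+1) → V) → (Fin (n+1) → ℂ) → B.gr.Comp)
    (gC : Fin n → (Fin (n+1) → V) → (Fin (n+1) → ℂ) → B.gr.Comp),
    RepLeft A B Φ gL ∧ RepRight A B Φ gR ∧ (∀ i, RepCirc A B i Φ (gC i)) ∧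
    ∀ v z, Ψ v z = gL v z + (∑ i : Fin n, ((-1 : ℂ) ^ ((i : ℕ) + 1)) • gC i v z)
      + ((-1 : ℂ) ^ (n + 1)) • gR v z

end Cochains

section RationalExpansions

open Filter Topology
open scoped Pointwise

/-- The monomial `∏ xᵢ ^ (-Kᵢ - 1)`. -/
def pm {n : ℕ} (x : Fin n → ℂ) (K : Fin n → ℤ) : ℂ := ∏ i, x i ^ (-(K i) - 1)

/-- The monomial `z ^ (-k - 1)`. -/
def pw (z : ℂ) (k : ℤ) : ℂ := z ^ (-k - 1)

/-- The monomials `mon p i`, `p ∈ T`, determine the coefficients of absolutely convergent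
series. -/
def Det {P I : Type*} (mon : P → I → ℂ) (T : Set P) : Prop :=
  ∀ c : I → ℂ, (∀ p ∈ T, HasSum (fun i => c i * mon p i) 0) → c = 0

theorem det_torus {n : ℕ} (r : Fin n → ℝ) (hr : ∀ i, 0 < r i) :
    Det (pm (n := n)) {x | ∀ i, ‖x i‖ = r i} := by
  intro c h
  set ρ : (Fin n → ℤ) → ℂ := fun K => ∏ i, (r i : ℂ) ^ (-(K i) - 1) with hρ
  have hρ0 : ∀ K, ρ K ≠ 0 := fun K => Finset.prod_ne_zero_iff.2 fun i _ =>
    zpow_ne_zero _ (by exact_mod_cast (hr i).ne')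
  set σ : (Fin n → ℤ) → (Fin n → ℤ) := fun K i => -(K i) - 1 with hσ
  have hσi : Function.Injective σ := by
    intro K K' hK
    funext i
    have := congrFun hK i
    simp only [hσ] at this
    omega
  have hnorm : Summable fun K => ‖c K * ρ K‖ := by
    rw [summable_norm_iff]
    refine (h (fun i => (r i : ℂ)) ?_).summable
    intro i
    simp [abs_of_pos (hr i)]
  have hpt : ∀ t : UnitAddTorus (Fin n),
      HasSum (fun K => (c K * ρ K) * UnitAddTorus.mFourier (σ K) t) 0 := by
    intro t
    have h1 := h (fun i => (r i : ℂ) * (AddCircle.toCircle (t i) : ℂ)) (by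
      intro i
      rw [norm_mul, Circle.norm_coe, mul_one]
      simp [abs_of_pos (hr i)])
    convert h1 using 2 with K
    rw [pm, mul_assoc, hρ, UnitAddTorus.mFourier]
    simp only [mul_zpow, Finset.prod_mul_distrib, ContinuousMap.coe_mk]
    congr 2
    refine Finset.prod_congr rfl fun i _ => ?_
    rw [fourier_apply, AddCircle.toCircle_zsmul]
    simp [hσ]
  have hC : Summable (fun K => (c K * ρ K) • UnitAddTorus.mFourier (d := Fin n) (σ K)) := by
    refine Summable.of_norm ?_
    simpa [norm_smul, UnitAddTorus.mFourier_norm] using hnorm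
  have hC0 : HasSum (fun K => (c K * ρ K) • UnitAddTorus.mFourier (d := Fin n) (σ K)) 0 := by
    have h2 := hC.hasSum
    convert h2
    ext t
    have h3 := (ContinuousMap.evalCLM ℂ t).hasSum h2
    simp only [ContinuousMap.evalCLM_apply, ContinuousMap.smul_apply,
      smul_eq_mul] at h3
    exact (hpt t).unique h3
  have hL : HasSum (fun K => (c K * ρ K) • UnitAddTorus.mFourierLp (d := Fin n) 2 (σ K)) 0 := by
    let _ : MeasureTheory.MeasureSpace UnitAddCircle := ⟨AddCircle.haarAddCircle⟩
    have : MeasureTheory.IsProbabilityMeasure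
        (MeasureTheory.volume : MeasureTheory.Measure UnitAddCircle) :=
      inferInstanceAs (MeasureTheory.IsProbabilityMeasure AddCircle.haarAddCircle)
    have h7 := (ContinuousMap.toLp (E := ℂ) (p := 2)
      (MeasureTheory.volume : MeasureTheory.Measure (UnitAddTorus (Fin n))) ℂ).hasSum hC0
    simp only [map_smul, map_zero] at h7
    exact h7
  funext K₀
  have hin := (innerSL ℂ (UnitAddTorus.mFourierLp (d := Fin n) 2 (σ K₀))).hasSum hL
  simp only [map_smul, map_zero, smul_eq_mul, innerSL_apply_apply] at hin
  have h4 : HasSum (fun K => if K = K₀ then c K₀ * ρ K₀ else 0) 0 := by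
    suffices hs : (fun K => if K = K₀ then c K₀ * ρ K₀ else 0) = fun b => c b * ρ b * _ by
      rw [hs]
      exact hin
    funext K
    have h5 := orthonormal_iff_ite.1 (UnitAddTorus.orthonormal_mFourier (d := Fin n)) (σ K₀) (σ K)
    refine Eq.trans ?_ (congrArg (c K * ρ K * ·) h5.symm)
    by_cases hK : K = K₀
    · simp [hK]
    · simp [hK, hσi.ne_iff.2 (Ne.symm hK)]
  have h6 := h4.unique (hasSum_ite_eq K₀ _)
  simpa [hρ0 K₀] using h6.symm

theorem det_circle (r : ℝ) (hr : 0 < r) : Det pw {z | ‖z‖ = r} := by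
  intro c h
  have h1 := det_torus (n := 1) (fun _ => r) (fun _ => hr) (fun K => c (K 0)) (by
    intro x hx
    have h2 := h (x 0) (hx 0)
    have h3 := (Equiv.funUnique (Fin 1) ℤ).hasSum_iff.2 h2
    convert h3 using 2 with K
    simp [pm, pw])
  funext k
  exact congrFun h1 (fun _ => k)

theorem exp_mul_le_add {a x ε : ℝ} (h1 : -ε ≤ x) (h2 : x ≤ ε) :
    Real.exp (x * a) ≤ Real.exp (ε * a) + Real.exp (-ε * a) := by
  rcases le_total 0 a with ha | ha
  · have : Real.exp (x * a) ≤ Real.exp (ε * a) := Real.exp_le_exp.2 (by nlinarith)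
    have := Real.exp_pos (-ε * a)
    linarith
  · have : Real.exp (x * a) ≤ Real.exp (-ε * a) := Real.exp_le_exp.2 (by nlinarith)
    have := Real.exp_pos (ε * a)
    linarith

theorem norm_exp_le_corners (a b τ τ₀ : ℂ) (ε : ℝ) (h1 : |(τ - τ₀).re| ≤ ε)
    (h2 : |(τ - τ₀).im| ≤ ε) :
    ‖Complex.exp (a + τ * b)‖ ≤
      ‖Complex.exp (a + (τ₀ + ⟨ε, ε⟩) * b)‖ + ‖Complex.exp (a + (τ₀ + ⟨ε, -ε⟩) * b)‖ +
      ‖Complex.exp (a + (τ₀ + ⟨-ε, ε⟩) * b)‖ + ‖Complex.exp (a + (τ₀ + ⟨-ε, -ε⟩) * b)‖ := by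
  rw [abs_le] at h1 h2
  have e1 := exp_mul_le_add (a := b.re) h1.1 h1.2
  have e2 := exp_mul_le_add (a := -b.im) h2.1 h2.2
  have key : ∀ x y : ℝ, ‖Complex.exp (a + (τ₀ + ⟨x, y⟩) * b)‖ =
      Real.exp (a.re + (τ₀ * b).re) * (Real.exp (x * b.re) * Real.exp (y * -b.im)) := by
    intro x y
    rw [Complex.norm_exp, ← Real.exp_add, ← Real.exp_add]
    congr 1
    simp
    ring
  have hτ : τ = τ₀ + ⟨(τ - τ₀).re, (τ - τ₀).im⟩ := by
    apply Complex.ext <;> simp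
  rw [hτ, key, key, key, key, key, ← mul_add, ← mul_add, ← mul_add]
  refine mul_le_mul_of_nonneg_left ?_ (Real.exp_pos _).le
  have := mul_le_mul e1 e2 (Real.exp_pos _).le (by positivity)
  nlinarith

theorem pm_exp {n : ℕ} (s : Fin n → ℂ) (K : Fin n → ℤ) :
    pm (fun i => Complex.exp (s i)) K = Complex.exp (∑ i, ((-(K i) - 1 : ℤ) : ℂ) * s i) := by
  rw [Complex.exp_sum, pm]
  exact Finset.prod_congr rfl fun i _ => (Complex.exp_int_mul _ _).symm

theorem hasSum_zero_of_chain {n : ℕ} (c : (Fin n → ℤ) → ℂ)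
    (hs : ∀ y, OrderedPos y → Summable fun K => c K * pm y K)
    (y₀ : Fin n → ℂ) (hy₀ : OrderedPos y₀)
    (h0 : ∀ᶠ y in 𝓝 y₀, HasSum (fun K => c K * pm y K) 0)
    (y₁ : Fin n → ℂ) (hy₁ : OrderedPos y₁) : HasSum (fun K => c K * pm y₁ K) 0 := by
  set a : Fin n → ℂ := fun i => Complex.log (y₀ i) with ha
  set b : Fin n → ℂ := fun i => Complex.log (y₁ i) - Complex.log (y₀ i) with hb
  set y : ℂ → Fin n → ℂ := fun τ i => Complex.exp (a i + τ * b i) with hy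
  have hyc : Continuous y := by fun_prop
  have y_zero : y 0 = y₀ := by
    funext i
    simp [hy, ha, Complex.exp_log (norm_pos_iff.1 (hy₀.2 i))]
  have y_one : y 1 = y₁ := by
    funext i
    simp [hy, ha, hb, Complex.exp_log (norm_pos_iff.1 (hy₁.2 i))]
  set D : Set ℂ := {τ | ∀ i j : Fin n, i < j → (a j + τ * b j).re < (a i + τ * b i).re} with hD
  have memD : ∀ τ, τ ∈ D ↔ OrderedPos (y τ) := by
    intro τ
    simp [hD, hy, OrderedPos, Ordered, Complex.norm_exp, Real.exp_pos]
  have Dopen : IsOpen D := by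
    simp only [hD, Set.ofPred_forall]
    refine isOpen_iInter_of_finite fun i => isOpen_iInter_of_finite fun j =>
      isOpen_iInter_of_finite fun _ => isOpen_lt ?_ ?_ <;> fun_prop
  have Dconv : Convex ℝ D := by
    intro τ hτ τ' hτ' p q hp hq hpq i j hij
    have h1 := hτ i j hij
    have h2 := hτ' i j hij
    simp only [Complex.add_re, Complex.mul_re, Complex.real_smul, Complex.add_im, Complex.mul_im,
      Complex.ofReal_re, Complex.ofReal_im, zero_mul, sub_zero, add_zero] at h1 h2 ⊢
    have e : ∀ A B C D' : ℝ, A + B = (p + q) * A + B := by intros; rw [hpq]; ring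
    rw [← one_mul (a j).re, ← one_mul (a i).re, ← hpq]
    rcases hp.lt_or_eq with hp' | hp'
    · nlinarith
    · have : 0 < q := by linarith
      nlinarith
  have hterm : ∀ τ K, c K * pm (y τ) K =
      c K * Complex.exp ((∑ i, ((-(K i) - 1 : ℤ) : ℂ) * a i) +
        τ * ∑ i, ((-(K i) - 1 : ℤ) : ℂ) * b i) := by
    intro τ K
    rw [pm_exp, Finset.mul_sum, ← Finset.sum_add_distrib]
    congr 2
    exact Finset.sum_congr rfl fun i _ => by ring
  set F : ℂ → ℂ := fun τ => ∑' K, c K * pm (y τ) K with hF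
  have hdiff : DifferentiableOn ℂ F D := by
    intro τ₀ hτ₀
    obtain ⟨δ, hδ, hball⟩ := Metric.isOpen_iff.1 Dopen τ₀ hτ₀
    set ε := δ / 4 with hε
    have hε0 : 0 < ε := by positivity
    have corner : ∀ p q : ℝ, |p| = ε → |q| = ε → τ₀ + ⟨p, q⟩ ∈ D := by
      intro p q hp hq
      apply hball
      rw [Metric.mem_ball, dist_eq_norm]
      have := Complex.norm_le_abs_re_add_abs_im (τ₀ + ⟨p, q⟩ - τ₀)
      simp only [add_sub_cancel_left] at this ⊢
      rw [hp, hq] at this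
      linarith
    have hsm : ∀ p q : ℝ, |p| = ε → |q| = ε →
        Summable fun K => ‖c K‖ * ‖Complex.exp ((∑ i, ((-(K i) - 1 : ℤ) : ℂ) * a i) +
        (τ₀ + ⟨p, q⟩) * ∑ i, ((-(K i) - 1 : ℤ) : ℂ) * b i)‖ := by
      intro p q hp hq
      have := (hs _ ((memD _).1 (corner p q hp hq))).norm
      simpa only [hterm, norm_mul] using this
    have hεa : |ε| = ε := abs_of_pos hε0
    have hεb : |-ε| = ε := by rw [abs_neg, hεa]
    have hS := (((hsm ε ε hεa hεa).add (hsm ε (-ε) hεa hεb)).add (hsm (-ε) ε hεb hεa)).add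
      (hsm (-ε) (-ε) hεb hεb)
    have hd := Complex.differentiableOn_tsum_of_summable_norm (F := fun K τ => c K * pm (y τ) K)
      (U := Metric.ball τ₀ ε) hS (by
        intro K
        simp only [hterm]
        fun_prop) Metric.isOpen_ball (by
        intro K τ hτ
        rw [hterm, norm_mul, ← mul_add, ← mul_add, ← mul_add]
        rw [Metric.mem_ball, dist_eq_norm] at hτ
        refine mul_le_mul_of_nonneg_left (norm_exp_le_corners _ _ _ _ _ ?_ ?_) (norm_nonneg _)
        · exact (Complex.abs_re_le_norm _).trans hτ.le
        · exact (Complex.abs_im_le_norm _).trans hτ.le)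
    exact ((hd τ₀ (Metric.mem_ball_self hε0)).differentiableAt
      (Metric.isOpen_ball.mem_nhds (Metric.mem_ball_self hε0))).differentiableWithinAt
  have hF0 : F =ᶠ[𝓝 0] 0 := by
    have h1 : ∀ᶠ τ in 𝓝 0, HasSum (fun K => c K * pm (y τ) K) 0 :=
      hyc.continuousAt.eventually (by rw [y_zero]; exact h0)
    filter_upwards [h1] with τ hτ
    exact hτ.tsum_eq
  have D0 : (0 : ℂ) ∈ D := by rw [memD, y_zero]; exact hy₀
  have D1 : (1 : ℂ) ∈ D := by rw [memD, y_one]; exact hy₁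
  have hz := (hdiff.analyticOnNhd Dopen).eqOn_zero_of_preconnected_of_eventuallyEq_zero
    Dconv.isPreconnected D0 hF0 D1
  have hz' : ∑' K, c K * pm y₁ K = 0 := by
    rw [← y_one]
    exact hz
  rw [← hz']
  exact (hs y₁ hy₁).hasSum

/-- A Laurent series absolutely convergent on a chain region which vanishes near one point of
that region is zero. -/
theorem eq_zero_of_chain {n : ℕ} (c : (Fin n → ℤ) → ℂ)
    (hs : ∀ y, OrderedPos y → Summable fun K => c K * pm y K)
    (y₀ : Fin n → ℂ) (hy₀ : OrderedPos y₀)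
    (h0 : ∀ᶠ y in 𝓝 y₀, HasSum (fun K => c K * pm y K) 0) : c = 0 := by
  refine det_torus (fun i => ‖y₀ i‖) hy₀.2 c fun x hx => ?_
  refine hasSum_zero_of_chain c hs y₀ hy₀ h0 x ⟨fun i j hij => ?_, fun i => ?_⟩
  · rw [hx i, hx j]
    exact hy₀.1 i j hij
  · rw [hx i]
    exact hy₀.2 i

/-- The identity principle near `q₀` for series in the monomials `mon` converging on `Ω`. -/
def IdP {Q J : Type*} [TopologicalSpace Q] (mon : Q → J → ℂ) (Ω : Set Q) (q₀ : Q) : Prop :=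
  ∀ c : J → ℂ, (∀ q ∈ Ω, Summable fun j => c j * mon q j) →
    (∀ᶠ q in 𝓝 q₀, HasSum (fun j => c j * mon q j) 0) → c = 0

theorem idP_chain {n : ℕ} (y₀ : Fin n → ℂ) (hy₀ : OrderedPos y₀) :
    IdP (pm (n := n)) {y | OrderedPos y} y₀ :=
  fun c hs h0 => eq_zero_of_chain c hs y₀ hy₀ h0

theorem IdP.pull {Q Q' J J' : Type*} [TopologicalSpace Q] [TopologicalSpace Q']
    {mon : Q → J → ℂ} {Ω : Set Q} {q₀ : Q} (h : IdP mon Ω q₀) {mon' : Q' → J' → ℂ}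
    (σ : Q → Q') (hσ : ContinuousAt σ q₀) (e : J ≃ J') (hm : ∀ q j, mon' (σ q) (e j) = mon q j)
    {Ω' : Set Q'} (hΩ : ∀ q ∈ Ω, σ q ∈ Ω') : IdP mon' Ω' (σ q₀) := by
  intro c hs h0
  have h1 := h (fun j => c (e j)) (fun q hq => by
    have := e.summable_iff.2 (hs _ (hΩ q hq))
    refine this.congr fun j => ?_
    simp [hm]) (by
    filter_upwards [hσ.eventually h0] with q hq
    have := e.hasSum_iff.2 hq
    simpa [Function.comp_def, hm] using this)
  funext j
  simpa using congrFun h1 (e.symm j)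

theorem pm_cons {n : ℕ} (a : ℂ) (x : Fin n → ℂ) (k : ℤ) (K : Fin n → ℤ) :
    pm (Fin.cons a x : Fin (n+1) → ℂ) (Fin.cons k K : Fin (n+1) → ℤ) = pw a k * pm x K := by
  simp [pm, pw, Fin.prod_univ_succ]

/-- Split off the first entry of a tuple of integers. -/
def headTail (n : ℕ) : (Fin (n+1) → ℤ) ≃ ℤ × (Fin n → ℤ) :=
  (Fin.consEquiv fun _ => ℤ).symm

theorem headTail_symm_apply {n : ℕ} (k : ℤ) (K : Fin n → ℤ) :
    (headTail n).symm (k, K) = Fin.cons k K := rfl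

theorem headTail_apply {n : ℕ} (K : Fin (n+1) → ℤ) : headTail n K = (K 0, Fin.tail K) := rfl

/-- The monomials in two groups of variables. -/
def mm {n : ℕ} (q : ℂ × (Fin n → ℂ)) (k : ℤ × (Fin n → ℤ)) : ℂ := pw q.1 k.1 * pm q.2 k.2

/-- The monomials in two variables. -/
def m2 (q : ℂ × ℂ) (k : ℤ × ℤ) : ℂ := pw q.1 k.1 * pw q.2 k.2

theorem idP_cons {n : ℕ} (ξ : ℂ) (x : Fin n → ℂ) (h : OrderedPos (Fin.cons ξ x : Fin (n+1) → ℂ)) :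
    IdP (mm (n := n)) {q | OrderedPos (Fin.cons q.1 q.2 : Fin (n+1) → ℂ)} (ξ, x) := by
  have := (idP_chain _ h).pull (mon' := mm (n := n)) (fun y => (y 0, Fin.tail y))
    (by
      refine Continuous.continuousAt ?_
      refine (continuous_apply 0).prodMk (continuous_pi fun i => continuous_apply _))
    (headTail n) (fun q j => by
      rw [headTail_apply, mm, ← pm_cons, Fin.cons_self_tail, Fin.cons_self_tail])
    (Ω' := {q | OrderedPos (Fin.cons q.1 q.2 : Fin (n+1) → ℂ)}) (fun q hq => by
      simpa [Fin.cons_self_tail] using hq)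
  simpa using this

theorem idP_pair (a b : ℂ) (h1 : ‖b‖ < ‖a‖) (h2 : 0 < ‖b‖) :
    IdP m2 {q | ‖q.2‖ < ‖q.1‖ ∧ 0 < ‖q.2‖} (a, b) := by
  have h : OrderedPos ![a, b] := by
    refine ⟨fun i j hij => ?_, fun i => ?_⟩
    · fin_cases i <;> fin_cases j <;> simp_all
    · fin_cases i
      · exact h2.trans h1
      · exact h2
  have := (idP_chain _ h).pull (mon' := m2) (fun y => (y 0, y 1))
    (by
      refine Continuous.continuousAt ?_
      exact (continuous_apply 0).prodMk (continuous_apply 1))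
    (finTwoArrowEquiv ℤ) (fun q j => by simp [m2, pm, pw, Fin.prod_univ_two])
    (Ω' := {q | ‖q.2‖ < ‖q.1‖ ∧ 0 < ‖q.2‖}) (fun q hq => ⟨hq.1 0 1 (by simp), hq.2 1⟩)
  simpa using this

theorem hasSum_fiber {I J : Type*} {e : I → J → ℂ} {a : I → ℂ} {b : J → ℂ} {s : ℂ}
    (h : HasSum (fun k : I × J => e k.1 k.2 * (a k.1 * b k.2)) s) :
    HasSum (fun i => (∑' j, e i j * b j) * a i) s := by
  have h1 := h.prod_fiberwise (fun i => (h.summable.prod_factor i).hasSum)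
  convert h1 using 2 with i
  rw [mul_comm, ← tsum_mul_left]
  exact tsum_congr fun j => by ring

theorem summable_fiber {I J : Type*} {e : I → J → ℂ} {a : I → ℂ} {b : J → ℂ}
    (h : Summable (fun k : I × J => e k.1 k.2 * (a k.1 * b k.2))) (i : I) (hi : a i ≠ 0) :
    Summable fun j => e i j * b j := by
  have h1 := (h.prod_factor i).mul_left (a i)⁻¹
  refine h1.congr fun j => ?_
  field_simp

/-- Transfer of a series expansion: the expansion `e` of `R` in the slice variables and the
variables `q` has coefficient arrays agreeing with `g'` if its slices are computed by `g`. -/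
theorem transfer {P Q₁ Q₂ I J₁ J₂ : Type*} [TopologicalSpace Q₂]
    {mP : P → I → ℂ} {m₁ : Q₁ → J₁ → ℂ} {m₂ : Q₂ → J₂ → ℂ}
    {g : I → J₁ → ℂ} {g' e : I → J₂ → ℂ} {R : P → Q₂ → ℂ} {τ : Q₂ → Q₁} {Ω : Set Q₂}
    {U : Q₂ → Set P} {q₀ : Q₂} (hI : IdP m₂ Ω q₀)
    (he : ∀ q ∈ Ω, ∀ p ∈ U q,
      HasSum (fun k : I × J₂ => e k.1 k.2 * (mP p k.1 * m₂ q k.2)) (R p q))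
    (hU : ∀ q ∈ Ω, ∃ p ∈ U q, ∀ i, mP p i ≠ 0)
    (hg' : ∀ i, ∀ q ∈ Ω, Summable fun j => g' i j * m₂ q j)
    (hO : ∀ᶠ q in 𝓝 q₀, q ∈ Ω ∧ ∃ T ⊆ U q, Det mP T ∧
      (∀ p ∈ T, HasSum (fun k : I × J₁ => g k.1 k.2 * (mP p k.1 * m₁ (τ q) k.2)) (R p q)) ∧
      ∀ i, ∑' j, g i j * m₁ (τ q) j = ∑' j, g' i j * m₂ q j) : e = g' := by
  have hes : ∀ i, ∀ q ∈ Ω, Summable fun j => e i j * m₂ q j := by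
    intro i q hq
    obtain ⟨p, hp, hpi⟩ := hU q hq
    exact summable_fiber (he q hq p hp).summable i (hpi i)
  funext i
  have h0 := hI (fun j => e i j - g' i j) (fun q hq => by
    simpa only [sub_mul] using (hes i q hq).sub (hg' i q hq)) (by
    filter_upwards [hO] with q hq
    obtain ⟨hqΩ, T, hTU, hdet, hT, hgg⟩ := hq
    have h1 := hdet (fun i => ∑' j, e i j * m₂ q j - ∑' j, g i j * m₁ (τ q) j) (fun p hp => by
      have := (hasSum_fiber (he q hqΩ p (hTU hp))).sub (hasSum_fiber (hT p hp))
      simpa only [sub_mul, sub_self] using this)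
    have h2 := congrFun h1 i
    have h3 := (hes i q hqΩ).hasSum.sub (hg' i q hqΩ).hasSum
    rw [← hgg i] at h3
    simp only [Pi.zero_apply] at h2
    rw [h2] at h3
    simpa only [sub_mul] using h3)
  funext j
  exact sub_eq_zero.1 (congrFun h0 j)

section Expansions

variable {X ι : Type*} [Fintype ι]

/-- `g` is on `U` the absolutely convergent sum of Laurent monomials in the coordinates `Y`, with
nonnegative exponents at vanishing coordinates. -/
def Ex (Y : X → ι → ℂ) (U : Set X) (g : X → ℂ) : Prop :=
  ∃ (κ : Type) (c : κ → ℂ) (e : κ → ι → ℤ),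
    (∀ k, ∀ x ∈ U, ∀ i, Y x i = 0 → 0 ≤ e k i) ∧
    ∀ x ∈ U, HasSum (fun k => c k * ∏ i, Y x i ^ e k i) (g x)

/-- `g` is on `U` a multiple of a Laurent monomial in the coordinates `Y`. -/
def Mo (Y : X → ι → ℂ) (U : Set X) (g : X → ℂ) : Prop :=
  ∃ (c : ℂ) (e : ι → ℤ), (∀ x ∈ U, ∀ i, Y x i = 0 → 0 ≤ e i) ∧
    ∀ x ∈ U, g x = c * ∏ i, Y x i ^ e i

variable {Y : X → ι → ℂ} {U : Set X} {g h : X → ℂ}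

theorem zpow_add_of_nonneg_of_zero {y : ℂ} {a b : ℤ} (h : y = 0 → 0 ≤ a ∧ 0 ≤ b) :
    y ^ (a + b) = y ^ a * y ^ b := by
  refine zpow_add' ?_
  by_cases hy : y = 0
  · have := h hy
    right
    omega
  · exact Or.inl hy

theorem prod_zpow_add {y : ι → ℂ} {a b : ι → ℤ} (ha : ∀ i, y i = 0 → 0 ≤ a i)
    (hb : ∀ i, y i = 0 → 0 ≤ b i) :
    ∏ i, y i ^ (a + b) i = (∏ i, y i ^ a i) * ∏ i, y i ^ b i := by
  rw [← Finset.prod_mul_distrib]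
  exact Finset.prod_congr rfl fun i _ =>
    zpow_add_of_nonneg_of_zero fun hy => ⟨ha i hy, hb i hy⟩

theorem Mo.ex (hg : Mo Y U g) : Ex Y U g := by
  obtain ⟨c, e, h1, h2⟩ := hg
  refine ⟨Unit, fun _ => c, fun _ => e, fun _ => h1, fun x hx => ?_⟩
  rw [h2 x hx]
  exact hasSum_unique (fun _ : Unit => c * ∏ i, Y x i ^ e i)

theorem Mo.congr (hg : Mo Y U g) (hgh : ∀ x ∈ U, g x = h x) : Mo Y U h := by
  obtain ⟨c, e, h1, h2⟩ := hg
  exact ⟨c, e, h1, fun x hx => by rw [← hgh x hx, h2 x hx]⟩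

theorem Ex.congr (hg : Ex Y U g) (hgh : ∀ x ∈ U, g x = h x) : Ex Y U h := by
  obtain ⟨κ, c, e, h1, h2⟩ := hg
  exact ⟨κ, c, e, h1, fun x hx => by rw [← hgh x hx]; exact h2 x hx⟩

theorem Mo.const (a : ℂ) : Mo Y U fun _ => a :=
  ⟨a, 0, fun _ _ _ _ => le_rfl, fun x _ => by simp⟩

theorem Mo.coord (i : ι) : Mo Y U fun x => Y x i := by
  classical
  refine ⟨1, Pi.single i 1, fun x _ j _ => ?_, fun x _ => ?_⟩
  · by_cases hj : j = i
    · subst hj; simp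
    · simp [hj]
  · rw [one_mul, Finset.prod_eq_single i]
    · simp
    · intro j _ hj
      simp [hj]
    · simp

theorem Mo.coord_inv (i : ι) (hi : ∀ x ∈ U, Y x i ≠ 0) : Mo Y U fun x => (Y x i)⁻¹ := by
  classical
  refine ⟨1, Pi.single i (-1), fun x hx j hj0 => ?_, fun x _ => ?_⟩
  · by_cases hj : j = i
    · subst hj; exact absurd hj0 (hi x hx)
    · simp [hj]
  · rw [one_mul, Finset.prod_eq_single i]
    · simp
    · intro j _ hj
      simp [hj]
    · simp

theorem Mo.mul (hg : Mo Y U g) (hh : Mo Y U h) : Mo Y U fun x => g x * h x := by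
  obtain ⟨c, e, h1, h2⟩ := hg
  obtain ⟨d, f, h3, h4⟩ := hh
  refine ⟨c * d, e + f, fun x hx i hi => add_nonneg (h1 x hx i hi) (h3 x hx i hi), fun x hx => ?_⟩
  change g x * h x = _
  rw [h2 x hx, h4 x hx, prod_zpow_add (h1 x hx) (h3 x hx)]
  ring

theorem Mo.neg (hg : Mo Y U g) : Mo Y U fun x => -g x :=
  ((Mo.const (-1)).mul hg).congr fun x _ => by ring

theorem Mo.prod {α : Type*} (s : Finset α) {g : α → X → ℂ} (hg : ∀ a ∈ s, Mo Y U (g a)) :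
    Mo Y U fun x => ∏ a ∈ s, g a x := by
  classical
  induction s using Finset.induction_on with
  | empty => simpa using Mo.const 1
  | insert a s ha ih =>
    refine ((hg a (by simp)).mul (ih fun b hb => hg b (by simp [hb]))).congr fun x _ => ?_
    rw [Finset.prod_insert ha]

theorem Ex.add (hg : Ex Y U g) (hh : Ex Y U h) : Ex Y U fun x => g x + h x := by
  obtain ⟨κ, c, e, h1, h2⟩ := hg
  obtain ⟨κ', c', e', h3, h4⟩ := hh
  refine ⟨κ ⊕ κ', Sum.elim c c', Sum.elim e e', ?_, fun x hx => ?_⟩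
  · rintro (k | k)
    · exact h1 k
    · exact h3 k
  · exact HasSum.sum (h2 x hx) (h4 x hx)

theorem Ex.mul (hg : Ex Y U g) (hh : Ex Y U h) : Ex Y U fun x => g x * h x := by
  obtain ⟨κ, c, e, h1, h2⟩ := hg
  obtain ⟨κ', c', e', h3, h4⟩ := hh
  refine ⟨κ × κ', fun k => c k.1 * c' k.2, fun k => e k.1 + e' k.2, fun k x hx i hi =>
    add_nonneg (h1 k.1 x hx i hi) (h3 k.2 x hx i hi), fun x hx => ?_⟩
  have hs := summable_mul_of_summable_norm (h2 x hx).summable.norm (h4 x hx).summable.norm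
  have hm := (h2 x hx).mul (h4 x hx) hs
  have he : (fun k : κ × κ' => c k.1 * c' k.2 * ∏ i, Y x i ^ (e k.1 + e' k.2) i) =
      fun k => (c k.1 * ∏ i, Y x i ^ e k.1 i) * (c' k.2 * ∏ i, Y x i ^ e' k.2 i) := by
    funext k
    rw [prod_zpow_add (h1 k.1 x hx) (h3 k.2 x hx)]
    ring
  rw [he]
  exact hm

theorem Ex.const (a : ℂ) : Ex Y U fun _ => a := (Mo.const a).ex

theorem Ex.neg (hg : Ex Y U g) : Ex Y U fun x => -g x :=
  ((Ex.const (-1)).mul hg).congr fun x _ => by ring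

theorem Ex.pow (hg : Ex Y U g) (N : ℕ) : Ex Y U fun x => g x ^ N := by
  induction N with
  | zero => simpa using Ex.const 1
  | succ N ih => exact (ih.mul hg).congr fun x _ => (pow_succ _ _).symm

theorem Ex.prod {α : Type*} (s : Finset α) {g : α → X → ℂ} (hg : ∀ a ∈ s, Ex Y U (g a)) :
    Ex Y U fun x => ∏ a ∈ s, g a x := by
  classical
  induction s using Finset.induction_on with
  | empty => simpa using Ex.const 1
  | insert a s ha ih =>
    refine ((hg a (by simp)).mul (ih fun b hb => hg b (by simp [hb]))).congr fun x _ => ?_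
    rw [Finset.prod_insert ha]

theorem Ex.mvPoly {α : Type*} (p : MvPolynomial α ℂ) {l : X → α → ℂ}
    (hl : ∀ a, Ex Y U fun x => l x a) : Ex Y U fun x => MvPolynomial.eval (l x) p := by
  induction p using MvPolynomial.induction_on with
  | C a => simpa using Ex.const a
  | add p q hp hq => simpa using hp.add hq
  | mul_X p a hp => simpa using hp.mul (hl a)

/-- Geometric expansion. -/
theorem Ex.geom {T : Type} [Fintype T] {t : T → X → ℂ} (ht : ∀ a, Mo Y U (t a))
    (hlt : ∀ x ∈ U, ∑ a, ‖t a x‖ < 1) : Ex Y U fun x => (1 - ∑ a, t a x)⁻¹ := by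
  have hw : ∀ k : (N : ℕ) × (Fin N → T), Mo Y U fun x => ∏ i, t (k.2 i) x :=
    fun k => Mo.prod _ fun i _ => ht (k.2 i)
  choose c e h1 h2 using hw
  refine ⟨(N : ℕ) × (Fin N → T), c, e, h1, fun x hx => ?_⟩
  simp only [← h2 _ x hx]
  have hsum : Summable fun k : (N : ℕ) × (Fin N → T) => ‖∏ i, t (k.2 i) x‖ := by
    rw [summable_sigma_of_nonneg fun _ => norm_nonneg _]
    refine ⟨fun N => (hasSum_fintype _).summable, ?_⟩
    have : ∀ N : ℕ, ∑' s : Fin N → T, ‖∏ i, t (s i) x‖ = (∑ a, ‖t a x‖) ^ N := by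
      intro N
      rw [tsum_fintype, Fintype.sum_pow]
      simp only [norm_prod]
    simp only [this]
    exact summable_geometric_of_lt_one (Finset.sum_nonneg fun _ _ => norm_nonneg _) (hlt x hx)
  have hs := hsum.of_norm.hasSum
  have hn : ‖∑ a, t a x‖ < 1 := (norm_sum_le _ _).trans_lt (hlt x hx)
  have h3 := hs.sigma (g := fun N => (∑ a, t a x) ^ N) (fun N => by
    rw [Fintype.sum_pow]
    exact hasSum_fintype _)
  rw [← h3.unique (hasSum_geometric_of_norm_lt_one hn)]
  exact hs

/-- A function which has expansions together with its inverse. -/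
def ExI (Y : X → ι → ℂ) (U : Set X) (g : X → ℂ) : Prop := Ex Y U g ∧ Ex Y U fun x => (g x)⁻¹

theorem ExI.congr (hg : ExI Y U g) (hgh : ∀ x ∈ U, g x = h x) : ExI Y U h :=
  ⟨hg.1.congr hgh, hg.2.congr fun x hx => by rw [hgh x hx]⟩

theorem ExI.neg (hg : ExI Y U g) : ExI Y U fun x => -g x :=
  ⟨hg.1.neg, hg.2.neg.congr fun x _ => by rw [inv_neg]⟩

theorem ExI.coord (i : ι) (hi : ∀ x ∈ U, Y x i ≠ 0) : ExI Y U fun x => Y x i :=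
  ⟨(Mo.coord i).ex, (Mo.coord_inv i hi).ex⟩

/-- Sums dominated by a coordinate. -/
theorem ExI.dom {μ ν₁ ν₂ : X → ℂ} (h0 : Mo Y U μ) (h1 : Mo Y U fun x => (μ x)⁻¹)
    (h2 : Mo Y U ν₁) (h3 : Mo Y U ν₂) (hlt : ∀ x ∈ U, ‖ν₁ x‖ + ‖ν₂ x‖ < ‖μ x‖) :
    ExI Y U fun x => μ x + ν₁ x + ν₂ x := by
  refine ⟨(h0.ex.add h2.ex).add h3.ex, ?_⟩
  have hμ : ∀ x ∈ U, 0 < ‖μ x‖ := fun x hx =>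
    (add_nonneg (norm_nonneg _) (norm_nonneg _)).trans_lt (hlt x hx)
  have hg := Ex.geom (Y := Y) (U := U)
    (t := fun (b : Bool) x => -((cond b (ν₁ x) (ν₂ x)) * (μ x)⁻¹))
    (by
      rintro (_ | _)
      · exact (h3.mul h1).neg
      · exact (h2.mul h1).neg) (by
      intro x hx
      simp only [Fintype.sum_bool, cond_true, cond_false, norm_neg, norm_mul, norm_inv]
      rw [← add_mul, ← div_eq_mul_inv, div_lt_one (hμ x hx)]
      exact hlt x hx)
  refine (h1.ex.mul hg).congr fun x hx => ?_
  have h4 : μ x ≠ 0 := norm_pos_iff.1 (hμ x hx)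
  rw [← mul_inv]
  congr 1
  simp only [Fintype.sum_bool, cond_true, cond_false]
  field_simp
  ring

theorem ExI.dom₁ {μ ν : X → ℂ} (h0 : Mo Y U μ) (h1 : Mo Y U fun x => (μ x)⁻¹)
    (h2 : Mo Y U ν) (hlt : ∀ x ∈ U, ‖ν x‖ < ‖μ x‖) : ExI Y U fun x => μ x + ν x :=
  (ExI.dom h0 h1 h2 (Mo.const 0) (by simpa using hlt)).congr fun x _ => by simp

theorem ex_prod_offDiag {α : Type*} [Fintype α] [DecidableEq α] {l : X → α → ℂ} (b : α → α → ℕ)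
    (hd : ∀ i j, i ≠ j → Ex Y U fun x => (l x i - l x j)⁻¹) :
    Ex Y U fun x => (∏ q ∈ Finset.univ.offDiag, (l x q.1 - l x q.2) ^ b q.1 q.2)⁻¹ := by
  have := Ex.prod (Y := Y) (U := U) (Finset.univ.offDiag)
    (g := fun q x => (l x q.1 - l x q.2)⁻¹ ^ b q.1 q.2)
    (fun q hq => (hd q.1 q.2 (Finset.mem_offDiag.1 hq).2.2).pow _)
  refine this.congr fun x _ => ?_
  simp only [inv_pow, Finset.prod_inv_distrib]

theorem DiagRatFn.ex {α : Type*} [Fintype α] [DecidableEq α] (R : DiagRatFn α) {l : X → α → ℂ}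
    (hl : ∀ a, Ex Y U fun x => l x a)
    (hd : ∀ i j, i ≠ j → Ex Y U fun x => (l x i - l x j)⁻¹) : Ex Y U fun x => R.eval (l x) :=
  ((Ex.mvPoly R.num hl).mul (ex_prod_offDiag R.b hd)).congr fun x _ => by
    rw [DiagRatFn.eval, div_eq_mul_inv]

theorem RatFn.ex {α : Type*} [Fintype α] [DecidableEq α] (R : RatFn α) {l : X → α → ℂ}
    (hl : ∀ a, ExI Y U fun x => l x a)
    (hd : ∀ i j, i ≠ j → Ex Y U fun x => (l x i - l x j)⁻¹) : Ex Y U fun x => R.eval (l x) := by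
  have h1 := Ex.prod (Y := Y) (U := U) Finset.univ (g := fun a x => (l x a)⁻¹ ^ R.a a)
    (fun a _ => (hl a).2.pow _)
  refine ((Ex.mvPoly R.num fun a => (hl a).1).mul (h1.mul (ex_prod_offDiag R.b hd))).congr
    fun x _ => ?_
  rw [RatFn.eval, div_eq_mul_inv, mul_inv]
  simp only [inv_pow, Finset.prod_inv_distrib]

theorem ex_diff_cons {n : ℕ} {a : X → ℂ} {v : X → Fin n → ℂ}
    (h0 : ∀ j, ExI Y U fun x => a x - v x j)
    (h1 : ∀ i j, i < j → ExI Y U fun x => v x i - v x j) :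
    ∀ i j, i < j → ExI Y U fun x =>
      (Fin.cons (a x) (v x) : Fin (n+1) → ℂ) i - (Fin.cons (a x) (v x) : Fin (n+1) → ℂ) j := by
  intro i j hij
  induction i using Fin.cases with
  | zero =>
    induction j using Fin.cases with
    | zero => exact absurd hij (lt_irrefl _)
    | succ j => simpa using h0 j
  | succ i =>
    induction j using Fin.cases with
    | zero => exact absurd hij (by simp)
    | succ j => simpa using h1 i j (by simpa using hij)

theorem ex_inv_of_lt {n : ℕ} {l : X → Fin n → ℂ}
    (h : ∀ i j, i < j → ExI Y U fun x => l x i - l x j) (i j : Fin n) (hij : i ≠ j) :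
    Ex Y U fun x => (l x i - l x j)⁻¹ := by
  rcases lt_or_gt_of_ne hij with h1 | h1
  · exact (h i j h1).2
  · refine (h j i h1).neg.2.congr fun x _ => ?_
    change (-(l x j - l x i))⁻¹ = _
    rw [neg_sub]

/-- The coefficient array of an expansion. -/
theorem Ex.array (hg : Ex Y U g) : ∃ a : (ι → ℤ) → ℂ,
    ∀ x ∈ U, HasSum (fun K => a K * ∏ i, Y x i ^ (-(K i) - 1)) (g x) := by
  obtain ⟨κ, c, e, h1, h2⟩ := hg
  set σ : κ → ι → ℤ := fun k i => -(e k i) - 1 with hσ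
  refine ⟨fun K => ∑' k : {k // σ k = K}, c k.1, fun x hx => ?_⟩
  have h3 := (Equiv.sigmaFiberEquiv σ).hasSum_iff.2 (h2 x hx)
  have h4 := h3.sigma (fun K => (h3.summable.sigma_factor K).hasSum)
  convert h4 using 2 with K
  rw [← tsum_mul_right]
  refine tsum_congr fun k => ?_
  simp only [Function.comp_apply, Equiv.sigmaFiberEquiv_apply]
  congr 1
  refine Finset.prod_congr rfl fun i _ => ?_
  have := congrFun k.2 i
  simp only [hσ] at this
  rw [← this]
  congr 1
  ring

end Expansions

theorem Ex.array_fin {X : Type*} {n : ℕ} {Y : X → Fin n → ℂ} {U : Set X} {g : X → ℂ}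
    (hg : Ex Y U g) : ∃ a : (Fin n → ℤ) → ℂ,
    ∀ x ∈ U, HasSum (fun K => a K * pm (Y x) K) (g x) := hg.array

theorem hasSum_headTail {n : ℕ} {c : (Fin (n+1) → ℤ) → ℂ} {s a : ℂ} {v : Fin n → ℂ} :
    HasSum (fun K => c K * pm (Fin.cons a v : Fin (n+1) → ℂ) K) s ↔
    HasSum (fun k : ℤ × (Fin n → ℤ) => c (Fin.cons k.1 k.2) * mm (a, v) k) s := by
  rw [← (headTail n).symm.hasSum_iff]
  refine Iff.of_eq (congrArg (fun f => HasSum f s) ?_)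
  funext k
  obtain ⟨k, K⟩ := k
  simp only [Function.comp_apply, headTail_symm_apply, pm_cons, mm]

theorem Ex.array_cons {X : Type*} {n : ℕ} {a : X → ℂ} {v : X → Fin n → ℂ} {U : Set X} {g : X → ℂ}
    (hg : Ex (fun x => (Fin.cons (a x) (v x) : Fin (n+1) → ℂ)) U g) :
    ∃ C : ℤ × (Fin n → ℤ) → ℂ, ∀ x ∈ U, HasSum (fun k => C k * mm (a x, v x) k) (g x) := by
  obtain ⟨c, hc⟩ := hg.array_fin
  exact ⟨fun k => c (Fin.cons k.1 k.2), fun x hx => hasSum_headTail.1 (hc x hx)⟩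

theorem Ex.array_cons₂ {X : Type*} {n : ℕ} {a b : X → ℂ} {v : X → Fin n → ℂ} {U : Set X}
    {g : X → ℂ}
    (hg : Ex (fun x => (Fin.cons (a x) (Fin.cons (b x) (v x) : Fin (n+1) → ℂ) :
      Fin (n+2) → ℂ)) U g) :
    ∃ C : ℤ → ℤ × (Fin n → ℤ) → ℂ, ∀ x ∈ U,
      HasSum (fun k : ℤ × ℤ × (Fin n → ℤ) => C k.1 k.2 * (pw (a x) k.1 * mm (b x, v x) k.2))
        (g x) := by
  obtain ⟨c, hc⟩ := hg.array_cons
  refine ⟨fun k l => c (k, (headTail n).symm l), fun x hx => ?_⟩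
  have h1 := ((Equiv.refl ℤ).prodCongr (headTail n).symm).hasSum_iff.2 (hc x hx)
  convert h1 using 2 with k
  obtain ⟨k, l, K⟩ := k
  simp only [Function.comp_apply, Equiv.prodCongr_apply, Prod.map_apply, Equiv.refl_apply,
    headTail_symm_apply]
  simp only [mm, pm_cons]

section Weights

/-- A family of projections onto the weight spaces, with weights `w`. -/
structure IsGr {ι M : Type*} [AddCommGroup M] [Module ℂ M] (w : ι → ℂ)
    (p : ι → M →ₗ[ℂ] M) : Prop where
  inj : Function.Injective w
  comp : ∀ m n, m ≠ n → ∀ x, p m (p n x) = 0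
  idem : ∀ (n : ι) (x : M), p n (p n x) = p n x
  finite : ∀ x, (Function.support fun n => p n x).Finite
  sum : ∀ x, ∑ᶠ n, p n x = x

variable {ι M : Type*} [AddCommGroup M] [Module ℂ M] {w : ι → ℂ} {p : ι → M →ₗ[ℂ] M}

/-- The weights of `x` lie in `S`. -/
def Wt (w : ι → ℂ) (p : ι → M →ₗ[ℂ] M) (x : M) (S : Set ℂ) : Prop :=
  ∀ n, p n x ≠ 0 → w n ∈ S

theorem Wt.mono {x : M} {S T : Set ℂ} (h : Wt w p x S) (hST : S ⊆ T) : Wt w p x T :=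
  fun n hn => hST (h n hn)

theorem Wt.zero (S : Set ℂ) : Wt w p 0 S := fun _ hn => absurd (map_zero _) hn

theorem Wt.add {x y : M} {S : Set ℂ} (hx : Wt w p x S) (hy : Wt w p y S) : Wt w p (x + y) S := by
  intro n hn
  by_contra hS
  have h1 : p n x = 0 := by_contra fun h => hS (hx n h)
  have h2 : p n y = 0 := by_contra fun h => hS (hy n h)
  exact hn (by rw [map_add, h1, h2, add_zero])

theorem Wt.smul {x : M} {S : Set ℂ} (c : ℂ) (hx : Wt w p x S) : Wt w p (c • x) S := by
  intro n hn
  refine hx n fun h => hn ?_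
  rw [map_smul, h, smul_zero]

theorem Wt.finsum {α : Type*} {f : α → M} {S : Set ℂ} (h : ∀ a, Wt w p (f a) S) :
    Wt w p (∑ᶠ a, f a) S :=
  finsum_induction (fun x => Wt w p x S) (Wt.zero S) (fun _ _ => Wt.add) h

theorem IsGr.wt_proj (h : IsGr w p) (n : ι) (x : M) : Wt w p (p n x) {w n} := by
  intro m hm
  by_contra hS
  exact hm (h.comp m n (fun e => hS (by simp [e])) x)

theorem IsGr.wt_self (h : IsGr w p) (x : M) :
    ∃ S : Set ℂ, S.Finite ∧ Wt w p x S :=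
  ⟨w '' Function.support fun n => p n x, (h.finite x).image w, fun n hn => ⟨n, hn, rfl⟩⟩

theorem IsGr.wt_induction (h : IsGr w p) {N : Type*} [AddCommGroup N] [Module ℂ N]
    {P : N → Prop} (h0 : P 0) (hadd : ∀ x y, P x → P y → P (x + y)) (L : M →ₗ[ℂ] N) (x : M)
    (hx : ∀ n, p n x ≠ 0 → P (L (p n x))) : P (L x) := by
  have h1 := L.toAddMonoidHom.map_finsum (h.finite x)
  rw [h.sum x] at h1
  change L x = ∑ᶠ n, L (p n x) at h1
  rw [h1]
  refine finsum_induction P h0 (fun _ _ => hadd _ _) fun n => ?_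
  by_cases hn : p n x = 0
  · rw [hn, map_zero]
    exact h0
  · exact hx n hn

theorem IsGr.proj_d (h : IsGr w p) (m : ι) (x : M) :
    p m (∑ᶠ n, w n • p n x) = w m • p m x := by
  have hf : (Function.support fun n => w n • p n x).Finite :=
    (h.finite x).subset fun n hn hn' => hn (by
      change p n x = 0 at hn'
      change w n • p n x = 0
      rw [hn', smul_zero])
  have h1 := (p m).toAddMonoidHom.map_finsum hf
  change p m (∑ᶠ n, w n • p n x) = ∑ᶠ n, p m (w n • p n x) at h1
  rw [h1, finsum_eq_single _ m]
  · rw [map_smul, h.idem]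
  · intro n hn
    rw [map_smul, h.comp m n hn.symm, smul_zero]

theorem IsGr.d_proj (h : IsGr w p) (m : ι) (x : M) :
    ∑ᶠ n, w n • p n (p m x) = w m • p m x := by
  rw [finsum_eq_single _ m]
  · rw [h.idem]
  · intro n hn
    rw [h.comp n m hn, smul_zero]

theorem IsGr.wt_of_eigen (h : IsGr w p) {x : M} {c : ℂ} (hx : ∑ᶠ n, w n • p n x = c • x) :
    Wt w p x {c} := by
  intro m hm
  have h1 := h.proj_d m x
  rw [hx, map_smul] at h1
  have h2 : (c - w m) • p m x = 0 := by rw [sub_smul, h1, sub_self]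
  rcases smul_eq_zero.1 h2 with h3 | h3
  · exact (sub_eq_zero.1 h3).symm
  · exact absurd h3 hm

theorem IsGr.wt_bilin {ι₁ ι₂ M₁ M₂ : Type*} [AddCommGroup M₁] [Module ℂ M₁] [AddCommGroup M₂]
    [Module ℂ M₂] {w₁ : ι₁ → ℂ} {p₁ : ι₁ → M₁ →ₗ[ℂ] M₁} {w₂ : ι₂ → ℂ} {p₂ : ι₂ → M₂ →ₗ[ℂ] M₂}
    (h : IsGr w p) (h₁ : IsGr w₁ p₁) (h₂ : IsGr w₂ p₂) (T : M₁ →ₗ[ℂ] M₂ →ₗ[ℂ] M) (c : ℂ)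
    (hT : ∀ x y, ∑ᶠ n, w n • p n (T x y) =
      T (∑ᶠ n, w₁ n • p₁ n x) y + c • T x y + T x (∑ᶠ n, w₂ n • p₂ n y))
    {x : M₁} {y : M₂} {S S' : Set ℂ} (hx : Wt w₁ p₁ x S) (hy : Wt w₂ p₂ y S') :
    Wt w p (T x y) (S + S' + {c}) := by
  refine h₁.wt_induction (P := fun z => Wt w p z (S + S' + {c})) (Wt.zero _)
    (fun _ _ => Wt.add) (T.flip y) x fun a ha => ?_
  change Wt w p (T (p₁ a x) y) _
  refine h₂.wt_induction (P := fun z => Wt w p z (S + S' + {c})) (Wt.zero _)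
    (fun _ _ => Wt.add) (T (p₁ a x)) y fun b hb => ?_
  refine (h.wt_of_eigen (c := w₁ a + w₂ b + c) ?_).mono ?_
  · rw [hT, h₁.d_proj, h₂.d_proj, map_smul, map_smul, LinearMap.smul_apply]
    module
  · rw [Set.singleton_subset_iff]
    exact Set.add_mem_add (Set.add_mem_add (hx a ha) (hy b hb)) rfl

/-- `φ` vanishes on the weight spaces with weight outside `C`. -/
def Kills (w : ι → ℂ) (p : ι → M →ₗ[ℂ] M) (φ : M →ₗ[ℂ] ℂ) (C : Set ℂ) : Prop :=
  ∀ n, w n ∉ C → ∀ x, φ (p n x) = 0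

theorem kills_of_inGradedDual {φ : M →ₗ[ℂ] ℂ} (hφ : InGradedDual p φ) :
    ∃ C : Set ℂ, C.Finite ∧ Kills w p φ C := by
  refine ⟨w '' Function.support fun n => φ ∘ₗ p n, Set.Finite.image w hφ, fun n hn x => ?_⟩
  by_contra hx
  refine hn ⟨n, fun h0 => hx ?_, rfl⟩
  exact congrArg (fun L : M →ₗ[ℂ] ℂ => L x) h0

theorem IsGr.inGradedDual (h : IsGr w p) {φ : M →ₗ[ℂ] ℂ} {C : Set ℂ} (hC : C.Finite)
    (hφ : Kills w p φ C) : InGradedDual p φ := by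
  refine (hC.preimage h.inj.injOn).subset fun n hn => ?_
  by_contra hnC
  exact hn (LinearMap.ext fun x => hφ n hnC x)

theorem IsGr.apply_eq_zero (h : IsGr w p) {φ : M →ₗ[ℂ] ℂ} {C S : Set ℂ} (hφ : Kills w p φ C)
    {x : M} (hx : Wt w p x S) (hd : Disjoint S C) : φ x = 0 :=
  h.wt_induction (P := fun z : ℂ => z = 0) rfl (fun _ _ h1 h2 => by rw [h1, h2, add_zero]) φ x
    fun n hn => hφ n (Set.disjoint_left.1 hd (hx n hn)) x

theorem IsGr.inGradedDual_comp {ι' M' : Type*} [AddCommGroup M'] [Module ℂ M'] {w' : ι' → ℂ}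
    {p' : ι' → M' →ₗ[ℂ] M'} (h : IsGr w p) (h' : IsGr w' p') {φ : M →ₗ[ℂ] ℂ}
    (hφ : InGradedDual p φ) (L : M' →ₗ[ℂ] M) {S : Set ℂ} (hS : S.Finite)
    (hL : ∀ x T, Wt w' p' x T → Wt w p (L x) (S + T)) : InGradedDual p' (φ ∘ₗ L) := by
  obtain ⟨C, hC, hk⟩ := kills_of_inGradedDual (w := w) hφ
  refine h'.inGradedDual (C := C - S) (hC.sub hS) fun n hn x => ?_
  refine h.apply_eq_zero hk (hL _ _ (h'.wt_proj n x)) ?_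
  rw [Set.disjoint_left]
  rintro _ ⟨s, hs, t, rfl, rfl⟩ hc
  refine hn ⟨_, hc, s, hs, ?_⟩
  simp

end Weights

section Ops

variable {V : Type*} [AddCommGroup V] [Module ℂ V]
variable {W : Type*} [AddCommGroup W] [Module ℂ W] {A : MOSVA V}

/-- The weights of `V`. -/
abbrev wV (n : ℤ) : ℂ := (n : ℂ)

/-- The weights of `W`. -/
abbrev wW (n : ℂ) : ℂ := n

theorem ZGrading.isGr (G : ZGrading V) : IsGr wV G.proj where
  inj := Int.cast_injective
  comp m n hmn x := by
    have := congrArg (fun L : V →ₗ[ℂ] V => L x) (G.proj_comp m n)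
    simpa [hmn] using this
  idem n x := by
    have := congrArg (fun L : V →ₗ[ℂ] V => L x) (G.proj_comp n n)
    simpa using this
  finite := G.proj_finite
  sum := G.proj_sum

theorem CGrading.isGr (G : CGrading W) : IsGr wW G.proj where
  inj := Function.injective_id
  comp m n hmn x := by
    have := congrArg (fun L : W →ₗ[ℂ] W => L x) (G.proj_comp m n)
    simpa [hmn] using this
  idem n x := by
    have := congrArg (fun L : W →ₗ[ℂ] W => L x) (G.proj_comp n n)
    simpa using this
  finite := G.proj_finite
  sum := G.proj_sum

/-- The coefficient of a vertex operator as a bilinear map. -/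
def coef {M₁ M₂ M : Type*} [AddCommGroup M₁] [Module ℂ M₁] [AddCommGroup M₂] [Module ℂ M₂]
    [AddCommGroup M] [Module ℂ M] (T : M₁ →ₗ[ℂ] M₂ →ₗ[ℂ] (ℤ → M)) (k : ℤ) :
    M₁ →ₗ[ℂ] M₂ →ₗ[ℂ] M :=
  T.compr₂ (LinearMap.proj k)

theorem MOSVA.wt_Y (A : MOSVA V) {u v : V} {S T : Set ℂ} (hu : Wt wV A.gr.proj u S)
    (hv : Wt wV A.gr.proj v T) (k : ℤ) :
    Wt wV A.gr.proj (A.Y u v k) (S + T + {-(k : ℂ) - 1}) :=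
  A.gr.isGr.wt_bilin A.gr.isGr A.gr.isGr (coef A.Y k) _ (fun x y => A.d_comm x y k) hu hv

theorem Bimod.wt_YR (B : Bimod A W) {w : W} {v : V} {S T : Set ℂ} (hw : Wt wW B.gr.proj w S)
    (hv : Wt wV A.gr.proj v T) (k : ℤ) :
    Wt wW B.gr.proj (B.YR w v k) (S + T + {-(k : ℂ) - 1}) :=
  B.gr.isGr.wt_bilin B.gr.isGr A.gr.isGr (coef B.YR k) _ (fun x y => B.d_commR x y k) hw hv

theorem Bimod.wt_DW (B : Bimod A W) {w : W} {S : Set ℂ} (hw : Wt wW B.gr.proj w S) :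
    Wt wW B.gr.proj (B.DW w) (S + {1}) := by
  refine B.gr.isGr.wt_induction (P := fun z => Wt wW B.gr.proj z (S + {1})) (Wt.zero _)
    (fun _ _ => Wt.add) B.DW w fun n hn => ?_
  have h1 := congrArg (fun L : W →ₗ[ℂ] W => L w) (B.DW_wt n)
  simp only [LinearMap.comp_apply] at h1
  rw [h1]
  refine (B.gr.isGr.wt_proj _ _).mono ?_
  rw [Set.singleton_subset_iff]
  exact Set.add_mem_add (hw n hn) rfl

theorem Bimod.wt_DW_pow (B : Bimod A W) {w : W} {S : Set ℂ} (hw : Wt wW B.gr.proj w S) (m : ℕ) :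
    Wt wW B.gr.proj ((B.DW ^ m) w) (S + {(m : ℂ)}) := by
  induction m with
  | zero => simpa using hw
  | succ m ih =>
    rw [pow_succ', Module.End.mul_apply]
    refine (B.wt_DW ih).mono ?_
    rw [add_assoc, Set.singleton_add_singleton]
    push_cast
    rfl

theorem Bimod.YsR_support (B : Bimod A W) (v : V) (w : W) (k : ℤ) :
    (Function.support fun m : ℕ => (((-1 : ℂ) ^ (k + (m : ℤ) + 1)) * ((m.factorial : ℂ))⁻¹) •
    ((B.DW ^ m) (B.YR w v (k + (m : ℤ))))).Finite := by
  obtain ⟨N, hN⟩ := B.truncR w v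
  refine (Set.finite_lt_nat (N - k).toNat).subset fun m hm => ?_
  by_contra hlt
  simp only [Set.mem_ofPred_eq, not_lt] at hlt
  exact hm (by
    change _ • ((B.DW ^ m) (B.YR w v (k + (m : ℤ)))) = 0
    rw [hN _ (by omega), map_zero, smul_zero])

/-- The coefficients of the opposite right vertex operator map as bilinear maps. -/
def Bimod.sR (B : Bimod A W) (k : ℤ) : V →ₗ[ℂ] W →ₗ[ℂ] W :=
  LinearMap.mk₂ ℂ (fun v w => B.YsR v w k)
    (fun v v' w => by
      simp only [Bimod.YsR]
      rw [← finsum_add_distrib (B.YsR_support v w k) (B.YsR_support v' w k)]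
      exact finsum_congr fun m => by simp [smul_add])
    (fun c v w => by
      simp only [Bimod.YsR]
      rw [smul_finsum' c (B.YsR_support v w k)]
      exact finsum_congr fun m => by simp [smul_comm c])
    (fun v w w' => by
      simp only [Bimod.YsR]
      rw [← finsum_add_distrib (B.YsR_support v w k) (B.YsR_support v w' k)]
      exact finsum_congr fun m => by simp [smul_add])
    (fun c v w => by
      simp only [Bimod.YsR]
      rw [smul_finsum' c (B.YsR_support v w k)]
      exact finsum_congr fun m => by simp [smul_comm c])

theorem Bimod.wt_sR (B : Bimod A W) {w : W} {v : V} {S T : Set ℂ} (hv : Wt wV A.gr.proj v S)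
    (hw : Wt wW B.gr.proj w T) (k : ℤ) :
    Wt wW B.gr.proj (B.YsR v w k) (S + T + {-(k : ℂ) - 1}) := by
  refine Wt.finsum fun m => Wt.smul _ ((B.wt_DW_pow (B.wt_YR hw hv _) m).mono ?_)
  rw [add_assoc, Set.singleton_add_singleton, add_comm T S]
  refine Set.add_subset_add_left ?_
  simp
  ring

theorem MOSVA.dual_Y (A : MOSVA V) {ψ : V →ₗ[ℂ] ℂ} (hψ : InGradedDual A.gr.proj ψ) (u : V)
    (k : ℤ) : InGradedDual A.gr.proj (ψ ∘ₗ coef A.Y k u) := by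
  obtain ⟨S, hS, hu⟩ := A.gr.isGr.wt_self u
  refine A.gr.isGr.inGradedDual_comp A.gr.isGr hψ _ (hS.add (Set.finite_singleton (-(k : ℂ) - 1)))
    fun x T hx => (A.wt_Y hu hx k).mono ?_
  rw [add_right_comm]

theorem Bimod.dual_sR (B : Bimod A W) {φ : W →ₗ[ℂ] ℂ} (hφ : InGradedDual B.gr.proj φ) (v : V)
    (k : ℤ) : InGradedDual B.gr.proj (φ ∘ₗ B.sR k v) := by
  obtain ⟨S, hS, hv⟩ := A.gr.isGr.wt_self v
  refine B.gr.isGr.inGradedDual_comp B.gr.isGr hφ _ (hS.add (Set.finite_singleton (-(k : ℂ) - 1)))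
    fun x T hx => (B.wt_sR hv hx k).mono ?_
  rw [add_right_comm]

theorem Bimod.dual_sR_flip (B : Bimod A W) {φ : W →ₗ[ℂ] ℂ} (hφ : InGradedDual B.gr.proj φ) (w : W)
    (k : ℤ) : InGradedDual A.gr.proj (φ ∘ₗ (B.sR k).flip w) := by
  obtain ⟨S, hS, hw⟩ := B.gr.isGr.wt_self w
  refine B.gr.isGr.inGradedDual_comp A.gr.isGr hφ _ (hS.add (Set.finite_singleton (-(k : ℂ) - 1)))
    fun x T hx => (B.wt_sR hx hw k).mono ?_
  rw [add_comm T S, add_right_comm]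

theorem Bimod.dual_DW (B : Bimod A W) {φ : W →ₗ[ℂ] ℂ} (hφ : InGradedDual B.gr.proj φ) (m : ℕ) :
    InGradedDual B.gr.proj (φ ∘ₗ (B.DW ^ m)) := by
  refine B.gr.isGr.inGradedDual_comp B.gr.isGr hφ _ (Set.finite_singleton (m : ℂ))
    fun x T hx => (B.wt_DW_pow hx m).mono ?_
  rw [add_comm]

theorem Bimod.exists_DW_bound (B : Bimod A W) {φ : W →ₗ[ℂ] ℂ} (hφ : InGradedDual B.gr.proj φ) :
    ∃ M : ℕ, ∀ m, M ≤ m → ∀ w, φ ((B.DW ^ m) w) = 0 := by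
  obtain ⟨C, hC, hk⟩ := kills_of_inGradedDual (w := wW) hφ
  obtain ⟨b, hb⟩ := B.gr.lower_bound
  obtain ⟨c, hc⟩ := (hC.image Complex.re).bddAbove
  obtain ⟨M, hM⟩ := exists_nat_gt (c - b)
  refine ⟨M, fun m hm w => ?_⟩
  have hw : Wt wW B.gr.proj w {n | b ≤ n.re} := by
    intro n hn
    by_contra h
    exact hn (by rw [hb n (by simpa using h), LinearMap.zero_apply])
  refine B.gr.isGr.apply_eq_zero hk (B.wt_DW_pow hw m) ?_
  rw [Set.disjoint_left]
  rintro _ ⟨n, hn, _, rfl, rfl⟩ hnC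
  have h1 := hc ⟨_, hnC, rfl⟩
  simp only [Complex.add_re, Complex.natCast_re] at h1
  have h2 : b ≤ n.re := hn
  have h3 : (M : ℝ) ≤ m := by exact_mod_cast hm
  linarith

theorem Bimod.apply_YsR (B : Bimod A W) {φ : W →ₗ[ℂ] ℂ} {M : ℕ}
    (hM : ∀ m, M ≤ m → ∀ w, φ ((B.DW ^ m) w) = 0) (v : V) (w : W) (k : ℤ) :
    φ (B.YsR v w k) = ∑ m ∈ Finset.range M, ((-1 : ℂ) ^ (k + (m : ℤ) + 1)) *
      ((m.factorial : ℂ))⁻¹ * φ ((B.DW ^ m) (B.YR w v (k + (m : ℤ)))) := by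
  have h1 := φ.toAddMonoidHom.map_finsum (B.YsR_support v w k)
  change φ (B.YsR v w k) = ∑ᶠ m : ℕ, φ (_ • _) at h1
  rw [h1, finsum_eq_sum_of_support_subset (s := Finset.range M)]
  · exact Finset.sum_congr rfl fun m _ => by rw [map_smul, smul_eq_mul]
  · intro m hm
    by_contra hlt
    refine hm ?_
    change φ (_ • _) = 0
    rw [map_smul, hM m (by simpa using hlt), smul_zero]

theorem neg_one_zpow_mul_pw {ζ : ℂ} (hζ : ζ ≠ 0) (k : ℤ) (m : ℕ) :
    (-1 : ℂ) ^ (k + (m : ℤ) + 1) * pw ζ k = ζ ^ m * pw (-ζ) (k + m) := by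
  have h1 : (-ζ) = (-1) * ζ := by ring
  rw [pw, pw, h1, mul_zpow, ← zpow_natCast, mul_left_comm, ← zpow_add₀ hζ]
  have h2 : (-1 : ℂ) ^ (k + (m : ℤ) + 1) = (-1 : ℂ) ^ (-(k + (m : ℤ)) - 1) := by
    rw [show -(k + (m : ℤ)) - 1 = -(k + (m : ℤ) + 1) by ring, zpow_neg, ← inv_zpow]
    norm_num
  rw [h2]
  congr 2
  ring

/-- The series of opposite right vertex operators in terms of right vertex operators. -/
theorem Bimod.hasSum_sR (B : Bimod A W) {φ : W →ₗ[ℂ] ℂ} {M : ℕ}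
    (hM : ∀ m, M ≤ m → ∀ w, φ ((B.DW ^ m) w) = 0) {κ : Type*} (v : κ → V) (μ : κ → ℂ) (w : κ → W)
    {ζ : ℂ} (hζ : ζ ≠ 0) {r : ℕ → ℂ}
    (h : ∀ m, HasSum (fun k : ℤ × κ => φ ((B.DW ^ m) (B.YR (w k.2) (v k.2) k.1)) *
      (pw (-ζ) k.1 * μ k.2)) (r m)) :
    HasSum (fun k : ℤ × κ => φ (B.YsR (v k.2) (w k.2) k.1) * (pw ζ k.1 * μ k.2))
      (∑ m ∈ Finset.range M, ζ ^ m * ((m.factorial : ℂ))⁻¹ * r m) := by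
  have h1 : HasSum (fun k : ℤ × κ => ∑ m ∈ Finset.range M,
      ζ ^ m * ((m.factorial : ℂ))⁻¹ * (φ ((B.DW ^ m) (B.YR (w k.2) (v k.2) (k.1 + m))) *
        (pw (-ζ) (k.1 + m) * μ k.2)))
      (∑ m ∈ Finset.range M, ζ ^ m * ((m.factorial : ℂ))⁻¹ * r m) :=
    hasSum_sum fun m _ => HasSum.mul_left _
      (((Equiv.addRight (m : ℤ)).prodCongr (Equiv.refl κ)).hasSum_iff.2 (h m))
  convert h1 using 2 with k
  rw [B.apply_YsR hM, Finset.sum_mul]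
  refine Finset.sum_congr rfl fun m _ => ?_
  have h2 := neg_one_zpow_mul_pw hζ k.1 m
  linear_combination (((m.factorial : ℂ))⁻¹ * φ ((B.DW ^ m) (B.YR (w k.2) (v k.2) (k.1 + m))) *
    μ k.2) * h2

end Ops

section Binomial

/-- Binomial coefficients with integer upper entry, as complex numbers. -/
def bc (k : ℤ) (r : ℕ) : ℂ := (descPochhammer ℂ r).eval (k : ℂ) / r.factorial

theorem bc_of_nonneg (j r : ℕ) : bc ((j : ℤ) + r) r = ((r + j).choose j : ℕ) := by
  have h1 : (((j : ℤ) + r : ℤ) : ℂ) = ((r + j : ℕ) : ℂ) := by push_cast; ring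
  rw [bc, h1, descPochhammer_eval_eq_descFactorial, Nat.descFactorial_eq_factorial_mul_choose,
    Nat.choose_symm_add]
  push_cast
  exact mul_div_cancel_left₀ _ (by exact_mod_cast r.factorial_ne_zero)

theorem bc_of_neg (s r : ℕ) : bc (-(s : ℤ) - 1 + r) r = (-1) ^ r * (s.choose r : ℕ) := by
  rw [bc, descPochhammer_eval_eq_ascPochhammer]
  have h1 : ((-(s : ℤ) - 1 + r : ℤ) : ℂ) - r + 1 = -(s : ℂ) := by push_cast; ring
  rw [h1, ascPochhammer_eval_neg_eq_descPochhammer, descPochhammer_eval_eq_descFactorial,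
    Nat.descFactorial_eq_factorial_mul_choose]
  push_cast
  rw [mul_div_assoc, mul_div_cancel_left₀ _ (by exact_mod_cast r.factorial_ne_zero)]

theorem hasSum_bc (j : ℤ) {x : ℂ} (hx : ‖x‖ < 1) :
    HasSum (fun r : ℕ => bc (j + r) r * x ^ r) (pw (1 - x) j) := by
  rcases Int.le_total 0 j with hj | hj
  · lift j to ℕ using hj
    simp only [bc_of_nonneg]
    have h1 := hasSum_choose_mul_geometric_of_norm_lt_one' j hx
    rw [Ring.inverse_eq_inv, ← zpow_natCast, inv_zpow, ← zpow_neg,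
      show -((j + 1 : ℕ) : ℤ) = -(j : ℤ) - 1 by push_cast; ring] at h1
    exact h1
  · rcases hj.eq_or_lt with rfl | hj
    · have h1 := hasSum_choose_mul_geometric_of_norm_lt_one' 0 hx
      rw [Ring.inverse_eq_inv] at h1
      have h2 := bc_of_nonneg 0
      simp only [Nat.cast_zero] at h2
      have h3 : pw (1 - x) 0 = (1 - x)⁻¹ ^ (0 + 1) := by simp [pw]
      rw [h3]
      exact h1.congr_fun fun r => by rw [h2]
    · obtain ⟨s, rfl⟩ : ∃ s : ℕ, j = -(s : ℤ) - 1 := ⟨(-j - 1).toNat, by omega⟩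
      simp only [bc_of_neg]
      have h1 : pw (1 - x) (-(s : ℤ) - 1) = ∑ r ∈ Finset.range (s + 1),
          (-1) ^ r * (s.choose r : ℕ) * x ^ r := by
        rw [pw, show -(-(s : ℤ) - 1) - 1 = (s : ℤ) by ring, zpow_natCast, sub_eq_neg_add, add_pow]
        refine Finset.sum_congr rfl fun r _ => ?_
        rw [neg_pow]
        ring
      rw [h1]
      refine hasSum_sum_of_ne_finset_zero fun r hr => ?_
      rw [Nat.choose_eq_zero_of_lt (by simpa using hr)]
      simp

theorem summable_norm_bc (j : ℤ) {ρ : ℝ} (h0 : 0 ≤ ρ) (h1 : ρ < 1) :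
    Summable (fun r : ℕ => ‖bc (j + r) r‖ * ρ ^ r) ∧
    ∑' r : ℕ, ‖bc (j + r) r‖ * ρ ^ r ≤ ‖pw (1 - (ρ : ℂ)) j‖ + ‖pw (1 + (ρ : ℂ)) j‖ := by
  have hρ : ‖(ρ : ℂ)‖ < 1 := by simpa [abs_of_nonneg h0] using h1
  have hs : Summable (fun r : ℕ => ‖bc (j + r) r‖ * ρ ^ r) := by
    have := (hasSum_bc j hρ).summable.norm
    refine this.congr fun r => ?_
    simp [abs_of_nonneg h0]
  refine ⟨hs, ?_⟩
  rcases le_or_gt 0 j with hj | hj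
  · have h2 : HasSum (fun r : ℕ => ((‖bc (j + r) r‖ * ρ ^ r : ℝ) : ℂ)) (pw (1 - (ρ : ℂ)) j) := by
      convert hasSum_bc j hρ using 2 with r
      lift j to ℕ using hj
      rw [bc_of_nonneg]
      simp
    have h3 := Complex.hasSum_ofReal.2 hs.hasSum
    have h4 := h2.unique h3
    have h5 : 0 ≤ ∑' r : ℕ, ‖bc (j + r) r‖ * ρ ^ r := tsum_nonneg fun r => by positivity
    rw [h4, Complex.norm_real, Real.norm_of_nonneg h5]
    linarith [norm_nonneg (pw (1 + (ρ : ℂ)) j)]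
  · have h2 : HasSum (fun r : ℕ => ((‖bc (j + r) r‖ * ρ ^ r : ℝ) : ℂ)) (pw (1 + (ρ : ℂ)) j) := by
      have h3 := hasSum_bc j (x := -(ρ : ℂ)) (by simpa using hρ)
      rw [sub_neg_eq_add] at h3
      convert h3 using 2 with r
      obtain ⟨s, rfl⟩ : ∃ s : ℕ, j = -(s : ℤ) - 1 := ⟨(-j - 1).toNat, by omega⟩
      rw [bc_of_neg, neg_pow (ρ : ℂ)]
      simp only [norm_mul, norm_pow, norm_neg, norm_one, one_pow, one_mul, Complex.norm_natCast]
      push_cast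
      rw [mul_mul_mul_comm, ← mul_pow]
      simp
    have h3 := Complex.hasSum_ofReal.2 hs.hasSum
    have h4 := h2.unique h3
    have h5 : 0 ≤ ∑' r : ℕ, ‖bc (j + r) r‖ * ρ ^ r := tsum_nonneg fun r => by positivity
    rw [h4, Complex.norm_real, Real.norm_of_nonneg h5]
    linarith [norm_nonneg (pw (1 - (ρ : ℂ)) j)]

end Binomial

section Ops

variable {V : Type*} [AddCommGroup V] [Module ℂ V]
variable {W : Type*} [AddCommGroup W] [Module ℂ W] {A : MOSVA V}

theorem Bimod.YR_vac (B : Bimod A W) (w : W) (n : ℕ) :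
    B.YR w A.vac (-(n : ℤ) - 1) = ((n.factorial : ℂ))⁻¹ • (B.DW ^ n) w := by
  induction n with
  | zero => simpa using B.creationR_lim w
  | succ n ih =>
    have h1 := B.D_commR w A.vac (-(n : ℤ) - 1)
    have h2 : A.D A.vac = 0 := by simp [MOSVA.D, A.identity]
    rw [h2, map_zero, Pi.zero_apply, sub_zero, ih, map_smul,
      show -(n : ℤ) - 1 - 1 = -((n + 1 : ℕ) : ℤ) - 1 by push_cast; ring] at h1
    rw [pow_succ', Module.End.mul_apply, Nat.factorial_succ]
    have h3 : (-((-(n : ℤ) - 1 : ℤ) : ℂ)) = (n : ℂ) + 1 := by push_cast; ring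
    rw [h3] at h1
    have h4 : (n : ℂ) + 1 ≠ 0 := by exact_mod_cast Nat.succ_ne_zero n
    rw [Nat.cast_mul, mul_inv, mul_smul, h1, smul_smul,
      Nat.cast_succ (R := ℂ), inv_mul_cancel₀ h4, one_smul]

theorem Bimod.YsR_vac (B : Bimod A W) (w : W) (k : ℤ) :
    B.YsR A.vac w k = if k = -1 then w else 0 := by
  rcases le_or_gt 0 k with hk | hk
  · rw [if_neg (by omega), Bimod.YsR]
    refine finsum_eq_zero_of_forall_eq_zero fun m => ?_
    rw [B.creationR _ _ (by omega), map_zero, smul_zero]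
  · obtain ⟨N, rfl⟩ : ∃ N : ℕ, k = -(N : ℤ) - 1 := ⟨(-k - 1).toNat, by omega⟩
    rw [Bimod.YsR, finsum_eq_sum_of_support_subset (s := Finset.range (N + 1))]
    · have h1 : ∀ m ∈ Finset.range (N + 1),
          (((-1 : ℂ) ^ (-(N : ℤ) - 1 + (m : ℤ) + 1)) * ((m.factorial : ℂ))⁻¹) •
            ((B.DW ^ m) (B.YR w A.vac (-(N : ℤ) - 1 + (m : ℤ)))) =
          (((N.factorial : ℂ))⁻¹ * (1 ^ m * (-1) ^ (N - m) * (N.choose m : ℕ))) •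
            (B.DW ^ N) w := by
        intro m hm
        have hmN : m ≤ N := Nat.lt_succ_iff.1 (Finset.mem_range.1 hm)
        rw [show -(N : ℤ) - 1 + (m : ℤ) = -((N - m : ℕ) : ℤ) - 1 by omega, B.YR_vac, map_smul,
          ← Module.End.mul_apply, ← pow_add, Nat.add_sub_cancel' hmN, smul_smul,
          show -((N - m : ℕ) : ℤ) - 1 + 1 = -((N - m : ℕ) : ℤ) by ring, zpow_neg, zpow_natCast,
          Nat.cast_choose ℂ hmN, ← inv_pow]
        congr 1
        have := Nat.factorial_ne_zero N
        field_simp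
        norm_num
      rw [Finset.sum_congr rfl h1, ← Finset.sum_smul, ← Finset.mul_sum, ← add_pow]
      rcases Nat.eq_zero_or_pos N with rfl | hN
      · simp
      · rw [if_neg (by omega)]
        simp [hN.ne']
    · intro m hm
      by_contra hlt
      have hNm : N + 1 ≤ m := by simpa using hlt
      refine hm ?_
      change _ • (B.DW ^ m) (B.YR w A.vac (-(N : ℤ) - 1 + (m : ℤ))) = 0
      rw [B.creationR _ _ (by omega), map_zero, smul_zero]

theorem Bimod.YR_DW_pow (B : Bimod A W) (w : W) (v : V) (k : ℤ) (r : ℕ) :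
    B.YR ((B.DW ^ r) w) v k = ((-1 : ℂ) ^ r * (r.factorial * bc k r)) • B.YR w v (k - r) := by
  induction r generalizing w with
  | zero => simp [bc]
  | succ r ih =>
    rw [pow_succ, Module.End.mul_apply, ih, B.D_derivR, smul_smul,
      show k - ((r + 1 : ℕ) : ℤ) = k - r - 1 by push_cast; ring]
    congr 1
    have h1 := Nat.factorial_ne_zero r
    have h2 := Nat.factorial_ne_zero (r + 1)
    rw [bc, bc, mul_div_cancel₀ _ (by exact_mod_cast h1), mul_div_cancel₀ _ (by exact_mod_cast h2),
      descPochhammer_succ_eval]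
    push_cast
    ring

/-- Products of two opposite right vertex operators as iterates of right vertex operators. -/
theorem Bimod.hasSum_YR_YsR (B : Bimod A W) (u₁ u₂ : V) (w : W) {φ : W →ₗ[ℂ] ℂ} (k l : ℤ) :
    HasSum (fun r : ℕ => (-1 : ℂ) ^ (l + r + 1) * (-1) ^ r * bc k r *
      φ (B.YR (B.YR w u₁ (l + r)) u₂ (k - r))) (φ (B.YR (B.YsR u₁ w l) u₂ k)) := by
  have h0 := B.YsR_support u₁ w l
  let L : W →ₗ[ℂ] ℂ := φ ∘ₗ (coef B.YR k).flip u₂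
  have h1 := L.toAddMonoidHom.map_finsum h0
  change φ (B.YR (B.YsR u₁ w l) u₂ k) = ∑ᶠ r : ℕ, L (_ • _) at h1
  have h2 : ∀ r : ℕ, L ((((-1 : ℂ) ^ (l + (r : ℤ) + 1)) * ((r.factorial : ℂ))⁻¹) •
      ((B.DW ^ r) (B.YR w u₁ (l + (r : ℤ))))) = (-1 : ℂ) ^ (l + r + 1) * (-1) ^ r * bc k r *
      φ (B.YR (B.YR w u₁ (l + r)) u₂ (k - r)) := by
    intro r
    rw [map_smul]
    change _ • φ (B.YR ((B.DW ^ r) _) u₂ k) = _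
    rw [B.YR_DW_pow, map_smul, smul_smul, smul_eq_mul]
    have := Nat.factorial_ne_zero r
    field_simp
  rw [h1, ← finsum_congr fun r => (h2 r).symm]
  rw [finsum_eq_sum_of_support_subset (s := h0.toFinset)]
  · refine hasSum_sum_of_ne_finset_zero fun r hr => ?_
    have h3 := Function.notMem_support.1 fun h => hr (h0.mem_toFinset.2 h)
    rw [← h2 r]
    exact (congrArg L h3).trans (map_zero L)
  · intro r hr
    refine h0.mem_toFinset.2 fun h3 => hr ?_
    exact (h2 r).symm.trans ((congrArg L h3).trans (map_zero L))

end Ops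

section TwoVariables

theorem hasSum_m2 {c : ℤ × ℤ → ℂ} {q : ℂ × ℂ} {s : ℂ} :
    HasSum (fun K : Fin 2 → ℤ => c (K 0, K 1) * pm ![q.1, q.2] K) s ↔
    HasSum (fun k => c k * m2 q k) s := by
  rw [← (finTwoArrowEquiv ℤ).symm.hasSum_iff]
  refine Iff.of_eq (congrArg (fun f => HasSum f s) ?_)
  funext k
  simp [pm, m2, pw]

theorem det_torus₂ (r s : ℝ) (hr : 0 < r) (hs : 0 < s) :
    Det m2 {q : ℂ × ℂ | ‖q.1‖ = r ∧ ‖q.2‖ = s} := by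
  intro c h
  have h1 := det_torus ![r, s] (by intro i; fin_cases i <;> simpa) (fun K => c (K 0, K 1))
    (fun x hx => by
      have h2 := hasSum_m2.2 (h (x 0, x 1) ⟨hx 0, hx 1⟩)
      have h3 : ![x 0, x 1] = x := by funext i; fin_cases i <;> rfl
      rwa [h3] at h2)
  funext k
  exact congrFun h1 ![k.1, k.2]

theorem Ex.array₂ {X : Type*} {a b : X → ℂ} {U : Set X} {g : X → ℂ}
    (hg : Ex (fun x => ![a x, b x]) U g) :
    ∃ C : ℤ × ℤ → ℂ, ∀ x ∈ U, HasSum (fun k => C k * m2 (a x, b x) k) (g x) := by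
  obtain ⟨c, hc⟩ := hg.array_fin
  refine ⟨fun k => c ![k.1, k.2], fun x hx => hasSum_m2.1 ((hc x hx).congr_fun fun K => ?_)⟩
  have h3 : ![K 0, K 1] = K := by funext i; fin_cases i <;> rfl
  rw [h3]

theorem Ex.sum {X ι α : Type*} [Fintype ι] {Y : X → ι → ℂ} {U : Set X} (s : Finset α)
    {g : α → X → ℂ} (hg : ∀ a, Ex Y U (g a)) : Ex Y U fun x => ∑ a ∈ s, g a x := by
  classical
  induction s using Finset.induction_on with
  | empty => simpa using Ex.const 0
  | insert a s ha ih =>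
    refine ((hg a).add ih).congr fun x _ => ?_
    rw [Finset.sum_insert ha]

end TwoVariables

section Assoc

variable {V : Type*} [AddCommGroup V] [Module ℂ V]
variable {W : Type*} [AddCommGroup W] [Module ℂ W] {A : MOSVA V}

theorem norm_pw (z : ℂ) (k : ℤ) : ‖pw z k‖ = ‖z‖ ^ (-k - 1) := norm_zpow _ _

theorem pw_mul (a b : ℂ) (k : ℤ) : pw (a * b) k = pw a k * pw b k := mul_zpow _ _ _

theorem pw_neg_shift {ζ ζ' : ℂ} (h : ζ ≠ 0) (h' : ζ' ≠ 0) (k l : ℤ) (r : ℕ) :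
    pw (-ζ') (l + r) * pw (-ζ) (k - r) * (ζ' / ζ) ^ r =
      (-1 : ℂ) ^ (l + r + 1) * (-1) ^ r * (pw (-ζ) k * pw ζ' l) := by
  have h1 : pw (-ζ') (l + r) = (-1 : ℂ) ^ (l + r + 1) * (pw ζ' l * (ζ' ^ r)⁻¹) := by
    rw [pw, show -ζ' = (-1) * ζ' by ring, mul_zpow, pw, ← zpow_natCast ζ' r, ← zpow_neg,
      ← zpow_add₀ h', show -(l + (r : ℤ)) - 1 = -(l + r + 1) by ring, zpow_neg, ← inv_zpow,
      show -(l + (r : ℤ) + 1) = -l - 1 + -(r : ℤ) by ring]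
    norm_num
  have h2 : pw (-ζ) (k - r) = pw (-ζ) k * ((-1) ^ r * ζ ^ r) := by
    rw [← mul_pow, neg_one_mul, pw, pw, ← zpow_natCast, ← zpow_add₀ (neg_ne_zero.2 h)]
    congr 1
    ring
  rw [h1, h2, div_pow]
  field_simp

/-- Iterates of right vertex operators re-expanded as products of two opposite ones. -/
theorem Bimod.hasSum_YR_YsR_torus (B : Bimod A W) (u₁ u₂ : V) (w : W) {φ : W →ₗ[ℂ] ℂ}
    {R : RatFn (Fin 2)}
    (hR : ∀ z₁ z₂ : ℂ, ‖z₁ - z₂‖ < ‖z₂‖ → 0 < ‖z₁ - z₂‖ →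
        AbsConvTo (fun k : ℤ × ℤ =>
            φ (B.YR (B.YR w u₁ k.1) u₂ k.2) * (z₁ - z₂) ^ (-k.1 - 1) * z₂ ^ (-k.2 - 1))
          (R.eval ![z₁, z₂]))
    {ζ ζ' : ℂ} (hζ : ‖ζ‖ = 3) (hζ' : ‖ζ'‖ = 1) :
    HasSum (fun k : ℤ × ℤ => φ (B.YR (B.YsR u₁ w k.2) u₂ k.1) * (pw (-ζ) k.1 * pw ζ' k.2))
      (R.eval ![-ζ, ζ' - ζ]) := by
  have hz : ζ ≠ 0 := by rw [← norm_ne_zero_iff, hζ]; norm_num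
  have hz' : ζ' ≠ 0 := by rw [← norm_ne_zero_iff, hζ']; norm_num
  have hx : ‖ζ' / ζ‖ = 1 / 3 := by rw [norm_div, hζ, hζ']
  set g : ℤ × ℤ → ℂ := fun k => φ (B.YR (B.YR w u₁ k.1) u₂ k.2) with hg
  have hsum : ∀ a : ℝ, 1 < a → Summable fun k : ℤ × ℤ => ‖g k‖ * a ^ (-k.2 - 1) := by
    intro a ha
    have ha0 : 0 < a := by linarith
    have h1 := (hR (1 + a) a (by simpa [abs_of_pos ha0] using ha) (by simp)).1
    refine h1.congr fun k => ?_
    simp [abs_of_pos ha0, hg]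
  have h2 := (hR (-ζ) (ζ' - ζ) (by
    have := norm_sub_norm_le ζ ζ'
    rw [show -ζ - (ζ' - ζ) = -ζ' by ring, norm_neg, norm_sub_rev]
    linarith) (by rw [show -ζ - (ζ' - ζ) = -ζ' by ring, norm_neg]; linarith)).2
  rw [show -ζ - (ζ' - ζ) = -ζ' by ring] at h2
  let t : (ℤ × ℤ) × ℕ → ℂ := fun k =>
    g k.1 * pw (-ζ') k.1.1 * pw (-ζ) k.1.2 * (bc (k.1.2 + k.2) k.2 * (ζ' / ζ) ^ k.2)
  have hfib : ∀ k : ℤ × ℤ, HasSum (fun r => t (k, r))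
      (φ (B.YR (B.YR w u₁ k.1) u₂ k.2) * (-ζ') ^ (-k.1 - 1) * (ζ' - ζ) ^ (-k.2 - 1)) := by
    intro k
    have h3 := (hasSum_bc k.2 (x := ζ' / ζ) (by rw [hx]; norm_num)).mul_left
      (g k * pw (-ζ') k.1 * pw (-ζ) k.2)
    have h4 : pw (-ζ) k.2 * pw (1 - ζ' / ζ) k.2 = (ζ' - ζ) ^ (-k.2 - 1) := by
      rw [← pw_mul, show -ζ * (1 - ζ' / ζ) = ζ' - ζ by field_simp; ring]
      rfl
    rw [mul_assoc (g k * pw (-ζ') k.1), h4] at h3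
    exact h3
  have ht : Summable t := by
    refine Summable.of_norm ?_
    have hn : ∀ k : ℤ × ℤ, ∀ r : ℕ, ‖t (k, r)‖ =
        ‖g k‖ * (3 : ℝ) ^ (-k.2 - 1) * (‖bc (k.2 + r) r‖ * (1 / 3 : ℝ) ^ r) := by
      intro k r
      simp only [t, norm_mul, norm_pow, hx, norm_pw, norm_neg, hζ, hζ', one_zpow, mul_one]
    have hb := fun j => summable_norm_bc j (ρ := 1 / 3) (by norm_num) (by norm_num)
    rw [summable_prod_of_nonneg fun _ => norm_nonneg _]
    refine ⟨fun k => (((hb k.2).1.mul_left _).congr fun r => (hn k r).symm), ?_⟩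
    refine Summable.of_nonneg_of_le (fun k => tsum_nonneg fun _ => norm_nonneg _) (fun k => ?_)
      ((hsum 2 (by norm_num)).add (hsum 4 (by norm_num)))
    rw [tsum_congr (hn k), tsum_mul_left]
    refine (mul_le_mul_of_nonneg_left (hb k.2).2 (by positivity)).trans (le_of_eq ?_)
    rw [norm_pw, norm_pw]
    have e1 : ‖(1 : ℂ) - ((1 / 3 : ℝ) : ℂ)‖ = 2 / 3 := by
      rw [← Complex.ofReal_one, ← Complex.ofReal_sub, Complex.norm_real]; norm_num
    have e2 : ‖(1 : ℂ) + ((1 / 3 : ℝ) : ℂ)‖ = 4 / 3 := by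
      rw [← Complex.ofReal_one, ← Complex.ofReal_add, Complex.norm_real]; norm_num
    rw [e1, e2, mul_add, mul_assoc, mul_assoc, ← mul_zpow, ← mul_zpow]
    norm_num
  have htot : HasSum t (R.eval ![-ζ, ζ' - ζ]) := by
    have h5 := ht.hasSum.prod_fiberwise hfib
    rw [← h5.unique h2]
    exact ht.hasSum
  let e : (ℤ × ℤ) × ℕ ≃ (ℤ × ℤ) × ℕ :=
    { toFun := fun k => ((k.1.2 + k.2, k.1.1 - k.2), k.2)
      invFun := fun k => ((k.1.2 + k.2, k.1.1 - k.2), k.2)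
      left_inv := fun k => by simp
      right_inv := fun k => by simp }
  refine (e.hasSum_iff.2 htot).prod_fiberwise fun k => ?_
  have h6 := (B.hasSum_YR_YsR u₁ u₂ w (φ := φ) k.1 k.2).mul_right (pw (-ζ) k.1 * pw ζ' k.2)
  refine h6.congr_fun fun r => ?_
  change g (k.2 + r, k.1 - r) * pw (-ζ') (k.2 + r) * pw (-ζ) (k.1 - r) *
    (bc (k.1 - r + r) r * (ζ' / ζ) ^ r) = _
  rw [sub_add_cancel, show g (k.2 + r, k.1 - r) * pw (-ζ') (k.2 + r) * pw (-ζ) (k.1 - r) *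
    (bc k.1 r * (ζ' / ζ) ^ r) = g (k.2 + r, k.1 - r) * bc k.1 r *
    (pw (-ζ') (k.2 + r) * pw (-ζ) (k.1 - r) * (ζ' / ζ) ^ r) by ring, pw_neg_shift hz hz']
  ring

/-- Associativity for the opposite right vertex operator map. -/
theorem Bimod.assoc_sR (B : Bimod A W) {φ : W →ₗ[ℂ] ℂ} (hφ : InGradedDual B.gr.proj φ)
    (u₁ u₂ : V) (w : W) : ∃ R : ℂ → ℂ → ℂ,
    (∀ ζ ζ' : ℂ, ‖ζ'‖ < ‖ζ‖ → 0 < ‖ζ'‖ →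
      HasSum (fun k : ℤ × ℤ => φ (B.YsR u₂ (B.YsR u₁ w k.2) k.1) * m2 (ζ, ζ') k)
        (R ζ (ζ' - ζ))) ∧
    (∀ ζ ξ : ℂ, ‖ξ‖ < ‖ζ‖ → 0 < ‖ξ‖ →
      HasSum (fun k : ℤ × ℤ => φ (B.YsR (A.Y u₁ u₂ k.2) w k.1) * m2 (ζ, ξ) k) (R ζ ξ)) := by
  obtain ⟨M, hM⟩ := B.exists_DW_bound hφ
  choose Rm h1 h2 using fun m : ℕ => B.associativityR w u₁ u₂ (φ ∘ₗ (B.DW ^ m)) (B.dual_DW hφ m)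
  let R : ℂ → ℂ → ℂ := fun ζ ξ =>
    ∑ m ∈ Finset.range M, ζ ^ m * ((m.factorial : ℂ))⁻¹ * (Rm m).eval ![-ζ, ξ]
  refine ⟨R, fun ζ ζ' hlt hpos => ?_, fun ζ ξ hlt hpos => ?_⟩
  · let Ω : Set (ℂ × ℂ) := {q | ‖q.2‖ < ‖q.1‖ ∧ 0 < ‖q.2‖}
    have hne : ∀ q ∈ Ω, q.1 ≠ 0 := fun q hq => norm_pos_iff.1 (hq.2.trans hq.1)
    let Y : ℂ × ℂ → Fin 2 → ℂ := fun q => ![q.1, q.2]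
    have c0 : Mo Y Ω fun q => q.1 := Mo.coord 0
    have c0' : Mo Y Ω fun q => (q.1)⁻¹ := Mo.coord_inv 0 hne
    have c1 : Mo Y Ω fun q => q.2 := Mo.coord 1
    have c1' : ExI Y Ω fun q => q.2 := ExI.coord 1 fun q hq => norm_pos_iff.1 hq.2
    have hex : Ex Y Ω fun q => R q.1 (q.2 - q.1) := by
      refine Ex.sum _ fun m => ?_
      refine ((c0.ex.pow _).mul (Ex.const _)).mul (RatFn.ex _ ?_ ?_)
      · intro a
        fin_cases a
        · exact ExI.neg (Y := Y) (U := Ω) (g := fun q : ℂ × ℂ => q.1) ⟨c0.ex, c0'.ex⟩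
        · refine (ExI.dom₁ c0 c0' c1.neg fun q hq => ?_).neg.congr fun q _ => ?_
          · simpa using hq.1
          · change -(q.1 + -q.2) = q.2 - q.1
            ring
      · refine ex_inv_of_lt fun i j hij => ?_
        fin_cases i <;> fin_cases j <;> simp at hij
        refine c1'.neg.congr fun q _ => ?_
        change -q.2 = -q.1 - (q.2 - q.1)
        ring
    obtain ⟨C, hC⟩ := hex.array₂
    have hCeq : (fun k : ℤ × ℤ => C k - φ (B.YsR u₂ (B.YsR u₁ w k.2) k.1)) = 0 := by
      refine det_torus₂ 3 1 (by norm_num) (by norm_num) _ fun q hq => ?_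
      have hqΩ : q ∈ Ω := ⟨by rw [hq.1, hq.2]; norm_num, by rw [hq.2]; norm_num⟩
      have h4 := B.hasSum_sR hM (fun _ => u₂) (pw q.2) (fun l => B.YsR u₁ w l) (hne q hqΩ)
        fun m => B.hasSum_YR_YsR_torus u₁ u₂ w (φ := φ ∘ₗ (B.DW ^ m))
          (fun z₁ z₂ => h2 m z₁ z₂) hq.1 hq.2
      have h5 := (hC q hqΩ).sub h4
      rw [sub_self] at h5
      refine h5.congr_fun fun k => ?_
      rw [sub_mul]
      rfl
    refine (hC (ζ, ζ') ⟨hlt, hpos⟩).congr_fun fun k => ?_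
    rw [sub_eq_zero.1 (congrFun hCeq k)]
  · have hζ : ζ ≠ 0 := norm_pos_iff.1 (hpos.trans hlt)
    refine B.hasSum_sR hM (fun l => A.Y u₁ u₂ l) (pw ξ) (fun _ => w) hζ fun m => ?_
    refine (h1 m (-ζ) ξ (by simpa using hlt) hpos).2.congr_fun fun k => ?_
    simp only [pw, LinearMap.comp_apply]
    ring

end Assoc

section Regions

theorem orderedPos_cons {n : ℕ} {a : ℂ} {x : Fin n → ℂ} :
    OrderedPos (Fin.cons a x : Fin (n+1) → ℂ) ↔ OrderedPos x ∧ 0 < ‖a‖ ∧ ∀ i, ‖x i‖ < ‖a‖ := by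
  constructor
  · rintro ⟨h1, h2⟩
    refine ⟨⟨fun i j hij => ?_, fun i => ?_⟩, ?_, fun i => ?_⟩
    · simpa using h1 i.succ j.succ (by simpa using hij)
    · simpa using h2 i.succ
    · simpa using h2 0
    · simpa using h1 0 i.succ (Fin.succ_pos i)
  · rintro ⟨⟨h1, h2⟩, h3, h4⟩
    refine ⟨fun i j hij => ?_, fun i => ?_⟩
    · induction j using Fin.cases with
      | zero => exact absurd hij (Fin.not_lt_zero i)
      | succ j =>
        induction i using Fin.cases with
        | zero => simpa using h4 j
        | succ i => simpa using h1 i j (by simpa using hij)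
    · induction i using Fin.cases with
      | zero => simpa using h3
      | succ i => simpa using h2 i

theorem orderedPos_snoc {n : ℕ} {a : ℂ} {x : Fin n → ℂ} :
    OrderedPos (Fin.snoc x a : Fin (n+1) → ℂ) ↔ OrderedPos x ∧ 0 < ‖a‖ ∧ ∀ i, ‖a‖ < ‖x i‖ := by
  constructor
  · rintro ⟨h1, h2⟩
    refine ⟨⟨fun i j hij => ?_, fun i => ?_⟩, ?_, fun i => ?_⟩
    · simpa using h1 i.castSucc j.castSucc (by simpa using hij)
    · simpa using h2 i.castSucc
    · simpa using h2 (Fin.last n)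
    · simpa using h1 i.castSucc (Fin.last n) (Fin.castSucc_lt_last i)
  · rintro ⟨⟨h1, h2⟩, h3, h4⟩
    refine ⟨fun i j hij => ?_, fun i => ?_⟩
    · induction i using Fin.lastCases with
      | last => exact absurd hij (not_lt.2 (Fin.le_last j))
      | cast i =>
        induction j using Fin.lastCases with
        | last => simpa using h4 i
        | cast j => simpa using h1 i j (by simpa using hij)
    · induction i using Fin.lastCases with
      | last => simpa using h3
      | cast i => simpa using h2 i

theorem isOpen_orderedPos {n : ℕ} : IsOpen {z : Fin n → ℂ | OrderedPos z} := by
  have h : {z : Fin n → ℂ | OrderedPos z} =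
      (⋂ i, ⋂ j, ⋂ _ : i < j, {z | ‖z j‖ < ‖z i‖}) ∩ ⋂ i, {z | 0 < ‖z i‖} := by
    ext z
    simp [OrderedPos, Ordered]
  rw [h]
  refine IsOpen.inter (isOpen_iInter_of_finite fun i => isOpen_iInter_of_finite fun j =>
    isOpen_iInter_of_finite fun _ => isOpen_lt (by fun_prop) (by fun_prop))
    (isOpen_iInter_of_finite fun i => isOpen_lt (by fun_prop) (by fun_prop))

theorem eventually_orderedPos {Q : Type*} [TopologicalSpace Q] {n : ℕ} {f : Q → Fin n → ℂ}
    {q₀ : Q} (hf : Continuous f) (h0 : OrderedPos (f q₀)) : ∀ᶠ q in 𝓝 q₀, OrderedPos (f q) :=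
  (isOpen_orderedPos.preimage hf).mem_nhds h0

/-- Radii of a small polydisc torus. -/
def tiny (n : ℕ) (ε : ℝ) (i : Fin n) : ℝ := ε / ((i : ℝ) + 2)

theorem tiny_pos {n : ℕ} {ε : ℝ} (hε : 0 < ε) (i : Fin n) : 0 < tiny n ε i := by
  unfold tiny; positivity

theorem tiny_lt {n : ℕ} {ε : ℝ} (hε : 0 < ε) (i : Fin n) : tiny n ε i < ε := by
  unfold tiny
  rw [div_lt_iff₀ (by positivity)]
  nlinarith [(Nat.cast_nonneg (i : ℕ) : (0 : ℝ) ≤ (i : ℕ))]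

theorem tiny_anti {n : ℕ} {ε : ℝ} (hε : 0 < ε) {i j : Fin n} (hij : i < j) :
    tiny n ε j < tiny n ε i := by
  unfold tiny
  have : ((i : ℕ) : ℝ) < (j : ℕ) := by exact_mod_cast hij
  gcongr

theorem orderedPos_of_tiny {n : ℕ} {ε : ℝ} (hε : 0 < ε) {x : Fin n → ℂ}
    (hx : ∀ i, ‖x i‖ = tiny n ε i) : OrderedPos x :=
  ⟨fun i j hij => by rw [hx, hx]; exact tiny_anti hε hij, fun i => by rw [hx]; exact tiny_pos hε i⟩

theorem det_tiny {n : ℕ} {ε : ℝ} (hε : 0 < ε) :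
    Det (pm (n := n)) {x | ∀ i, ‖x i‖ = tiny n ε i} := det_torus _ (tiny_pos hε)

theorem exists_tiny {n : ℕ} {ε : ℝ} (hε : 0 < ε) : ∃ x : Fin n → ℂ, ∀ i, ‖x i‖ = tiny n ε i :=
  ⟨fun i => (tiny n ε i : ℂ), fun i => by
    rw [Complex.norm_real, Real.norm_of_nonneg (tiny_pos hε i).le]⟩

theorem pm_ne_zero {n : ℕ} {x : Fin n → ℂ} (hx : OrderedPos x) (K : Fin n → ℤ) : pm x K ≠ 0 :=
  Finset.prod_ne_zero_iff.2 fun i _ => zpow_ne_zero _ (norm_pos_iff.1 (hx.2 i))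

theorem pw_ne_zero {z : ℂ} (hz : 0 < ‖z‖) (k : ℤ) : pw z k ≠ 0 :=
  zpow_ne_zero _ (norm_pos_iff.1 hz)

theorem pm_snoc {n : ℕ} (a : ℂ) (x : Fin n → ℂ) (k : ℤ) (K : Fin n → ℤ) :
    pm (Fin.snoc x a : Fin (n+1) → ℂ) (Fin.snoc K k : Fin (n+1) → ℤ) = pw a k * pm x K := by
  simp [pm, pw, Fin.prod_univ_castSucc, mul_comm]

theorem hasSum_lastInit {n : ℕ} {c : (Fin (n+1) → ℤ) → ℂ} {s a : ℂ} {v : Fin n → ℂ} :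
    HasSum (fun K => c K * pm (Fin.snoc v a : Fin (n+1) → ℂ) K) s ↔
    HasSum (fun k : ℤ × (Fin n → ℤ) => c (Fin.snoc k.2 k.1) * mm (a, v) k) s := by
  rw [← (Fin.snocEquiv fun _ => ℤ).hasSum_iff]
  refine Iff.of_eq (congrArg (fun f => HasSum f s) ?_)
  funext k
  obtain ⟨k, K⟩ := k
  change c (Fin.snoc K k) * pm _ (Fin.snoc K k : Fin (n+1) → ℤ) = _
  rw [pm_snoc]
  rfl

theorem ex_diff_snoc {X ι : Type*} [Fintype ι] {Y : X → ι → ℂ} {U : Set X} {n : ℕ} {a : X → ℂ}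
    {v : X → Fin n → ℂ}
    (h0 : ∀ j, ExI Y U fun x => v x j - a x)
    (h1 : ∀ i j, i < j → ExI Y U fun x => v x i - v x j) :
    ∀ i j, i < j → ExI Y U fun x =>
      (Fin.snoc (v x) (a x) : Fin (n+1) → ℂ) i - (Fin.snoc (v x) (a x) : Fin (n+1) → ℂ) j := by
  intro i j hij
  induction i using Fin.lastCases with
  | last => exact absurd hij (not_lt.2 (Fin.le_last j))
  | cast i =>
    induction j using Fin.lastCases with
    | last => simpa using h0 i
    | cast j => simpa using h1 i j (by simpa using hij)

theorem compApply_succ_last {M : Type*} (n : ℕ) (f : Fin (n+1) → (M → M)) (w : M) :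
    compApply (n+1) f w = compApply n (fun i => f i.castSucc) (f (Fin.last n) w) := by
  induction n with
  | zero => rfl
  | succ n ih =>
    change f 0 (compApply (n+1) (fun i => f i.succ) w) = _
    rw [ih]
    rfl

end Regions

section Iterates

variable {V : Type*} [AddCommGroup V] [Module ℂ V] {A : MOSVA V}

/-- Iterated components of vertex operators. -/
abbrev MOSVA.Yc (A : MOSVA V) {p : ℕ} (u : Fin p → V) (K : Fin p → ℤ) (v : V) : V :=
  compApply p (fun i y => A.Y (u i) y (K i)) v

theorem MOSVA.assoc_Y (A : MOSVA V) {ψ : V →ₗ[ℂ] ℂ} (hψ : InGradedDual A.gr.proj ψ)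
    (u₁ u₂ v : V) : ∃ R : ℂ → ℂ → ℂ,
    (∀ z ξ : ℂ, ‖ξ‖ < ‖z‖ → 0 < ‖ξ‖ →
      HasSum (fun k : ℤ × ℤ => ψ (A.Y u₁ (A.Y u₂ v k.2) k.1) * m2 (z, ξ) k) (R z ξ)) ∧
    (∀ ξ x : ℂ, ‖x‖ < ‖ξ‖ → 0 < ‖x‖ →
      HasSum (fun k : ℤ × ℤ => ψ (A.Y (A.Y u₁ u₂ k.2) v k.1) * m2 (ξ, x) k) (R (ξ + x) ξ)) := by
  obtain ⟨R, h1, h2⟩ := A.associativity u₁ u₂ v ψ hψ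
  refine ⟨fun z ξ => R.eval ![z, ξ], fun z ξ h3 h4 => (h1 z ξ h3 h4).2.congr_fun fun k => ?_,
    fun ξ x h3 h4 => ?_⟩
  · simp only [m2, pw]
    ring
  · have h5 := (h2 (ξ + x) ξ (by simpa using h3) (by simpa using h4)).2
    refine ((Equiv.prodComm ℤ ℤ).hasSum_iff.2 h5).congr_fun fun k => ?_
    simp only [m2, pw, Function.comp_apply, Equiv.prodComm_apply, Prod.fst_swap, Prod.snd_swap,
      add_sub_cancel_left]
    ring

theorem MOSVA.rat_Yc (A : MOSVA V) {p : ℕ} (u : Fin p → V) (u' v : V) {ψ : V →ₗ[ℂ] ℂ}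
    (hψ : InGradedDual A.gr.proj ψ) : ∃ R : RatFn (Fin (p+1)),
    ∀ ξ z, OrderedPos (Fin.snoc z ξ : Fin (p+1) → ℂ) →
      HasSum (fun k : ℤ × (Fin p → ℤ) => ψ (A.Yc u k.2 (A.Y u' v k.1)) * mm (ξ, z) k)
        (R.eval (Fin.snoc z ξ : Fin (p+1) → ℂ)) := by
  obtain ⟨R, hR⟩ := A.rationality (p+1) (Fin.snoc u u' : Fin (p+1) → V) v ψ hψ
  refine ⟨R, fun ξ z hz => ?_⟩
  refine (hasSum_lastInit.1 (hR _ hz).2).congr_fun fun k => ?_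
  simp only [compApply_succ_last, Fin.snoc_castSucc, Fin.snoc_last]

/-- The expansions of `⟨ψ, Y(u₁,z₁)⋯Y(u_p,z_p)Y(u',ξ)v⟩` and of
`⟨ψ, Y(Y(u₁,x₁)⋯Y(u_p,x_p)u',ξ)v⟩` agree. -/
def MOSVA.IterRat (A : MOSVA V) (p : ℕ) : Prop :=
  ∀ (u : Fin p → V) (u' v : V) (ψ : V →ₗ[ℂ] ℂ), InGradedDual A.gr.proj ψ →
    ∃ R : ℂ → (Fin p → ℂ) → ℂ,
      (∀ ξ z, OrderedPos (Fin.snoc z ξ : Fin (p+1) → ℂ) →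
        HasSum (fun k : ℤ × (Fin p → ℤ) => ψ (A.Yc u k.2 (A.Y u' v k.1)) * mm (ξ, z) k)
          (R ξ z)) ∧
      (∀ ξ x, OrderedPos (Fin.cons ξ x : Fin (p+1) → ℂ) →
        HasSum (fun k : ℤ × (Fin p → ℤ) => ψ (A.Y (A.Yc u k.2 u') v k.1) * mm (ξ, x) k)
          (R ξ (fun i => ξ + x i)))

theorem MOSVA.iterRat_zero (A : MOSVA V) : A.IterRat 0 := by
  intro u u' v ψ hψ
  obtain ⟨R, hR⟩ := A.rat_Yc u u' v hψ
  refine ⟨fun ξ z => R.eval (Fin.snoc z ξ : Fin 1 → ℂ), hR, fun ξ x hx => ?_⟩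
  have h1 := (orderedPos_cons.1 hx).2.1
  have h2 := hR ξ x (orderedPos_snoc.2 ⟨⟨fun i => i.elim0, fun i => i.elim0⟩, h1, fun i => i.elim0⟩)
  have h3 : (fun i => ξ + x i) = x := by funext i; exact i.elim0
  rw [h3]
  exact h2

end Iterates

section Reindex

/-- Move a tuple of integers past two integers. -/
def rot (n : ℕ) : (Fin n → ℤ) × (ℤ × ℤ) ≃ ℤ × ℤ × (Fin n → ℤ) :=
  (Equiv.prodComm _ _).trans (Equiv.prodAssoc _ _ _)

theorem hasSum_rot {n : ℕ} {c : ℤ × ℤ × (Fin n → ℤ) → ℂ} {a b s : ℂ} {x : Fin n → ℂ} :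
    HasSum (fun k : (Fin n → ℤ) × (ℤ × ℤ) =>
      c (k.2.1, k.2.2, k.1) * (pm x k.1 * m2 (a, b) k.2)) s ↔
    HasSum (fun k : ℤ × ℤ × (Fin n → ℤ) => c k * (pw a k.1 * mm (b, x) k.2)) s := by
  rw [← (rot n).hasSum_iff]
  refine Iff.of_eq (congrArg (fun f => HasSum f s) ?_)
  funext k
  change _ = c (k.2.1, k.2.2, k.1) * (pw a k.2.1 * mm (b, x) (k.2.2, k.1))
  simp only [mm, m2]
  ring

/-- Insert an integer in front of a tuple past another integer. -/
def shuffle (n : ℕ) : ℤ × ℤ × (Fin n → ℤ) ≃ ℤ × (Fin (n+1) → ℤ) where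
  toFun k := (k.2.1, Fin.cons k.1 k.2.2)
  invFun k := (k.2 0, k.1, Fin.tail k.2)
  left_inv k := by simp
  right_inv k := by simp

theorem hasSum_shuffle {n : ℕ} {c : ℤ × (Fin (n+1) → ℤ) → ℂ} {a b s : ℂ} {x : Fin n → ℂ} :
    HasSum (fun k : ℤ × ℤ × (Fin n → ℤ) =>
      c (k.2.1, Fin.cons k.1 k.2.2) * (pw a k.1 * mm (b, x) k.2)) s ↔
    HasSum (fun k => c k * mm (b, (Fin.cons a x : Fin (n+1) → ℂ)) k) s := by
  rw [← (shuffle n).hasSum_iff]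
  refine Iff.of_eq (congrArg (fun f => HasSum f s) ?_)
  funext k
  change _ = c (k.2.1, Fin.cons k.1 k.2.2) *
    mm (b, (Fin.cons a x : Fin (n+1) → ℂ)) (k.2.1, (Fin.cons k.1 k.2.2 : Fin (n+1) → ℤ))
  simp only [mm, pm_cons]
  ring

theorem hasSum_assocCons {n : ℕ} {c : ℤ × (Fin (n+1) → ℤ) → ℂ} {a b s : ℂ} {x : Fin n → ℂ} :
    HasSum (fun k : ℤ × ℤ × (Fin n → ℤ) =>
      c (k.1, Fin.cons k.2.1 k.2.2) * (pw a k.1 * mm (b, x) k.2)) s ↔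
    HasSum (fun k => c k * mm (a, (Fin.cons b x : Fin (n+1) → ℂ)) k) s := by
  rw [← ((Equiv.refl ℤ).prodCongr (headTail n).symm).hasSum_iff]
  refine Iff.of_eq (congrArg (fun f => HasSum f s) ?_)
  funext k
  change _ = c (k.1, Fin.cons k.2.1 k.2.2) *
    mm (a, (Fin.cons b x : Fin (n+1) → ℂ)) (k.1, (Fin.cons k.2.1 k.2.2 : Fin (n+1) → ℤ))
  simp only [mm, pm_cons]

end Reindex

section Iterates

variable {V : Type*} [AddCommGroup V] [Module ℂ V] {A : MOSVA V}

theorem norm_two_add_tiny {p : ℕ} (i : Fin p) : ‖(2 : ℂ) + (tiny p 1 i : ℂ)‖ = 2 + tiny p 1 i := by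
  have h := tiny_pos (n := p) one_pos i
  rw [show (2 : ℂ) + (tiny p 1 i : ℂ) = ((2 + tiny p 1 i : ℝ) : ℂ) by push_cast; ring,
    Complex.norm_real, Real.norm_of_nonneg (by linarith)]

theorem orderedPos_base {p : ℕ} :
    OrderedPos (Fin.cons 2 (fun i => (tiny p 1 i : ℂ)) : Fin (p+1) → ℂ) := by
  have h : ∀ i, ‖(tiny p 1 i : ℂ)‖ = tiny p 1 i := fun i => by
    rw [Complex.norm_real, Real.norm_of_nonneg (tiny_pos one_pos i).le]
  refine orderedPos_cons.2 ⟨orderedPos_of_tiny one_pos h, by norm_num, fun i => ?_⟩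
  rw [h, Complex.norm_ofNat]
  linarith [tiny_lt one_pos i]

theorem orderedPos_base_add {p : ℕ} :
    OrderedPos (Fin.snoc (fun i => 2 + (tiny p 1 i : ℂ)) 2 : Fin (p+1) → ℂ) := by
  refine orderedPos_snoc.2 ⟨⟨fun i j hij => ?_, fun i => ?_⟩, by norm_num, fun i => ?_⟩ <;>
    simp only [norm_two_add_tiny, Complex.norm_ofNat]
  · linarith [tiny_anti (n := p) one_pos hij]
  · linarith [tiny_pos (n := p) one_pos i]
  · linarith [tiny_pos (n := p) one_pos i]

theorem continuous_snoc {Q : Type*} [TopologicalSpace Q] {n : ℕ} {v : Q → Fin n → ℂ} {a : Q → ℂ}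
    (hv : ∀ i, Continuous fun q => v q i) (ha : Continuous a) :
    Continuous fun q => (Fin.snoc (v q) (a q) : Fin (n+1) → ℂ) := by
  refine continuous_pi fun i => ?_
  induction i using Fin.lastCases with
  | last => simpa using ha
  | cast i => simpa using hv i

theorem continuous_cons {Q : Type*} [TopologicalSpace Q] {n : ℕ} {v : Q → Fin n → ℂ} {a : Q → ℂ}
    (hv : ∀ i, Continuous fun q => v q i) (ha : Continuous a) :
    Continuous fun q => (Fin.cons (a q) (v q) : Fin (n+1) → ℂ) := by
  refine continuous_pi fun i => ?_
  induction i using Fin.cases with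
  | zero => simpa using ha
  | succ i => simpa using hv i

theorem MOSVA.Yc_cons {p : ℕ} (u₀ : V) (u : Fin p → V) (k : ℤ) (K : Fin p → ℤ) (v : V) :
    A.Yc (Fin.cons u₀ u : Fin (p+1) → V) (Fin.cons k K) v = A.Y u₀ (A.Yc u K v) k := rfl

theorem MOSVA.hasSum_product_iterate {p : ℕ} (ih : A.IterRat p) (u₀ : V) (u : Fin p → V) (u' v : V)
    {ψ : V →ₗ[ℂ] ℂ} (hψ : InGradedDual A.gr.proj ψ) {R : RatFn (Fin (p+2))}
    (hR : ∀ ξ z, OrderedPos (Fin.snoc z ξ : Fin (p+2) → ℂ) →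
      HasSum (fun k : ℤ × (Fin (p+1) → ℤ) =>
        ψ (A.Yc (Fin.cons u₀ u : Fin (p+1) → V) k.2 (A.Y u' v k.1)) * mm (ξ, z) k)
        (R.eval (Fin.snoc z ξ : Fin (p+2) → ℂ)))
    {ξ z₀ : ℂ} {x : Fin p → ℂ} (hx : OrderedPos (Fin.cons ξ x : Fin (p+1) → ℂ))
    (h0 : ‖ξ‖ < ‖z₀‖) (h1 : ∀ i, ‖ξ‖ + ‖x i‖ < ‖z₀‖) :
    HasSum (fun k : ℤ × ℤ × (Fin p → ℤ) =>
      ψ (A.Y u₀ (A.Y (A.Yc u k.2.2 u') v k.2.1) k.1) * (pw z₀ k.1 * mm (ξ, x) k.2))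
      (R.eval (Fin.cons z₀ (Fin.snoc (fun i => ξ + x i) ξ : Fin (p+1) → ℂ) : Fin (p+2) → ℂ)) := by
  let U : Set (ℂ × ℂ × (Fin p → ℂ)) := {q | OrderedPos (Fin.cons q.2.1 q.2.2 : Fin (p+1) → ℂ) ∧
    ‖q.2.1‖ < ‖q.1‖ ∧ ∀ i, ‖q.2.1‖ + ‖q.2.2 i‖ < ‖q.1‖}
  let Y : ℂ × ℂ × (Fin p → ℂ) → Fin (p+2) → ℂ := fun q =>
    Fin.cons q.1 (Fin.cons q.2.1 q.2.2 : Fin (p+1) → ℂ)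
  let S : ℂ → ℂ × (Fin p → ℂ) → ℂ := fun z q =>
    R.eval (Fin.cons z (Fin.snoc (fun i => q.1 + q.2 i) q.1 : Fin (p+1) → ℂ) : Fin (p+2) → ℂ)
  have hz : ∀ q ∈ U, q.1 ≠ 0 := fun q hq => norm_pos_iff.1 ((norm_nonneg _).trans_lt hq.2.1)
  have hξ : ∀ q ∈ U, q.2.1 ≠ 0 := fun q hq => norm_pos_iff.1 (orderedPos_cons.1 hq.1).2.1
  have hxi : ∀ i, ∀ q ∈ U, q.2.2 i ≠ 0 := fun i q hq =>
    norm_pos_iff.1 ((orderedPos_cons.1 hq.1).1.2 i)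
  have cz : Mo Y U fun q => q.1 := Mo.coord 0
  have cz' : Mo Y U fun q => (q.1)⁻¹ := Mo.coord_inv 0 hz
  have cξ : Mo Y U fun q => q.2.1 := Mo.coord 1
  have cξ' : Mo Y U fun q => (q.2.1)⁻¹ := Mo.coord_inv 1 hξ
  have cx : ∀ i, Mo Y U fun q => q.2.2 i := fun i => Mo.coord i.succ.succ
  have cx' : ∀ i, Mo Y U fun q => (q.2.2 i)⁻¹ := fun i => Mo.coord_inv i.succ.succ (hxi i)
  have hex : Ex Y U fun q => S q.1 q.2 := by
    refine RatFn.ex R ?_ (ex_inv_of_lt (ex_diff_cons ?_ (ex_diff_snoc ?_ ?_)))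
    · intro a
      induction a using Fin.cases with
      | zero => exact ⟨cz.ex, cz'.ex⟩
      | succ a =>
        induction a using Fin.lastCases with
        | last =>
          exact ExI.congr (g := fun q : ℂ × ℂ × (Fin p → ℂ) => q.2.1) ⟨cξ.ex, cξ'.ex⟩
            fun q _ => by simp
        | cast i =>
          simpa using ExI.dom₁ cξ cξ' (cx i) fun q hq => (orderedPos_cons.1 hq.1).2.2 i
    · intro a
      induction a using Fin.lastCases with
      | last =>
        refine (ExI.dom₁ cz cz' cξ.neg fun q hq => ?_).congr fun q _ => ?_
        · rw [norm_neg]; exact hq.2.1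
        · simp [sub_eq_add_neg]
      | cast i =>
        refine (ExI.dom cz cz' cξ.neg (cx i).neg fun q hq => ?_).congr fun q _ => ?_
        · rw [norm_neg, norm_neg]; exact hq.2.2 i
        · simp only [Fin.snoc_castSucc]; ring
    · intro i
      refine ExI.congr (g := fun q : ℂ × ℂ × (Fin p → ℂ) => q.2.2 i) ⟨(cx i).ex, (cx' i).ex⟩
        fun q _ => ?_
      ring
    · intro i j hij
      refine (ExI.dom₁ (cx i) (cx' i) (cx j).neg fun q hq => ?_).congr fun q _ => ?_
      · rw [norm_neg]; exact (orderedPos_cons.1 hq.1).1.1 i j hij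
      · ring
  obtain ⟨C, hC⟩ := hex.array_cons₂
  have hCg : C = fun k (l : ℤ × (Fin p → ℤ)) =>
      ψ (A.Y u₀ (A.Y (A.Yc u l.2 u') v l.1) k) := by
    choose R' hF hG using fun k : ℤ => ih u u' v (ψ ∘ₗ coef A.Y k u₀) (A.dual_Y hψ u₀ k)
    refine transfer (mP := pw) (m₁ := mm) (m₂ := mm)
      (g := fun k l => ψ (A.Y u₀ (A.Yc u l.2 (A.Y u' v l.1)) k)) (R := S)
      (τ := fun q => (q.1, fun i => q.1 + q.2 i))
      (U := fun q => {z | (z, q) ∈ U}) (idP_cons _ _ orderedPos_base)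
      (fun q hq z hz => hC (z, q) hz) (fun q hq => ?_) (fun k q hq => (hG k q.1 q.2 hq).summable) ?_
    · refine ⟨((‖q.1‖ + ‖q.1‖ + 1 : ℝ) : ℂ), ?_, fun i => pw_ne_zero ?_ i⟩
      · have h2 : ‖((‖q.1‖ + ‖q.1‖ + 1 : ℝ) : ℂ)‖ = ‖q.1‖ + ‖q.1‖ + 1 := by
          rw [Complex.norm_real, Real.norm_of_nonneg (by positivity)]
        refine ⟨hq, ?_, fun i => ?_⟩ <;> rw [h2]
        · linarith [norm_nonneg q.1]
        · linarith [(orderedPos_cons.1 hq).2.2 i]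
      · rw [Complex.norm_real, Real.norm_of_nonneg (by positivity)]
        positivity
    · have ev1 := eventually_orderedPos
        (f := fun q : ℂ × (Fin p → ℂ) => (Fin.cons q.1 q.2 : Fin (p+1) → ℂ))
        (q₀ := ((2 : ℂ), fun i : Fin p => (tiny p 1 i : ℂ)))
        (continuous_cons (fun i => by fun_prop) (by fun_prop)) (orderedPos_base (p := p))
      have ev2 := eventually_orderedPos
        (f := fun q : ℂ × (Fin p → ℂ) => (Fin.snoc (fun i => q.1 + q.2 i) q.1 : Fin (p+1) → ℂ))
        (q₀ := ((2 : ℂ), fun i : Fin p => (tiny p 1 i : ℂ)))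
        (continuous_snoc (fun i => by fun_prop) (by fun_prop)) (orderedPos_base_add (p := p))
      filter_upwards [ev1, ev2] with q hq1 hq2
      refine ⟨hq1, {z | ‖z‖ = ‖q.1‖ + ‖q.1‖ + 1}, fun z hz => ?_,
        det_circle _ (by positivity), fun z hz => ?_, fun k => ?_⟩
      · refine ⟨hq1, ?_, fun i => ?_⟩ <;> rw [hz]
        · linarith [norm_nonneg q.1]
        · linarith [(orderedPos_cons.1 hq1).2.2 i]
      · have h2 := hR q.1 (Fin.cons z fun i => q.1 + q.2 i : Fin (p+1) → ℂ) (by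
          rw [← Fin.cons_snoc_eq_snoc_cons]
          refine orderedPos_cons.2 ⟨hq2, by rw [hz]; positivity, fun i => ?_⟩
          rw [hz]
          induction i using Fin.lastCases with
          | last =>
            rw [Fin.snoc_last]
            linarith [norm_nonneg q.1]
          | cast i =>
            rw [Fin.snoc_castSucc]
            linarith [(orderedPos_cons.1 hq1).2.2 i, norm_add_le q.1 (q.2 i)])
        rw [← Fin.cons_snoc_eq_snoc_cons] at h2
        refine ((hasSum_shuffle (c := fun k => ψ (A.Yc (Fin.cons u₀ u : Fin (p+1) → V) k.2
          (A.Y u' v k.1)))).2 h2).congr_fun fun k => ?_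
        change _ = ψ (A.Yc (Fin.cons u₀ u : Fin (p+1) → V) (Fin.cons k.1 k.2.2)
          (A.Y u' v k.2.1)) * (pw z k.1 * mm (q.1, fun i => q.1 + q.2 i) k.2)
        rw [MOSVA.Yc_cons]
      · exact (hF k _ _ hq2).tsum_eq.trans (hG k _ _ hq1).tsum_eq.symm
  have h2 := hC (z₀, ξ, x) ⟨hx, h0, h1⟩
  rw [hCg] at h2
  exact h2

end Iterates

section Iterates

variable {V : Type*} [AddCommGroup V] [Module ℂ V] {A : MOSVA V}

theorem snoc_add_cons {p : ℕ} (ξ x₀ : ℂ) (x : Fin p → ℂ) :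
    (Fin.snoc (fun i => ξ + (Fin.cons x₀ x : Fin (p+1) → ℂ) i) ξ : Fin (p+2) → ℂ) =
      Fin.cons (ξ + x₀) (Fin.snoc (fun i => ξ + x i) ξ : Fin (p+1) → ℂ) := by
  rw [Fin.cons_snoc_eq_snoc_cons]
  congr 1
  funext i
  induction i using Fin.cases with
  | zero => simp
  | succ i => simp

theorem MOSVA.hasSum_iterate_cons {p : ℕ} (ih : A.IterRat p) (u₀ : V) (u : Fin p → V) (u' v : V)
    {ψ : V →ₗ[ℂ] ℂ} (hψ : InGradedDual A.gr.proj ψ) {R : RatFn (Fin (p+2))}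
    (hR : ∀ ξ z, OrderedPos (Fin.snoc z ξ : Fin (p+2) → ℂ) →
      HasSum (fun k : ℤ × (Fin (p+1) → ℤ) =>
        ψ (A.Yc (Fin.cons u₀ u : Fin (p+1) → V) k.2 (A.Y u' v k.1)) * mm (ξ, z) k)
        (R.eval (Fin.snoc z ξ : Fin (p+2) → ℂ)))
    {ξ : ℂ} {x : Fin (p+1) → ℂ} (hx : OrderedPos (Fin.cons ξ x : Fin (p+2) → ℂ)) :
    HasSum (fun k : ℤ × (Fin (p+1) → ℤ) =>
      ψ (A.Y (A.Yc (Fin.cons u₀ u : Fin (p+1) → V) k.2 u') v k.1) * mm (ξ, x) k)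
      (R.eval (Fin.snoc (fun i => ξ + x i) ξ : Fin (p+2) → ℂ)) := by
  let U : Set ((ℂ × ℂ) × (Fin p → ℂ)) := {q | OrderedPos
    (Fin.cons q.1.1 (Fin.cons q.1.2 q.2 : Fin (p+1) → ℂ) : Fin (p+2) → ℂ)}
  let Y : (ℂ × ℂ) × (Fin p → ℂ) → Fin (p+2) → ℂ := fun q =>
    Fin.cons q.1.1 (Fin.cons q.1.2 q.2 : Fin (p+1) → ℂ)
  let S : (Fin p → ℂ) → ℂ × ℂ → ℂ := fun x q =>
    R.eval (Fin.cons (q.1 + q.2)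
      (Fin.snoc (fun i => q.1 + x i) q.1 : Fin (p+1) → ℂ) : Fin (p+2) → ℂ)
  have hξ : ∀ q ∈ U, q.1.1 ≠ 0 := fun q hq => norm_pos_iff.1 (orderedPos_cons.1 hq).2.1
  have hx0 : ∀ q ∈ U, q.1.2 ≠ 0 := fun q hq =>
    norm_pos_iff.1 (orderedPos_cons.1 (orderedPos_cons.1 hq).1).2.1
  have hlt0 : ∀ q ∈ U, ‖q.1.2‖ < ‖q.1.1‖ := fun q hq => by
    simpa using (orderedPos_cons.1 hq).2.2 0
  have hlt : ∀ i, ∀ q ∈ U, ‖q.2 i‖ < ‖q.1.1‖ := fun i q hq => by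
    simpa using (orderedPos_cons.1 hq).2.2 i.succ
  have hlt' : ∀ i, ∀ q ∈ U, ‖q.2 i‖ < ‖q.1.2‖ := fun i q hq =>
    (orderedPos_cons.1 (orderedPos_cons.1 hq).1).2.2 i
  have hxx : ∀ q ∈ U, OrderedPos q.2 := fun q hq =>
    (orderedPos_cons.1 (orderedPos_cons.1 hq).1).1
  have cξ : Mo Y U fun q => q.1.1 := Mo.coord 0
  have cξ' : Mo Y U fun q => (q.1.1)⁻¹ := Mo.coord_inv 0 hξ
  have c0 : Mo Y U fun q => q.1.2 := Mo.coord 1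
  have c0' : Mo Y U fun q => (q.1.2)⁻¹ := Mo.coord_inv 1 hx0
  have cx : ∀ i, Mo Y U fun q => q.2 i := fun i => Mo.coord i.succ.succ
  have cx' : ∀ i, Mo Y U fun q => (q.2 i)⁻¹ := fun i =>
    Mo.coord_inv i.succ.succ fun q hq => norm_pos_iff.1 ((hxx q hq).2 i)
  have hex : Ex Y U fun q => S q.2 q.1 := by
    refine RatFn.ex R ?_ (ex_inv_of_lt (ex_diff_cons ?_ (ex_diff_snoc ?_ ?_)))
    · intro a
      induction a using Fin.cases with
      | zero => simpa using ExI.dom₁ cξ cξ' c0 hlt0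
      | succ a =>
        induction a using Fin.lastCases with
        | last =>
          exact ExI.congr (g := fun q : (ℂ × ℂ) × (Fin p → ℂ) => q.1.1) ⟨cξ.ex, cξ'.ex⟩
            fun q _ => by simp
        | cast i => simpa using ExI.dom₁ cξ cξ' (cx i) (hlt i)
    · intro a
      induction a using Fin.lastCases with
      | last =>
        exact ExI.congr (g := fun q : (ℂ × ℂ) × (Fin p → ℂ) => q.1.2) ⟨c0.ex, c0'.ex⟩
          fun q _ => by simp
      | cast i =>
        refine (ExI.dom₁ c0 c0' (cx i).neg fun q hq => ?_).congr fun q _ => ?_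
        · rw [norm_neg]; exact hlt' i q hq
        · simp only [Fin.snoc_castSucc]; ring
    · intro i
      refine ExI.congr (g := fun q : (ℂ × ℂ) × (Fin p → ℂ) => q.2 i) ⟨(cx i).ex, (cx' i).ex⟩
        fun q _ => ?_
      ring
    · intro i j hij
      refine (ExI.dom₁ (cx i) (cx' i) (cx j).neg fun q hq => ?_).congr fun q _ => ?_
      · rw [norm_neg]; exact (hxx q hq).1 i j hij
      · ring
  obtain ⟨C, hC⟩ := hex.array_cons₂
  have hCg : (fun (K : Fin p → ℤ) (l : ℤ × ℤ) => C l.1 (l.2, K)) = fun K l =>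
      ψ (A.Y (A.Y u₀ (A.Yc u K u') l.2) v l.1) := by
    choose R' hF hG using fun K : Fin p → ℤ => A.assoc_Y hψ u₀ (A.Yc u K u') v
    refine transfer (mP := pm) (m₁ := m2) (m₂ := m2)
      (g := fun K l => ψ (A.Y u₀ (A.Y (A.Yc u K u') v l.2) l.1)) (R := S)
      (τ := fun q => (q.1 + q.2, q.1))
      (U := fun q => {x | (q, x) ∈ U}) (idP_pair 2 1 (by norm_num) (by norm_num))
      (fun q hq x hx => ?_) (fun q hq => ?_) (fun K q hq => (hG K q.1 q.2 hq.1 hq.2).summable) ?_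
    · exact (hasSum_rot (c := fun k => C k.1 k.2)).2 (hC (q, x) hx)
    · obtain ⟨x, hx⟩ := exists_tiny (n := p) hq.2
      have h1 := orderedPos_of_tiny hq.2 hx
      refine ⟨x, ?_, fun i => pm_ne_zero h1 i⟩
      have h2 : ∀ i, ‖x i‖ < ‖q.2‖ := fun i => by rw [hx]; exact tiny_lt hq.2 i
      refine orderedPos_cons.2 ⟨orderedPos_cons.2 ⟨h1, hq.2, h2⟩, hq.2.trans hq.1, fun i => ?_⟩
      induction i using Fin.cases with
      | zero => simpa using hq.1
      | succ i => simpa using (h2 i).trans hq.1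
    · have ev : ∀ᶠ q : ℂ × ℂ in 𝓝 ((2 : ℂ), (1 : ℂ)),
          ‖q.2‖ < ‖q.1‖ ∧ 0 < ‖q.2‖ ∧ ‖q.1‖ < ‖q.1 + q.2‖ := by
        refine Eventually.and ?_ (Eventually.and ?_ ?_) <;>
          refine ContinuousAt.eventually_lt (by fun_prop) (by fun_prop) ?_ <;> norm_num
      filter_upwards [ev] with q hq
      obtain ⟨h1, h2, h3⟩ := hq
      obtain ⟨ε, hε, hε'⟩ := exists_between (lt_min h2 (sub_pos.2 h3))
      obtain ⟨hε1, hε2⟩ := lt_min_iff.1 hε'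
      have key : ∀ x : Fin p → ℂ, (∀ i, ‖x i‖ = tiny p ε i) → (q, x) ∈ U := fun x hx => by
        have h5 : ∀ i, ‖x i‖ < ‖q.2‖ := fun i => by rw [hx]; exact (tiny_lt hε i).trans hε1
        refine orderedPos_cons.2 ⟨orderedPos_cons.2 ⟨orderedPos_of_tiny hε hx, h2, h5⟩,
          h2.trans h1, fun i => ?_⟩
        induction i using Fin.cases with
        | zero => simpa using h1
        | succ i => simpa using (h5 i).trans h1
      refine ⟨⟨h1, h2⟩, {x | ∀ i, ‖x i‖ = tiny p ε i}, key, det_tiny hε, fun x hx => ?_,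
        fun K => (hF K _ _ h3 (h2.trans h1)).tsum_eq.trans (hG K _ _ h1 h2).tsum_eq.symm⟩
      refine (hasSum_rot (c := fun k => ψ (A.Y u₀ (A.Y (A.Yc u k.2.2 u') v k.2.1) k.1))).2
        (MOSVA.hasSum_product_iterate ih u₀ u u' v hψ hR (orderedPos_cons.2 ⟨orderedPos_of_tiny hε hx,
          h2.trans h1, fun i => ?_⟩) h3 fun i => ?_) <;> rw [hx i]
      · exact (tiny_lt hε i).trans (hε1.trans h1)
      · linarith [tiny_lt hε i]
  obtain ⟨x₀, x, rfl⟩ : ∃ x₀ x', x = (Fin.cons x₀ x' : Fin (p+1) → ℂ) :=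
    ⟨x 0, Fin.tail x, (Fin.cons_self_tail x).symm⟩
  rw [snoc_add_cons]
  refine (hasSum_assocCons (c := fun k =>
    ψ (A.Y (A.Yc (Fin.cons u₀ u : Fin (p+1) → V) k.2 u') v k.1))).1 ?_
  refine (hC ((ξ, x₀), x) hx).congr_fun fun k => ?_
  have h2 := congrFun (congrFun hCg k.2.2) (k.1, k.2.1)
  change C k.1 k.2 = _ at h2
  rw [h2, MOSVA.Yc_cons]

theorem MOSVA.iterRat (A : MOSVA V) (p : ℕ) : A.IterRat p := by
  induction p with
  | zero => exact A.iterRat_zero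
  | succ p ih =>
    intro u u' v ψ hψ
    obtain ⟨R, hR⟩ := A.rat_Yc u u' v hψ
    refine ⟨fun ξ z => R.eval (Fin.snoc z ξ : Fin (p+2) → ℂ), hR, fun ξ x hx => ?_⟩
    rw [← Fin.cons_self_tail u] at hR ⊢
    exact MOSVA.hasSum_iterate_cons ih _ _ u' v hψ hR hx

end Iterates

section RightIterates

/-- The matrix coefficient of `e^{ζD}` applied to a rational function evaluated at `-ζ`. -/
def expS {p : ℕ} (M : ℕ) (R : ℕ → RatFn (Fin (p+1))) (ζ : ℂ) (y : Fin p → ℂ) : ℂ :=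
  ∑ m ∈ Finset.range M, ζ ^ m * ((m.factorial : ℂ))⁻¹ *
    (R m).eval (Fin.cons (-ζ) y : Fin (p+1) → ℂ)

theorem expS_ex {X ι : Type*} [Fintype ι] {Y : X → ι → ℂ} {U : Set X} {p : ℕ} (M : ℕ)
    (R : ℕ → RatFn (Fin (p+1))) {ζ : X → ℂ} {y : X → Fin p → ℂ} (hζ : ExI Y U ζ)
    (hy : ∀ a, ExI Y U fun x => y x a) (h0 : ∀ j, ExI Y U fun x => -ζ x - y x j)
    (h1 : ∀ i j, i < j → ExI Y U fun x => y x i - y x j) :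
    Ex Y U fun x => expS M R (ζ x) (y x) := by
  refine Ex.sum _ fun m => ((hζ.1.pow m).mul (Ex.const _)).mul (RatFn.ex (R m) (fun a => ?_)
    (ex_inv_of_lt (ex_diff_cons (a := fun x => -ζ x) h0 h1)))
  induction a using Fin.cases with
  | zero => simpa using hζ.neg
  | succ a => simpa using hy a

theorem hasSum_assocSnoc {n : ℕ} {c : ℤ × (Fin (n+1) → ℤ) → ℂ} {a b s : ℂ} {x : Fin n → ℂ} :
    HasSum (fun k : ℤ × ℤ × (Fin n → ℤ) =>
      c (k.1, Fin.snoc k.2.2 k.2.1) * (pw a k.1 * mm (b, x) k.2)) s ↔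
    HasSum (fun k => c k * mm (a, (Fin.snoc x b : Fin (n+1) → ℂ)) k) s := by
  rw [← ((Equiv.refl ℤ).prodCongr (Fin.snocEquiv fun _ => ℤ)).hasSum_iff]
  refine Iff.of_eq (congrArg (fun f => HasSum f s) ?_)
  funext k
  change _ = c (k.1, Fin.snoc k.2.2 k.2.1) *
    mm (a, (Fin.snoc x b : Fin (n+1) → ℂ)) (k.1, (Fin.snoc k.2.2 k.2.1 : Fin (n+1) → ℤ))
  simp only [mm, pm_snoc]

variable {V : Type*} [AddCommGroup V] [Module ℂ V]
variable {W : Type*} [AddCommGroup W] [Module ℂ W] {A : MOSVA V}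

/-- The product of opposite right vertex operators applied in increasing order. -/
abbrev Bimod.Sc (B : Bimod A W) {p : ℕ} (u : Fin p → V) (K : Fin p → ℤ) (w : W) : W :=
  compApply p (fun i x => B.YsR (u i.rev) x (K i.rev)) w

theorem Bimod.Sc_snoc (B : Bimod A W) {p : ℕ} (u : Fin p → V) (a : V) (K : Fin p → ℤ) (k : ℤ)
    (w : W) : B.Sc (Fin.snoc u a : Fin (p+1) → V) (Fin.snoc K k) w = B.YsR a (B.Sc u K w) k := by
  change B.YsR ((Fin.snoc u a : Fin (p+1) → V) (Fin.rev 0)) _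
    ((Fin.snoc K k : Fin (p+1) → ℤ) (Fin.rev 0)) = _
  simp only [Fin.rev_zero, Fin.snoc_last, Fin.rev_succ, Fin.snoc_castSucc]

theorem MOSVA.Yc_snoc {p : ℕ} (u : Fin p → V) (a : V) (K : Fin p → ℤ) (k : ℤ) (v : V) :
    A.Yc (Fin.snoc u a : Fin (p+1) → V) (Fin.snoc K k) v = A.Yc u K (A.Y a v k) := by
  simp only [compApply_succ_last, Fin.snoc_castSucc, Fin.snoc_last]

theorem Bimod.rat_sR (B : Bimod A W) {p : ℕ} (u : Fin p → V) (v : V) (w : W) {φ : W →ₗ[ℂ] ℂ}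
    (hφ : InGradedDual B.gr.proj φ) : ∃ (M : ℕ) (R : ℕ → RatFn (Fin (p+1))),
    ∀ ζ x, OrderedPos (Fin.cons ζ x : Fin (p+1) → ℂ) →
      HasSum (fun k : ℤ × (Fin p → ℤ) => φ (B.YsR (A.Yc u k.2 v) w k.1) * mm (ζ, x) k)
        (expS M R ζ x) := by
  obtain ⟨M, hM⟩ := B.exists_DW_bound hφ
  choose R hR using fun m : ℕ => B.rationalityR p w (Fin.snoc u v : Fin (p+1) → V)
    (φ ∘ₗ (B.DW ^ m)) (B.dual_DW hφ m)
  refine ⟨M, R, fun ζ x hx => ?_⟩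
  have hζ := (orderedPos_cons.1 hx).2.1
  refine B.hasSum_sR hM (fun K => A.Yc u K v) (pm x) (fun _ => w) (norm_pos_iff.1 hζ) fun m => ?_
  have hx' : OrderedPos (Fin.cons (-ζ) x : Fin (p+1) → ℂ) := by
    rw [orderedPos_cons, norm_neg]
    exact orderedPos_cons.1 hx
  refine (hasSum_headTail.1 (hR m _ hx').2).congr_fun fun k => ?_
  simp [mm]

theorem Bimod.hasSum_iterate_iterate (B : Bimod A W) {p : ℕ} (u : Fin p → V) (a v : V) (w : W)
    {φ : W →ₗ[ℂ] ℂ} (hφ : InGradedDual B.gr.proj φ) {M : ℕ} {R : ℕ → RatFn (Fin (p+2))}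
    (hR : ∀ ζ x, OrderedPos (Fin.cons ζ x : Fin (p+2) → ℂ) →
      HasSum (fun k : ℤ × (Fin (p+1) → ℤ) =>
        φ (B.YsR (A.Yc (Fin.snoc u a : Fin (p+1) → V) k.2 v) w k.1) * mm (ζ, x) k)
        (expS M R ζ x))
    {ζ ξ : ℂ} {x : Fin p → ℂ} (hx : OrderedPos (Fin.cons ξ x : Fin (p+1) → ℂ))
    (h0 : ‖ξ‖ < ‖ζ‖) (h1 : ∀ i, ‖ξ‖ + ‖x i‖ < ‖ζ‖) :
    HasSum (fun k : ℤ × ℤ × (Fin p → ℤ) =>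
      φ (B.YsR (A.Y (A.Yc u k.2.2 a) v k.2.1) w k.1) * (pw ζ k.1 * mm (ξ, x) k.2))
      (expS M R ζ (Fin.snoc (fun i => ξ + x i) ξ : Fin (p+1) → ℂ)) := by
  let U : Set (ℂ × ℂ × (Fin p → ℂ)) := {q | OrderedPos (Fin.cons q.2.1 q.2.2 : Fin (p+1) → ℂ) ∧
    ‖q.2.1‖ < ‖q.1‖ ∧ ∀ i, ‖q.2.1‖ + ‖q.2.2 i‖ < ‖q.1‖}
  let Y : ℂ × ℂ × (Fin p → ℂ) → Fin (p+2) → ℂ := fun q =>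
    Fin.cons q.1 (Fin.cons q.2.1 q.2.2 : Fin (p+1) → ℂ)
  let S : ℂ → ℂ × (Fin p → ℂ) → ℂ := fun z q =>
    expS M R z (Fin.snoc (fun i => q.1 + q.2 i) q.1 : Fin (p+1) → ℂ)
  have hz : ∀ q ∈ U, q.1 ≠ 0 := fun q hq => norm_pos_iff.1 ((norm_nonneg _).trans_lt hq.2.1)
  have hξ : ∀ q ∈ U, q.2.1 ≠ 0 := fun q hq => norm_pos_iff.1 (orderedPos_cons.1 hq.1).2.1
  have hxi : ∀ i, ∀ q ∈ U, q.2.2 i ≠ 0 := fun i q hq =>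
    norm_pos_iff.1 ((orderedPos_cons.1 hq.1).1.2 i)
  have cz : Mo Y U fun q => q.1 := Mo.coord 0
  have cz' : Mo Y U fun q => (q.1)⁻¹ := Mo.coord_inv 0 hz
  have cξ : Mo Y U fun q => q.2.1 := Mo.coord 1
  have cξ' : Mo Y U fun q => (q.2.1)⁻¹ := Mo.coord_inv 1 hξ
  have cx : ∀ i, Mo Y U fun q => q.2.2 i := fun i => Mo.coord i.succ.succ
  have cx' : ∀ i, Mo Y U fun q => (q.2.2 i)⁻¹ := fun i => Mo.coord_inv i.succ.succ (hxi i)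
  have hex : Ex Y U fun q => S q.1 q.2 := by
    refine expS_ex M R ⟨cz.ex, cz'.ex⟩ ?_ ?_ (ex_diff_snoc ?_ ?_)
    · intro a
      induction a using Fin.lastCases with
      | last =>
        exact ExI.congr (g := fun q : ℂ × ℂ × (Fin p → ℂ) => q.2.1) ⟨cξ.ex, cξ'.ex⟩
          fun q _ => by simp
      | cast i =>
        simpa using ExI.dom₁ cξ cξ' (cx i) fun q hq => (orderedPos_cons.1 hq.1).2.2 i
    · intro a
      induction a using Fin.lastCases with
      | last =>
        refine (ExI.dom₁ cz cz' cξ fun q hq => hq.2.1).neg.congr fun q _ => ?_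
        simp only [Fin.snoc_last]; ring
      | cast i =>
        refine (ExI.dom cz cz' cξ (cx i) fun q hq => hq.2.2 i).neg.congr fun q _ => ?_
        simp only [Fin.snoc_castSucc]; ring
    · intro i
      refine ExI.congr (g := fun q : ℂ × ℂ × (Fin p → ℂ) => q.2.2 i) ⟨(cx i).ex, (cx' i).ex⟩
        fun q _ => ?_
      ring
    · intro i j hij
      refine (ExI.dom₁ (cx i) (cx' i) (cx j).neg fun q hq => ?_).congr fun q _ => ?_
      · rw [norm_neg]; exact (orderedPos_cons.1 hq.1).1.1 i j hij
      · ring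
  obtain ⟨C, hC⟩ := hex.array_cons₂
  have hCg : C = fun k (l : ℤ × (Fin p → ℤ)) =>
      φ (B.YsR (A.Y (A.Yc u l.2 a) v l.1) w k) := by
    choose R' hF hG using fun k : ℤ => A.iterRat p u a v (φ ∘ₗ (B.sR k).flip w)
      (B.dual_sR_flip hφ w k)
    refine transfer (mP := pw) (m₁ := mm) (m₂ := mm)
      (g := fun k l => φ (B.YsR (A.Yc u l.2 (A.Y a v l.1)) w k)) (R := S)
      (τ := fun q => (q.1, fun i => q.1 + q.2 i))
      (U := fun q => {z | (z, q) ∈ U}) (idP_cons _ _ orderedPos_base)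
      (fun q hq z hz => hC (z, q) hz) (fun q hq => ?_) (fun k q hq => (hG k q.1 q.2 hq).summable) ?_
    · refine ⟨((‖q.1‖ + ‖q.1‖ + 1 : ℝ) : ℂ), ?_, fun i => pw_ne_zero ?_ i⟩
      · have h2 : ‖((‖q.1‖ + ‖q.1‖ + 1 : ℝ) : ℂ)‖ = ‖q.1‖ + ‖q.1‖ + 1 := by
          rw [Complex.norm_real, Real.norm_of_nonneg (by positivity)]
        refine ⟨hq, ?_, fun i => ?_⟩ <;> rw [h2]
        · linarith [norm_nonneg q.1]
        · linarith [(orderedPos_cons.1 hq).2.2 i]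
      · rw [Complex.norm_real, Real.norm_of_nonneg (by positivity)]
        positivity
    · have ev1 := eventually_orderedPos
        (f := fun q : ℂ × (Fin p → ℂ) => (Fin.cons q.1 q.2 : Fin (p+1) → ℂ))
        (q₀ := ((2 : ℂ), fun i : Fin p => (tiny p 1 i : ℂ)))
        (continuous_cons (fun i => by fun_prop) (by fun_prop)) (orderedPos_base (p := p))
      have ev2 := eventually_orderedPos
        (f := fun q : ℂ × (Fin p → ℂ) => (Fin.snoc (fun i => q.1 + q.2 i) q.1 : Fin (p+1) → ℂ))
        (q₀ := ((2 : ℂ), fun i : Fin p => (tiny p 1 i : ℂ)))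
        (continuous_snoc (fun i => by fun_prop) (by fun_prop)) (orderedPos_base_add (p := p))
      filter_upwards [ev1, ev2] with q hq1 hq2
      refine ⟨hq1, {z | ‖z‖ = ‖q.1‖ + ‖q.1‖ + 1}, fun z hz => ?_,
        det_circle _ (by positivity), fun z hz => ?_, fun k => ?_⟩
      · refine ⟨hq1, ?_, fun i => ?_⟩ <;> rw [hz]
        · linarith [norm_nonneg q.1]
        · linarith [(orderedPos_cons.1 hq1).2.2 i]
      · have h2 := hR z (Fin.snoc (fun i => q.1 + q.2 i) q.1 : Fin (p+1) → ℂ) (by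
          refine orderedPos_cons.2 ⟨hq2, by rw [hz]; positivity, fun i => ?_⟩
          rw [hz]
          induction i using Fin.lastCases with
          | last =>
            rw [Fin.snoc_last]
            linarith [norm_nonneg q.1]
          | cast i =>
            rw [Fin.snoc_castSucc]
            linarith [(orderedPos_cons.1 hq1).2.2 i, norm_add_le q.1 (q.2 i)])
        refine ((hasSum_assocSnoc (c := fun k => φ (B.YsR (A.Yc (Fin.snoc u a : Fin (p+1) → V) k.2
          v) w k.1))).2 h2).congr_fun fun k => ?_
        change _ = φ (B.YsR (A.Yc (Fin.snoc u a : Fin (p+1) → V) (Fin.snoc k.2.2 k.2.1) v) w k.1) *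
          (pw z k.1 * mm (q.1, fun i => q.1 + q.2 i) k.2)
        rw [MOSVA.Yc_snoc]
      · exact (hF k _ _ hq2).tsum_eq.trans (hG k _ _ hq1).tsum_eq.symm
  have h2 := hC (ζ, ξ, x) ⟨hx, h0, h1⟩
  rw [hCg] at h2
  exact h2

end RightIterates

section RightIterates

variable {V : Type*} [AddCommGroup V] [Module ℂ V]
variable {W : Type*} [AddCommGroup W] [Module ℂ W] {A : MOSVA V}

theorem Bimod.hasSum_product_iterate (B : Bimod A W) {p : ℕ} (u : Fin p → V) (a v : V) (w : W)
    {φ : W →ₗ[ℂ] ℂ} (hφ : InGradedDual B.gr.proj φ) {M : ℕ} {R : ℕ → RatFn (Fin (p+2))}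
    (hR : ∀ ζ x, OrderedPos (Fin.cons ζ x : Fin (p+2) → ℂ) →
      HasSum (fun k : ℤ × (Fin (p+1) → ℤ) =>
        φ (B.YsR (A.Yc (Fin.snoc u a : Fin (p+1) → V) k.2 v) w k.1) * mm (ζ, x) k)
        (expS M R ζ x))
    {ζ ζ' : ℂ} {x : Fin p → ℂ} (hx : OrderedPos (Fin.cons ζ' x : Fin (p+1) → ℂ))
    (h0 : ‖ζ'‖ < ‖ζ‖) (h1 : ∀ i, ‖ζ'‖ + ‖x i‖ < ‖ζ‖) :
    HasSum (fun k : ℤ × ℤ × (Fin p → ℤ) =>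
      φ (B.YsR v (B.YsR (A.Yc u k.2.2 a) w k.2.1) k.1) * (pw ζ k.1 * mm (ζ', x) k.2))
      (expS M R ζ (Fin.snoc (fun i => ζ' - ζ + x i) (ζ' - ζ) : Fin (p+1) → ℂ)) := by
  let U : Set ((ℂ × ℂ) × (Fin p → ℂ)) := {q | OrderedPos (Fin.cons q.1.2 q.2 : Fin (p+1) → ℂ) ∧
    ‖q.1.2‖ < ‖q.1.1‖ ∧ ∀ i, ‖q.1.2‖ + ‖q.2 i‖ < ‖q.1.1‖}
  let Y : (ℂ × ℂ) × (Fin p → ℂ) → Fin (p+2) → ℂ := fun q =>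
    Fin.cons q.1.1 (Fin.cons q.1.2 q.2 : Fin (p+1) → ℂ)
  let S : (Fin p → ℂ) → ℂ × ℂ → ℂ := fun x q =>
    expS M R q.1 (Fin.snoc (fun i => q.2 - q.1 + x i) (q.2 - q.1) : Fin (p+1) → ℂ)
  have hz : ∀ q ∈ U, q.1.1 ≠ 0 := fun q hq => norm_pos_iff.1 ((norm_nonneg _).trans_lt hq.2.1)
  have hξ : ∀ q ∈ U, q.1.2 ≠ 0 := fun q hq => norm_pos_iff.1 (orderedPos_cons.1 hq.1).2.1
  have hxi : ∀ i, ∀ q ∈ U, q.2 i ≠ 0 := fun i q hq =>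
    norm_pos_iff.1 ((orderedPos_cons.1 hq.1).1.2 i)
  have cz : Mo Y U fun q => q.1.1 := Mo.coord 0
  have cz' : Mo Y U fun q => (q.1.1)⁻¹ := Mo.coord_inv 0 hz
  have cξ : Mo Y U fun q => q.1.2 := Mo.coord 1
  have cξ' : Mo Y U fun q => (q.1.2)⁻¹ := Mo.coord_inv 1 hξ
  have cx : ∀ i, Mo Y U fun q => q.2 i := fun i => Mo.coord i.succ.succ
  have cx' : ∀ i, Mo Y U fun q => (q.2 i)⁻¹ := fun i => Mo.coord_inv i.succ.succ (hxi i)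
  have hex : Ex Y U fun q => S q.2 q.1 := by
    refine expS_ex M R ⟨cz.ex, cz'.ex⟩ ?_ ?_ (ex_diff_snoc ?_ ?_)
    · intro b
      induction b using Fin.lastCases with
      | last =>
        refine (ExI.dom₁ cz cz' cξ.neg fun q hq => ?_).neg.congr fun q _ => ?_
        · rw [norm_neg]; exact hq.2.1
        · simp only [Fin.snoc_last]; ring
      | cast i =>
        refine (ExI.dom cz cz' cξ.neg (cx i).neg fun q hq => ?_).neg.congr fun q _ => ?_
        · rw [norm_neg, norm_neg]; exact hq.2.2 i
        · simp only [Fin.snoc_castSucc]; ring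
    · intro b
      induction b using Fin.lastCases with
      | last =>
        refine (ExI.neg (g := fun q : (ℂ × ℂ) × (Fin p → ℂ) => q.1.2) ⟨cξ.ex, cξ'.ex⟩).congr
          fun q _ => ?_
        simp only [Fin.snoc_last]; ring
      | cast i =>
        refine (ExI.dom₁ cξ cξ' (cx i) fun q hq =>
          (orderedPos_cons.1 hq.1).2.2 i).neg.congr fun q _ => ?_
        simp only [Fin.snoc_castSucc]; ring
    · intro i
      refine ExI.congr (g := fun q : (ℂ × ℂ) × (Fin p → ℂ) => q.2 i) ⟨(cx i).ex, (cx' i).ex⟩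
        fun q _ => ?_
      ring
    · intro i j hij
      refine (ExI.dom₁ (cx i) (cx' i) (cx j).neg fun q hq => ?_).congr fun q _ => ?_
      · rw [norm_neg]; exact (orderedPos_cons.1 hq.1).1.1 i j hij
      · ring
  obtain ⟨C, hC⟩ := hex.array_cons₂
  have key : ∀ (q : ℂ × ℂ), 0 < ‖q.2‖ → ∀ ε : ℝ, 0 < ε → ε < ‖q.2‖ → ‖q.2‖ + ε < ‖q.1‖ →
      ∀ x : Fin p → ℂ, (∀ i, ‖x i‖ = tiny p ε i) → (q, x) ∈ U := fun q h2 ε hε hε1 hε2 x hx => by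
    have h5 : ∀ i, ‖x i‖ < ε := fun i => by rw [hx]; exact tiny_lt hε i
    refine ⟨orderedPos_cons.2 ⟨orderedPos_of_tiny hε hx, h2, fun i => (h5 i).trans hε1⟩,
      by change ‖q.2‖ < ‖q.1‖; linarith, fun i => ?_⟩
    have := h5 i
    change ‖q.2‖ + ‖x i‖ < ‖q.1‖
    linarith
  have hCg : (fun (K : Fin p → ℤ) (l : ℤ × ℤ) => C l.1 (l.2, K)) = fun K l =>
      φ (B.YsR v (B.YsR (A.Yc u K a) w l.2) l.1) := by
    choose R' hF hG using fun K : Fin p → ℤ => B.assoc_sR hφ (A.Yc u K a) v w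
    refine transfer (mP := pm) (m₁ := m2) (m₂ := m2)
      (g := fun K l => φ (B.YsR (A.Y (A.Yc u K a) v l.2) w l.1)) (R := S)
      (τ := fun q => (q.1, q.2 - q.1))
      (U := fun q => {x | (q, x) ∈ U}) (idP_pair 2 1 (by norm_num) (by norm_num))
      (fun q hq x hx => ?_) (fun q hq => ?_) (fun K q hq => (hF K q.1 q.2 hq.1 hq.2).summable) ?_
    · exact (hasSum_rot (c := fun k => C k.1 k.2)).2 (hC (q, x) hx)
    · obtain ⟨ε, hε, hε'⟩ := exists_between (lt_min hq.2 (sub_pos.2 hq.1))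
      obtain ⟨hε1, hε2⟩ := lt_min_iff.1 hε'
      obtain ⟨x, hx⟩ := exists_tiny (n := p) hε
      exact ⟨x, key q hq.2 ε hε hε1 (by linarith) x hx,
        fun i => pm_ne_zero (orderedPos_of_tiny hε hx) i⟩
    · have ev : ∀ᶠ q : ℂ × ℂ in 𝓝 ((2 : ℂ), (1 : ℂ)),
          ‖q.2‖ < ‖q.1‖ ∧ 0 < ‖q.2‖ ∧ ‖q.2 - q.1‖ < ‖q.1‖ ∧ 0 < ‖q.2 - q.1‖ := by
        refine Eventually.and ?_ (Eventually.and ?_ (Eventually.and ?_ ?_)) <;>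
          refine ContinuousAt.eventually_lt (by fun_prop) (by fun_prop) ?_ <;> norm_num
      filter_upwards [ev] with q hq
      obtain ⟨h1, h2, h3, h4⟩ := hq
      obtain ⟨ε, hε, hε'⟩ := exists_between
        (lt_min (lt_min h2 (sub_pos.2 h1)) (lt_min h4 (sub_pos.2 h3)))
      obtain ⟨hε'', hε'''⟩ := lt_min_iff.1 hε'
      obtain ⟨hε1, hε2⟩ := lt_min_iff.1 hε''
      obtain ⟨hε3, hε4⟩ := lt_min_iff.1 hε'''
      refine ⟨⟨h1, h2⟩, {x | ∀ i, ‖x i‖ = tiny p ε i},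
        fun x hx => key q h2 ε hε hε1 (by linarith) x hx, det_tiny hε, fun x hx => ?_,
        fun K => (hG K _ _ h3 h4).tsum_eq.trans (hF K _ _ h1 h2).tsum_eq.symm⟩
      refine (hasSum_rot (c := fun k => φ (B.YsR (A.Y (A.Yc u k.2.2 a) v k.2.1) w k.1))).2
        (B.hasSum_iterate_iterate u a v w hφ hR (orderedPos_cons.2 ⟨orderedPos_of_tiny hε hx, h4,
          fun i => ?_⟩) h3 fun i => ?_) <;> rw [hx i]
      · exact (tiny_lt hε i).trans hε3
      · linarith [tiny_lt hε i]
  refine (hC ((ζ, ζ'), x) ⟨hx, h0, h1⟩).congr_fun fun k => ?_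
  have h2 := congrFun (congrFun hCg k.2.2) (k.1, k.2.1)
  change C k.1 k.2 = _ at h2
  rw [h2]

/-- Products of opposite right vertex operators and the corresponding iterates have matrix
coefficients converging to the same function. -/
def Bimod.IterRat (B : Bimod A W) (p : ℕ) : Prop :=
  ∀ (u : Fin p → V) (v : V) (w : W) (φ : W →ₗ[ℂ] ℂ), InGradedDual B.gr.proj φ →
    ∃ S : ℂ → (Fin p → ℂ) → ℂ,
      (∀ ζ z, OrderedPos (Fin.cons ζ (fun i => z i.rev) : Fin (p+1) → ℂ) →
        HasSum (fun k : ℤ × (Fin p → ℤ) => φ (B.YsR v (B.Sc u k.2 w) k.1) * mm (ζ, z) k)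
          (S ζ (fun i => z i - ζ))) ∧
      (∀ ζ x, OrderedPos (Fin.cons ζ x : Fin (p+1) → ℂ) →
        HasSum (fun k : ℤ × (Fin p → ℤ) => φ (B.YsR (A.Yc u k.2 v) w k.1) * mm (ζ, x) k)
          (S ζ x))

theorem Bimod.iterRat_zero (B : Bimod A W) : B.IterRat 0 := by
  intro u v w φ hφ
  obtain ⟨M, R, hR⟩ := B.rat_sR u v w hφ
  refine ⟨expS M R, fun ζ z hz => ?_, hR⟩
  rw [show (fun i => z i - ζ) = z from funext fun i => i.elim0]
  rw [show (fun i : Fin 0 => z i.rev) = z from funext fun i => i.elim0] at hz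
  exact hR ζ z hz

theorem norm_two_sub_tiny {p : ℕ} (i : Fin p) : ‖(2 : ℂ) - (tiny p 1 i : ℂ)‖ = 2 - tiny p 1 i := by
  have h := tiny_lt (n := p) one_pos i
  rw [show (2 : ℂ) - (tiny p 1 i : ℂ) = ((2 - tiny p 1 i : ℝ) : ℂ) by push_cast; ring,
    Complex.norm_real, Real.norm_of_nonneg (by linarith)]

theorem orderedPos_base_sub {p : ℕ} :
    OrderedPos (Fin.cons 2 (fun i => 2 - (tiny p 1 i.rev : ℂ)) : Fin (p+1) → ℂ) := by
  refine orderedPos_cons.2 ⟨⟨fun i j hij => ?_, fun i => ?_⟩, by norm_num, fun i => ?_⟩ <;>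
    simp only [norm_two_sub_tiny, Complex.norm_ofNat]
  · linarith [tiny_anti (n := p) one_pos (Fin.rev_lt_rev.2 hij)]
  · linarith [tiny_lt (n := p) one_pos i.rev]
  · linarith [tiny_pos (n := p) one_pos i.rev]

theorem idP_rev {p : ℕ} : IdP (mm (n := p))
    {q | OrderedPos (Fin.cons q.1 (fun i => q.2 i.rev) : Fin (p+1) → ℂ)}
    ((2 : ℂ), fun i => 2 - (tiny p 1 i : ℂ)) := by
  have h := (idP_cons _ _ (orderedPos_base_sub (p := p))).pull (mon' := mm (n := p))
    (Ω' := {q | OrderedPos (Fin.cons q.1 (fun i => q.2 i.rev) : Fin (p+1) → ℂ)})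
    (fun q => (q.1, fun i => q.2 i.rev)) (by fun_prop)
    ((Equiv.refl ℤ).prodCongr (Equiv.arrowCongr Fin.revPerm (Equiv.refl ℤ)))
    (fun q k => ?_) (fun q hq => ?_)
  · simpa using h
  · simp only [mm, pm, Equiv.prodCongr_apply, Prod.map, Equiv.refl_apply]
    congr 1
    rw [← Equiv.prod_comp Fin.revPerm]
    refine Finset.prod_congr rfl fun i _ => ?_
    simp
  · simpa using hq

theorem cons_rev_snoc {p : ℕ} (ζ ζ' : ℂ) (z : Fin p → ℂ) :
    (Fin.cons ζ (fun i => (Fin.snoc z ζ' : Fin (p+1) → ℂ) i.rev) : Fin (p+2) → ℂ) =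
      Fin.cons ζ (Fin.cons ζ' (fun i => z i.rev) : Fin (p+1) → ℂ) := by
  congr 1
  funext i
  induction i using Fin.cases with
  | zero => simp
  | succ i => simp [Fin.rev_succ]

end RightIterates

section RightIterates

variable {V : Type*} [AddCommGroup V] [Module ℂ V]
variable {W : Type*} [AddCommGroup W] [Module ℂ W] {A : MOSVA V}

theorem Bimod.hasSum_product_product (B : Bimod A W) {p : ℕ} (ih : B.IterRat p) (u : Fin p → V) (a v : V)
    (w : W) {φ : W →ₗ[ℂ] ℂ} (hφ : InGradedDual B.gr.proj φ) {M : ℕ} {R : ℕ → RatFn (Fin (p+2))}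
    (hR : ∀ ζ x, OrderedPos (Fin.cons ζ x : Fin (p+2) → ℂ) →
      HasSum (fun k : ℤ × (Fin (p+1) → ℤ) =>
        φ (B.YsR (A.Yc (Fin.snoc u a : Fin (p+1) → V) k.2 v) w k.1) * mm (ζ, x) k)
        (expS M R ζ x))
    {ζ ζ' : ℂ} {z : Fin p → ℂ} (hz : OrderedPos (Fin.cons ζ' (fun i => z i.rev) : Fin (p+1) → ℂ))
    (h0 : ‖ζ'‖ < ‖ζ‖) :
    HasSum (fun k : ℤ × ℤ × (Fin p → ℤ) =>
      φ (B.YsR v (B.YsR a (B.Sc u k.2.2 w) k.2.1) k.1) * (pw ζ k.1 * mm (ζ', z) k.2))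
      (expS M R ζ (Fin.snoc (fun i => z i - ζ) (ζ' - ζ) : Fin (p+1) → ℂ)) := by
  let U : Set (ℂ × ℂ × (Fin p → ℂ)) :=
    {q | OrderedPos (Fin.cons q.2.1 (fun i => q.2.2 i.rev) : Fin (p+1) → ℂ) ∧ ‖q.2.1‖ < ‖q.1‖}
  let Y : ℂ × ℂ × (Fin p → ℂ) → Fin (p+2) → ℂ := fun q =>
    Fin.cons q.1 (Fin.cons q.2.1 q.2.2 : Fin (p+1) → ℂ)
  let S : ℂ → ℂ × (Fin p → ℂ) → ℂ := fun z q =>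
    expS M R z (Fin.snoc (fun i => q.2 i - z) (q.1 - z) : Fin (p+1) → ℂ)
  have hz' : ∀ q ∈ U, q.1 ≠ 0 := fun q hq => norm_pos_iff.1 ((norm_nonneg _).trans_lt hq.2)
  have hξ : ∀ q ∈ U, q.2.1 ≠ 0 := fun q hq => norm_pos_iff.1 (orderedPos_cons.1 hq.1).2.1
  have hlt : ∀ i, ∀ q ∈ U, ‖q.2.2 i‖ < ‖q.2.1‖ := fun i q hq => by
    simpa using (orderedPos_cons.1 hq.1).2.2 i.rev
  have hxi : ∀ i, ∀ q ∈ U, q.2.2 i ≠ 0 := fun i q hq => by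
    simpa using (orderedPos_cons.1 hq.1).1.2 i.rev
  have hij : ∀ i j, i < j → ∀ q ∈ U, ‖q.2.2 i‖ < ‖q.2.2 j‖ := fun i j h q hq => by
    simpa using (orderedPos_cons.1 hq.1).1.1 j.rev i.rev (Fin.rev_lt_rev.2 h)
  have cz : Mo Y U fun q => q.1 := Mo.coord 0
  have cz' : Mo Y U fun q => (q.1)⁻¹ := Mo.coord_inv 0 hz'
  have cξ : Mo Y U fun q => q.2.1 := Mo.coord 1
  have cξ' : Mo Y U fun q => (q.2.1)⁻¹ := Mo.coord_inv 1 hξ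
  have cx : ∀ i, Mo Y U fun q => q.2.2 i := fun i => Mo.coord i.succ.succ
  have cx' : ∀ i, Mo Y U fun q => (q.2.2 i)⁻¹ := fun i => Mo.coord_inv i.succ.succ (hxi i)
  have hex : Ex Y U fun q => S q.1 q.2 := by
    refine expS_ex M R ⟨cz.ex, cz'.ex⟩ ?_ ?_ (ex_diff_snoc ?_ ?_)
    · intro b
      induction b using Fin.lastCases with
      | last =>
        refine (ExI.dom₁ cz cz' cξ.neg fun q hq => ?_).neg.congr fun q _ => ?_
        · rw [norm_neg]; exact hq.2
        · simp only [Fin.snoc_last]; ring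
      | cast i =>
        refine (ExI.dom₁ cz cz' (cx i).neg fun q hq => ?_).neg.congr fun q _ => ?_
        · rw [norm_neg]; exact (hlt i q hq).trans hq.2
        · simp only [Fin.snoc_castSucc]; ring
    · intro b
      induction b using Fin.lastCases with
      | last =>
        refine (ExI.neg (g := fun q : ℂ × ℂ × (Fin p → ℂ) => q.2.1) ⟨cξ.ex, cξ'.ex⟩).congr
          fun q _ => ?_
        simp only [Fin.snoc_last]; ring
      | cast i =>
        refine (ExI.neg (g := fun q : ℂ × ℂ × (Fin p → ℂ) => q.2.2 i)
          ⟨(cx i).ex, (cx' i).ex⟩).congr fun q _ => ?_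
        simp only [Fin.snoc_castSucc]; ring
    · intro i
      refine (ExI.dom₁ cξ cξ' (cx i).neg fun q hq => ?_).neg.congr fun q _ => ?_
      · rw [norm_neg]; exact hlt i q hq
      · ring
    · intro i j h
      refine (ExI.dom₁ (cx j) (cx' j) (cx i).neg fun q hq => ?_).neg.congr fun q _ => ?_
      · rw [norm_neg]; exact hij i j h q hq
      · ring
  obtain ⟨C, hC⟩ := hex.array_cons₂
  have hCg : C = fun k (l : ℤ × (Fin p → ℤ)) =>
      φ (B.YsR v (B.YsR a (B.Sc u l.2 w) l.1) k) := by
    choose S' hF hG using fun k : ℤ => ih u a w (φ ∘ₗ B.sR k v) (B.dual_sR hφ v k)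
    refine transfer (mP := pw) (m₁ := mm) (m₂ := mm)
      (g := fun k l => φ (B.YsR v (B.YsR (A.Yc u l.2 a) w l.1) k)) (R := S)
      (τ := fun q => (q.1, fun i => q.2 i - q.1))
      (U := fun q => {z | (z, q) ∈ U}) idP_rev
      (fun q hq z hz => hC (z, q) hz) (fun q hq => ?_) (fun k q hq => (hF k q.1 q.2 hq).summable) ?_
    · have h2 : ‖((‖q.1‖ + 1 : ℝ) : ℂ)‖ = ‖q.1‖ + 1 := by
        rw [Complex.norm_real, Real.norm_of_nonneg (by positivity)]
      refine ⟨((‖q.1‖ + 1 : ℝ) : ℂ), ⟨hq, ?_⟩, fun i => pw_ne_zero ?_ i⟩ <;> rw [h2]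
      · exact lt_add_one _
      · positivity
    · have ev1 := eventually_orderedPos
        (f := fun q : ℂ × (Fin p → ℂ) => (Fin.cons q.1 (fun i => q.2 i.rev) : Fin (p+1) → ℂ))
        (q₀ := ((2 : ℂ), fun i : Fin p => 2 - (tiny p 1 i : ℂ)))
        (continuous_cons (fun i => by fun_prop) (by fun_prop)) (orderedPos_base_sub (p := p))
      have ev2 := eventually_orderedPos
        (f := fun q : ℂ × (Fin p → ℂ) => (Fin.cons q.1 (fun i => q.2 i - q.1) : Fin (p+1) → ℂ))
        (q₀ := ((2 : ℂ), fun i : Fin p => 2 - (tiny p 1 i : ℂ)))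
        (continuous_cons (fun i => by fun_prop) (by fun_prop)) (by
          have h : ∀ i, ‖(2 - (tiny p 1 i : ℂ)) - 2‖ = tiny p 1 i := fun i => by
            rw [sub_sub_cancel_left, norm_neg, Complex.norm_real,
              Real.norm_of_nonneg (tiny_pos one_pos i).le]
          refine orderedPos_cons.2 ⟨orderedPos_of_tiny one_pos h, by norm_num, fun i => ?_⟩
          rw [h, Complex.norm_ofNat]
          linarith [tiny_lt one_pos i])
      filter_upwards [ev1, ev2] with q hq1 hq2
      have hlt2 := (orderedPos_cons.1 hq2).2.2
      refine ⟨hq1, {z | ‖z‖ = ‖q.1‖ + ‖q.1‖ + 1}, fun z hz => ⟨hq1, ?_⟩,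
        det_circle _ (by positivity), fun z hz => ?_, fun k => ?_⟩
      · rw [hz]
        linarith [norm_nonneg q.1]
      · have h2 := B.hasSum_product_iterate u a v w hφ hR (ζ := z) hq2
          (by rw [hz]; linarith [norm_nonneg q.1])
          (fun i => by rw [hz]; linarith [hlt2 i])
        have h3 : (fun i => q.1 - z + (q.2 i - q.1)) = fun i => q.2 i - z := by
          funext i; ring
        rw [h3] at h2
        exact h2
      · exact (hG k _ _ hq2).tsum_eq.trans (hF k _ _ hq1).tsum_eq.symm
  have h2 := hC (ζ, ζ', z) ⟨hz, h0⟩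
  rw [hCg] at h2
  exact h2

theorem Bimod.iterRat (B : Bimod A W) (p : ℕ) : B.IterRat p := by
  induction p with
  | zero => exact B.iterRat_zero
  | succ p ih =>
    intro u v w φ hφ
    obtain ⟨M, R, hR⟩ := B.rat_sR u v w hφ
    refine ⟨expS M R, fun ζ y hy => ?_, hR⟩
    obtain ⟨u, a, rfl⟩ : ∃ (u' : Fin p → V) (a : V), u = (Fin.snoc u' a : Fin (p+1) → V) :=
      ⟨Fin.init u, u (Fin.last p), (Fin.snoc_init_self u).symm⟩
    obtain ⟨z, ζ', rfl⟩ : ∃ (z : Fin p → ℂ) (ζ' : ℂ), y = (Fin.snoc z ζ' : Fin (p+1) → ℂ) :=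
      ⟨Fin.init y, y (Fin.last p), (Fin.snoc_init_self y).symm⟩
    rw [cons_rev_snoc] at hy
    have h1 := orderedPos_cons.1 hy
    have h2 := B.hasSum_product_product ih u a v w hφ hR h1.1 (by simpa using h1.2.2 0)
    have h3 : (fun i => (Fin.snoc z ζ' : Fin (p+1) → ℂ) i - ζ) =
        (Fin.snoc (fun i => z i - ζ) (ζ' - ζ) : Fin (p+1) → ℂ) := by
      funext i
      induction i using Fin.lastCases with
      | last => simp
      | cast i => simp
    rw [h3]
    refine (hasSum_assocSnoc (c := fun k => φ (B.YsR v (B.Sc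
      (Fin.snoc u a : Fin (p+1) → V) k.2 w) k.1))).1 (h2.congr_fun fun k => ?_)
    change φ (B.YsR v (B.Sc (Fin.snoc u a : Fin (p+1) → V) (Fin.snoc k.2.2 k.2.1) w) k.1) * _ = _
    rw [B.Sc_snoc]

end RightIterates

section Completion

variable {V : Type*} [AddCommGroup V] [Module ℂ V]
variable {W : Type*} [AddCommGroup W] [Module ℂ W] {A : MOSVA V}

/-- `L` changes weights by elements of `S`. -/
def CGrading.Shift (G : CGrading W) (L : W → W) (S : Set ℂ) : Prop :=
  ∀ x T, Wt wW G.proj x T → Wt wW G.proj (L x) (S + T)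

theorem CGrading.wt_comp (G : CGrading W) (f : G.Comp) (n : ℂ) : Wt wW G.proj (f.1 n) {n} := by
  have h1 := G.isGr.wt_proj n (f.1 n)
  rwa [f.2 n] at h1

theorem CGrading.apply_shift_eq_zero (G : CGrading W) {φ : W →ₗ[ℂ] ℂ} {C S : Set ℂ}
    (hφ : Kills wW G.proj φ C) {x : W} {n : ℂ} (hx : Wt wW G.proj x (S + {n})) (hn : n ∉ C - S) :
    φ x = 0 := by
  refine G.isGr.apply_eq_zero hφ hx ?_
  rw [Set.disjoint_left]
  rintro _ ⟨s, hs, t, rfl, rfl⟩ hc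
  exact hn ⟨_, hc, s, hs, by simp⟩

theorem CGrading.apply_eq_sum (G : CGrading W) {φ : W →ₗ[ℂ] ℂ} {C : Set ℂ} (hC : C.Finite)
    (hφ : Kills wW G.proj φ C) (x : W) : φ x = ∑ m ∈ hC.toFinset, φ (G.proj m x) := by
  have h1 := φ.toAddMonoidHom.map_finsum (G.proj_finite x)
  rw [G.proj_sum] at h1
  change φ x = ∑ᶠ m, φ (G.proj m x) at h1
  rw [h1]
  refine finsum_eq_sum_of_support_subset _ fun m hm => ?_
  by_contra hmC
  exact hm (hφ m (by simpa using hmC) x)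

theorem CGrading.pair_ext (G : CGrading W) {φ : W →ₗ[ℂ] ℂ} (hφ : InGradedDual G.proj φ)
    (L : W →ₗ[ℂ] W) {S : Set ℂ} (hS : S.Finite) (hL : G.Shift L S) (f : G.Comp) :
    G.pair φ (G.ext L f) = G.pair (φ ∘ₗ L) f := by
  obtain ⟨C, hC, hk⟩ := kills_of_inGradedDual (w := wW) hφ
  have hCS : (C - S).Finite := hC.sub hS
  have hw : ∀ n, Wt wW G.proj (L (f.1 n)) (S + {n}) := fun n => hL _ _ (G.wt_comp f n)
  have h1 : ∀ m ∈ C, ∀ n, n ∉ C - S → G.proj m (L (f.1 n)) = 0 := by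
    intro m hm n hn
    by_contra h
    obtain ⟨s, hs, t, rfl, hst⟩ := hw n m h
    refine hn ⟨m, hm, s, hs, ?_⟩
    change m - s = t
    change s + t = m at hst
    rw [← hst, add_sub_cancel_left]
  have h2 : ∀ m ∈ C, ∑ᶠ n, G.proj m (L (f.1 n)) =
      ∑ n ∈ hCS.toFinset, G.proj m (L (f.1 n)) := by
    intro m hm
    refine finsum_eq_sum_of_support_subset _ fun n hn => ?_
    by_contra hnC
    exact hn (h1 m hm n (by simpa using hnC))
  change ∑ᶠ m, φ (∑ᶠ n, G.proj m (L (f.1 n))) = ∑ᶠ n, φ (L (f.1 n))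
  rw [finsum_eq_sum_of_support_subset (s := hC.toFinset),
    finsum_eq_sum_of_support_subset (s := hCS.toFinset)]
  · rw [Finset.sum_congr rfl fun m hm => by rw [h2 m (by simpa using hm), map_sum],
      Finset.sum_comm]
    exact Finset.sum_congr rfl fun n _ => (G.apply_eq_sum hC hk _).symm
  · intro n hn
    by_contra hnC
    exact hn (G.apply_shift_eq_zero hk (hw n) (by simpa using hnC))
  · intro m hm
    by_contra hmC
    have h3 := (G.ext L f).2 m
    refine hm ?_
    change φ ((G.ext L f).1 m) = 0
    rw [← h3]
    exact hk m (by simpa using hmC) _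

theorem CGrading.pair_compApply (G : CGrading W) {m : ℕ} (L : Fin m → W →ₗ[ℂ] W)
    (hL : ∀ i, ∃ S : Set ℂ, S.Finite ∧ G.Shift (L i) S) {φ : W →ₗ[ℂ] ℂ}
    (hφ : InGradedDual G.proj φ) (f : G.Comp) :
    G.pair φ (compApply m (fun i => G.ext (L i)) f) =
      ∑ᶠ n, φ (compApply m (fun i => ⇑(L i)) (f.1 n)) := by
  induction m generalizing φ with
  | zero => rfl
  | succ m ih =>
    obtain ⟨S, hS, h0⟩ := hL 0
    change G.pair φ (G.ext (L 0) (compApply m (fun i => G.ext (L i.succ)) f)) = _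
    rw [G.pair_ext hφ (L 0) hS h0, ih (fun i => L i.succ) (fun i => hL i.succ)
      (G.isGr.inGradedDual_comp G.isGr hφ (L 0) hS h0)]
    rfl

theorem exists_wt_compApply {ι M : Type*} [AddCommGroup M] [Module ℂ M] {w : ι → ℂ}
    {p : ι → M →ₗ[ℂ] M} {m : ℕ} (S : Fin m → Set ℂ) (hS : ∀ i, (S i).Finite) :
    ∃ S' : Set ℂ, S'.Finite ∧ ∀ (a : Fin m → M → M) (c : Fin m → ℂ),
      (∀ i x T, Wt w p x T → Wt w p (a i x) (S i + T + {c i})) →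
      ∀ x T, Wt w p x T → Wt w p (compApply m a x) (S' + T + {∑ i, c i}) := by
  induction m with
  | zero =>
    refine ⟨{0}, Set.finite_singleton _, fun a c _ x T hx => ?_⟩
    simpa [compApply] using hx
  | succ m ih =>
    obtain ⟨S', hS', h⟩ := ih (fun i => S i.succ) (fun i => hS i.succ)
    refine ⟨S 0 + S', (hS 0).add hS', fun a c ha x T hx => ?_⟩
    have h1 := ha 0 _ _ (h (fun i => a i.succ) (fun i => c i.succ) (fun i => ha i.succ) x T hx)
    refine h1.mono ?_
    rw [Fin.sum_univ_succ, ← Set.singleton_add_singleton]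
    exact Eq.subset (by abel)

/-- Minus one minus the degree of the monomial `pm x K`. -/
def dg {m : ℕ} (K : Fin m → ℤ) : ℤ := -(∑ i, (-(K i) - 1)) - 1

/-- Minus one minus the degree of the monomial `mm q k`. -/
def dg₂ {m : ℕ} (k : ℤ × (Fin m → ℤ)) : ℤ := -((-k.1 - 1) + ∑ i, (-(k.2 i) - 1)) - 1

theorem MOSVA.exists_wt (A : MOSVA V) {m : ℕ} (u : Fin m → V) :
    ∃ S : Fin m → Set ℂ, (∀ i, (S i).Finite) ∧ ∀ i, Wt wV A.gr.proj (u i) (S i) := by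
  choose S h1 h2 using fun i => A.gr.isGr.wt_self (u i)
  exact ⟨S, h1, h2⟩

theorem Bimod.exists_wt_Sc (B : Bimod A W) {m : ℕ} (u : Fin m → V) :
    ∃ S : Set ℂ, S.Finite ∧ ∀ (K : Fin m → ℤ) (x : W) (T : Set ℂ), Wt wW B.gr.proj x T →
      Wt wW B.gr.proj (B.Sc u K x) (S + T + {-(dg K : ℂ) - 1}) := by
  obtain ⟨S, hS, hu⟩ := MOSVA.exists_wt A u
  obtain ⟨S', hS', h⟩ := exists_wt_compApply (w := wW) (p := B.gr.proj) (fun i : Fin m => S i.rev)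
    (fun i => hS i.rev)
  refine ⟨S', hS', fun K x T hx => ?_⟩
  have h1 := h (fun i x => B.YsR (u i.rev) x (K i.rev)) (fun i => -(K i.rev : ℂ) - 1)
    (fun i x T hx => B.wt_sR (hu i.rev) hx _) x T hx
  refine h1.mono (Eq.subset ?_)
  have h2 : ∑ i : Fin m, (-(K i.rev : ℂ) - 1) = ∑ i : Fin m, (-(K i : ℂ) - 1) :=
    Equiv.sum_comp Fin.revPerm fun i => -(K i : ℂ) - 1
  rw [h2]
  congr 2
  simp [dg]
  ring

theorem Bimod.exists_wt_Yc (B : Bimod A W) {m : ℕ} (u : Fin m → V) (v : V) :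
    ∃ S : Set ℂ, S.Finite ∧ ∀ (k : ℤ × (Fin m → ℤ)) (x : W) (T : Set ℂ), Wt wW B.gr.proj x T →
      Wt wW B.gr.proj (B.YsR (A.Yc u k.2 v) x k.1) (S + T + {-(dg₂ k : ℂ) - 1}) := by
  obtain ⟨S, hS, hu⟩ := MOSVA.exists_wt A u
  obtain ⟨Sv, hSv, hv⟩ := A.gr.isGr.wt_self v
  obtain ⟨S', hS', h⟩ := exists_wt_compApply (w := wV) (p := A.gr.proj) S hS
  refine ⟨S' + Sv, hS'.add hSv, fun k x T hx => ?_⟩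
  have h1 := h (fun i x => A.Y (u i) x (k.2 i)) (fun i => -(k.2 i : ℂ) - 1)
    (fun i x T hx => A.wt_Y (hu i) hx _) v Sv hv
  refine (B.wt_sR h1 hx k.1).mono (Eq.subset ?_)
  have h2 : (-(dg₂ k : ℂ) - 1) = (∑ i, (-(k.2 i : ℂ) - 1)) + (-(k.1 : ℂ) - 1) := by
    simp [dg₂]
    ring
  rw [h2, ← Set.singleton_add_singleton]
  abel

theorem Bimod.pair_Sc (B : Bimod A W) {m : ℕ} (u : Fin m → V) {φ : W →ₗ[ℂ] ℂ}
    (hφ : InGradedDual B.gr.proj φ) (f : B.gr.Comp) :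
    ∃ N : ℤ → Finset ℂ, ∀ (K : Fin m → ℤ) (N' : Finset ℂ), N (dg K) ⊆ N' →
      B.gr.pair φ (compApply m (fun i => B.gr.ext fun x => B.YsR (u i.rev) x (K i.rev)) f) =
        ∑ n ∈ N', φ (B.Sc u K (f.1 n)) := by
  obtain ⟨C, hC, hk⟩ := kills_of_inGradedDual (w := wW) hφ
  obtain ⟨S, hS, h⟩ := B.exists_wt_Sc u
  have hN : ∀ d : ℤ, (C - (S + {-(d : ℂ) - 1})).Finite := fun d =>
    hC.sub (hS.add (Set.finite_singleton _))
  refine ⟨fun d => (hN d).toFinset, fun K N' hN' => ?_⟩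
  have h1 := B.gr.pair_compApply (fun i : Fin m => B.sR (K i.rev) (u i.rev)) (fun i => by
    obtain ⟨T, hT, hv⟩ := A.gr.isGr.wt_self (u i.rev)
    refine ⟨_, hT.add (Set.finite_singleton (-(K i.rev : ℂ) - 1)), fun x T' hx => ?_⟩
    rw [add_right_comm]
    exact B.wt_sR hv hx _) hφ f
  refine h1.trans ?_
  refine finsum_eq_sum_of_support_subset _ fun n hn => hN' ?_
  by_contra hnC
  refine hn (B.gr.apply_shift_eq_zero hk (S := S + {-(dg K : ℂ) - 1}) (n := n) ?_
    (by simpa using hnC))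
  rw [add_right_comm]
  exact h K _ _ (B.gr.wt_comp f n)

theorem Bimod.pair_Yc (B : Bimod A W) {m : ℕ} (u : Fin m → V) (v : V) {φ : W →ₗ[ℂ] ℂ}
    (hφ : InGradedDual B.gr.proj φ) (f : B.gr.Comp) :
    ∃ N : ℤ → Finset ℂ, ∀ (k : ℤ × (Fin m → ℤ)) (N' : Finset ℂ), N (dg₂ k) ⊆ N' →
      B.gr.pair φ (B.gr.ext (fun x => B.YsR (A.Yc u k.2 v) x k.1) f) =
        ∑ n ∈ N', φ (B.YsR (A.Yc u k.2 v) (f.1 n) k.1) := by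
  obtain ⟨C, hC, hk⟩ := kills_of_inGradedDual (w := wW) hφ
  obtain ⟨S, hS, h⟩ := B.exists_wt_Yc u v
  have hN : ∀ d : ℤ, (C - (S + {-(d : ℂ) - 1})).Finite := fun d =>
    hC.sub (hS.add (Set.finite_singleton _))
  refine ⟨fun d => (hN d).toFinset, fun k N' hN' => ?_⟩
  have h1 := B.gr.pair_ext hφ (B.sR k.1 (A.Yc u k.2 v))
    (hS.add (Set.finite_singleton (-(dg₂ k : ℂ) - 1))) (fun x T hx => by
      rw [add_right_comm]
      exact h k x T hx) f
  refine h1.trans ?_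
  refine finsum_eq_sum_of_support_subset _ fun n hn => hN' ?_
  by_contra hnC
  refine hn (B.gr.apply_shift_eq_zero hk (S := S + {-(dg₂ k : ℂ) - 1}) (n := n) ?_
    (by simpa using hnC))
  rw [add_right_comm]
  exact h k _ _ (B.gr.wt_comp f n)

end Completion

section Homogeneous

/-- Collecting the terms of a series by degree. -/
theorem hasSum_graded {J : Type*} (δ : J → ℤ) {c a b : J → ℂ} {t s : ℂ}
    (h : ∀ j, a j = pw t (δ j) * b j) :
    HasSum (fun j => c j * a j) s ↔
    HasSum (fun k : ℤ × J => (if δ k.2 = k.1 then c k.2 else 0) * (pw t k.1 * b k.2)) s := by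
  have hi : Function.Injective fun j => (δ j, j) := fun j j' hj => (Prod.ext_iff.1 hj).2
  rw [← hi.hasSum_iff]
  · refine Iff.of_eq (congrArg (fun f => HasSum f s) ?_)
    funext j
    simp [h]
  · rintro ⟨d, j⟩ hk
    have : δ j ≠ d := fun e => hk ⟨j, by simp [e]⟩
    simp [this]

theorem slice_eq {J₁ J₂ : Type*} {δ₁ : J₁ → ℤ} {δ₂ : J₂ → ℤ} {c₁ b₁ : J₁ → ℂ} {c₂ b₂ : J₂ → ℂ}
    {a₁ : ℂ → J₁ → ℂ} {a₂ : ℂ → J₂ → ℂ} {s : ℂ → ℂ}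
    (h₁ : ∀ t : ℂ, ‖t‖ = 1 → ∀ j, a₁ t j = pw t (δ₁ j) * b₁ j)
    (h₂ : ∀ t : ℂ, ‖t‖ = 1 → ∀ j, a₂ t j = pw t (δ₂ j) * b₂ j)
    (hs₁ : ∀ t : ℂ, ‖t‖ = 1 → HasSum (fun j => c₁ j * a₁ t j) (s t))
    (hs₂ : ∀ t : ℂ, ‖t‖ = 1 → HasSum (fun j => c₂ j * a₂ t j) (s t)) (d : ℤ) :
    (Summable fun j => (if δ₁ j = d then c₁ j else 0) * b₁ j) ∧
    (Summable fun j => (if δ₂ j = d then c₂ j else 0) * b₂ j) ∧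
    ∑' j, (if δ₁ j = d then c₁ j else 0) * b₁ j = ∑' j, (if δ₂ j = d then c₂ j else 0) * b₂ j := by
  have e₁ := fun t ht => (hasSum_graded δ₁ (h₁ t ht)).1 (hs₁ t ht)
  have e₂ := fun t ht => (hasSum_graded δ₂ (h₂ t ht)).1 (hs₂ t ht)
  have hp : pw 1 d ≠ 0 := pw_ne_zero (by simp) d
  refine ⟨summable_fiber (e := fun d j => if δ₁ j = d then c₁ j else 0)
      (e₁ 1 (by simp)).summable d hp, summable_fiber (e := fun d j => if δ₂ j = d then c₂ j else 0)
      (e₂ 1 (by simp)).summable d hp, ?_⟩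
  have h0 := det_circle 1 one_pos (fun d => (∑' j, (if δ₁ j = d then c₁ j else 0) * b₁ j) -
    ∑' j, (if δ₂ j = d then c₂ j else 0) * b₂ j) fun t ht => by
      have f₁ := hasSum_fiber (e := fun d j => if δ₁ j = d then c₁ j else 0) (e₁ t ht)
      have f₂ := hasSum_fiber (e := fun d j => if δ₂ j = d then c₂ j else 0) (e₂ t ht)
      have f₃ := f₁.sub f₂
      rw [sub_self] at f₃
      exact f₃.congr_fun fun d => (sub_mul _ _ _)
  exact sub_eq_zero.1 (congrFun h0 d)

theorem pm_smul {m : ℕ} {t : ℂ} (ht : t ≠ 0) (z : Fin m → ℂ) (K : Fin m → ℤ) :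
    pm (fun i => t * z i) K = pw t (dg K) * pm z K := by
  have h1 : ∏ i, t ^ (-(K i) - 1) = pw t (dg K) := by
    have h2 : ∀ s : Finset (Fin m), ∏ i ∈ s, t ^ (-(K i) - 1) = t ^ (∑ i ∈ s, (-(K i) - 1)) := by
      intro s
      classical
      induction s using Finset.induction_on with
      | empty => simp
      | insert a s ha ih => rw [Finset.prod_insert ha, Finset.sum_insert ha, ih, zpow_add₀ ht]
    rw [h2, pw, dg]
    congr 1
    ring
  rw [pm, pm, ← h1, ← Finset.prod_mul_distrib]
  exact Finset.prod_congr rfl fun i _ => mul_zpow _ _ _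

theorem mm_smul {m : ℕ} {t : ℂ} (ht : t ≠ 0) (q : ℂ × (Fin m → ℂ)) (k : ℤ × (Fin m → ℤ)) :
    mm (t * q.1, fun i => t * q.2 i) k = pw t (dg₂ k) * mm q k := by
  have h1 : pw t k.1 * pw t (dg k.2) = pw t (dg₂ k) := by
    rw [pw, pw, pw, ← zpow_add₀ ht, dg, dg₂]
    congr 1
    ring
  change pw (t * q.1) k.1 * pm (fun i => t * q.2 i) k.2 = _ * (pw q.1 k.1 * pm q.2 k.2)
  rw [pm_smul ht, ← h1, pw, mul_zpow]
  unfold pw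
  ring

end Homogeneous

section Slices

variable {V : Type*} [AddCommGroup V] [Module ℂ V]
variable {W : Type*} [AddCommGroup W] [Module ℂ W] {A : MOSVA V}

theorem orderedPos_smul {n : ℕ} {x : Fin n → ℂ} (hx : OrderedPos x) {t : ℂ} (ht : t ≠ 0) :
    OrderedPos fun i => t * x i := by
  have ht' := norm_pos_iff.2 ht
  refine ⟨fun i j hij => ?_, fun i => ?_⟩ <;> simp only [norm_mul]
  · exact mul_lt_mul_of_pos_left (hx.1 i j hij) ht'
  · exact mul_pos ht' (hx.2 i)

theorem cons_smul {n : ℕ} (a t : ℂ) (x : Fin n → ℂ) :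
    (Fin.cons (t * a) (fun i => t * x i) : Fin (n+1) → ℂ) =
      fun i => t * (Fin.cons a x : Fin (n+1) → ℂ) i := by
  funext i
  induction i using Fin.cases <;> simp

/-- Homogeneous parts of products of opposite right vertex operators and of the
corresponding iterate. -/
theorem Bimod.slice_vec (B : Bimod A W) {m : ℕ} (u : Fin m → V) (w : W) {φ : W →ₗ[ℂ] ℂ}
    (hφ : InGradedDual B.gr.proj φ) {q : ℂ × (Fin m → ℂ)}
    (h1 : OrderedPos (Fin.cons q.1 (fun i => q.1 + q.2 i.rev) : Fin (m+1) → ℂ))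
    (h2 : OrderedPos (Fin.cons q.1 q.2 : Fin (m+1) → ℂ)) (d : ℤ) :
    (Summable fun K : Fin m → ℤ => (if dg K = d then φ (B.Sc u K w) else 0) *
      pm (fun i => q.1 + q.2 i) K) ∧
    (Summable fun k => (if dg₂ k = d then φ (B.YsR (A.Yc u k.2 A.vac) w k.1) else 0) * mm q k) ∧
    ∑' K : Fin m → ℤ, (if dg K = d then φ (B.Sc u K w) else 0) * pm (fun i => q.1 + q.2 i) K =
      ∑' k, (if dg₂ k = d then φ (B.YsR (A.Yc u k.2 A.vac) w k.1) else 0) * mm q k := by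
  obtain ⟨S, hF, hG⟩ := B.iterRat m u A.vac w φ hφ
  have hn : ∀ t : ℂ, ‖t‖ = 1 → t ≠ 0 := fun t ht => norm_pos_iff.1 (by rw [ht]; exact one_pos)
  refine slice_eq (δ₁ := dg) (δ₂ := dg₂)
    (a₁ := fun t K => pm (fun i => t * (q.1 + q.2 i)) K)
    (a₂ := fun t k => mm (t * q.1, fun i => t * q.2 i) k)
    (s := fun t => S (t * q.1) fun i => t * q.2 i)
    (fun t ht K => pm_smul (hn t ht) _ K) (fun t ht k => mm_smul (hn t ht) q k)
    (fun t ht => ?_) (fun t ht => ?_) d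
  · have h3 := orderedPos_smul h1 (hn t ht)
    rw [← cons_smul] at h3
    have h4 := hF (t * q.1) (fun i => t * (q.1 + q.2 i)) h3
    have h5 : (fun i => t * (q.1 + q.2 i) - t * q.1) = fun i => t * q.2 i := by
      funext i; ring
    rw [h5] at h4
    have hi : Function.Injective fun K : Fin m → ℤ => ((-1 : ℤ), K) :=
      fun K K' hK => (Prod.ext_iff.1 hK).2
    refine ((hi.hasSum_iff ?_).2 h4).congr_fun fun K => ?_
    · rintro ⟨k, K⟩ hk
      have hk' : k ≠ -1 := fun e => hk ⟨K, by rw [e]⟩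
      rw [B.YsR_vac, if_neg hk', map_zero, zero_mul]
    · change φ (B.Sc u K w) * pm _ K = φ (B.YsR A.vac (B.Sc u K w) (-1)) * (pw _ (-1) * pm _ K)
      rw [B.YsR_vac, if_pos rfl]
      simp [pw]
  · have h3 := orderedPos_smul h2 (hn t ht)
    rw [← cons_smul] at h3
    exact hG _ _ h3

/-- Homogeneous parts of products and iterates applied to an element of the completion. -/
theorem Bimod.slice_comp (B : Bimod A W) {m : ℕ} (u : Fin m → V) {φ : W →ₗ[ℂ] ℂ}
    (hφ : InGradedDual B.gr.proj φ) (f : B.gr.Comp) {q : ℂ × (Fin m → ℂ)}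
    (h1 : OrderedPos (Fin.cons q.1 (fun i => q.1 + q.2 i.rev) : Fin (m+1) → ℂ))
    (h2 : OrderedPos (Fin.cons q.1 q.2 : Fin (m+1) → ℂ)) (d : ℤ) :
    ∑' K : Fin m → ℤ, (if dg K = d then B.gr.pair φ
        (compApply m (fun i => B.gr.ext fun x => B.YsR (u i.rev) x (K i.rev)) f) else 0) *
        pm (fun i => q.1 + q.2 i) K =
      ∑' k, (if dg₂ k = d then
        B.gr.pair φ (B.gr.ext (fun x => B.YsR (A.Yc u k.2 A.vac) x k.1) f) else 0) * mm q k := by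
  classical
  obtain ⟨N₁, hN₁⟩ := B.pair_Sc u hφ f
  obtain ⟨N₂, hN₂⟩ := B.pair_Yc u A.vac hφ f
  have e1 : ∀ K : Fin m → ℤ, (if dg K = d then B.gr.pair φ
        (compApply m (fun i => B.gr.ext fun x => B.YsR (u i.rev) x (K i.rev)) f) else 0) *
        pm (fun i => q.1 + q.2 i) K = ∑ n ∈ N₁ d ∪ N₂ d,
        (if dg K = d then φ (B.Sc u K (f.1 n)) else 0) * pm (fun i => q.1 + q.2 i) K := by
    intro K
    by_cases hd : dg K = d
    · simp only [hd, if_true]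
      rw [hN₁ K (N₁ d ∪ N₂ d) (by rw [hd]; exact Finset.subset_union_left), Finset.sum_mul]
    · simp [hd]
  have e2 : ∀ k : ℤ × (Fin m → ℤ), (if dg₂ k = d then
        B.gr.pair φ (B.gr.ext (fun x => B.YsR (A.Yc u k.2 A.vac) x k.1) f) else 0) * mm q k =
        ∑ n ∈ N₁ d ∪ N₂ d,
        (if dg₂ k = d then φ (B.YsR (A.Yc u k.2 A.vac) (f.1 n) k.1) else 0) * mm q k := by
    intro k
    by_cases hd : dg₂ k = d
    · simp only [hd, if_true]
      rw [hN₂ k (N₁ d ∪ N₂ d) (by rw [hd]; exact Finset.subset_union_right), Finset.sum_mul]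
    · simp [hd]
  have hs := fun n => B.slice_vec u (f.1 n) hφ h1 h2 d
  rw [tsum_congr e1, tsum_congr e2, Summable.tsum_finsetSum fun n _ => (hs n).1,
    Summable.tsum_finsetSum fun n _ => (hs n).2.1]
  exact Finset.sum_congr rfl fun n _ => (hs n).2.2

theorem Bimod.summable_iter (B : Bimod A W) {m : ℕ} (u : Fin m → V) {φ : W →ₗ[ℂ] ℂ}
    (hφ : InGradedDual B.gr.proj φ) (f : B.gr.Comp) {q : ℂ × (Fin m → ℂ)}
    (h2 : OrderedPos (Fin.cons q.1 q.2 : Fin (m+1) → ℂ)) (d : ℤ) :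
    Summable fun k => (if dg₂ k = d then
      B.gr.pair φ (B.gr.ext (fun x => B.YsR (A.Yc u k.2 A.vac) x k.1) f) else 0) * mm q k := by
  obtain ⟨N₂, hN₂⟩ := B.pair_Yc u A.vac hφ f
  have h3 : ∀ n ∈ N₂ d, Summable fun k =>
      (if dg₂ k = d then φ (B.YsR (A.Yc u k.2 A.vac) (f.1 n) k.1) else 0) * mm q k := by
    intro n _
    obtain ⟨S, -, hG⟩ := B.iterRat m u A.vac (f.1 n) φ hφ
    refine ((hG q.1 q.2 h2).summable.indicator {k | dg₂ k = d}).congr fun k => ?_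
    by_cases hd : dg₂ k = d <;> simp [hd, Set.indicator]
  refine (summable_sum h3).congr fun k => ?_
  by_cases hd : dg₂ k = d
  · simp only [hd, if_true]
    rw [hN₂ k (N₂ d) (by rw [hd]), Finset.sum_mul]
  · simp [hd]

end Slices

section Completion

theorem eventually_lt_mul {d : ℝ} (hd : 0 < d) (c : ℝ) : ∀ᶠ r : ℝ in atTop, c < r * d :=
  (tendsto_id.atTop_mul_const hd).eventually_gt_atTop c

/-- The region of variables in which the iterate has to be expanded. -/
def IterRegion {n : ℕ} (m : ℕ) (zt : Fin n → ℂ) : Set (ℂ × (Fin m → ℂ)) :=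
  {q | Ordered q.2 ∧ ∀ i j, ‖q.2 i‖ + ‖zt j‖ < ‖q.1‖}

theorem eventually_iterRegion {m n : ℕ} (zt : Fin n → ℂ) {q : ℂ × (Fin m → ℂ)}
    (hq : OrderedPos (Fin.cons q.1 q.2 : Fin (m+1) → ℂ)) :
    ∀ᶠ r : ℝ in atTop, ∀ t : ℂ, ‖t‖ = r → (t * q.1, fun i => t * q.2 i) ∈ IterRegion m zt := by
  have h := orderedPos_cons.1 hq
  have h1 : ∀ᶠ r : ℝ in atTop, ∀ i : Fin m, ∀ j : Fin n, ‖zt j‖ < r * (‖q.1‖ - ‖q.2 i‖) :=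
    eventually_all.2 fun i => eventually_all.2 fun j =>
      eventually_lt_mul (sub_pos.2 (h.2.2 i)) _
  filter_upwards [h1, eventually_gt_atTop 0] with r hr hr0 t ht
  refine ⟨fun i j hij => ?_, fun i j => ?_⟩
  · change ‖t * q.2 j‖ < ‖t * q.2 i‖
    rw [norm_mul, norm_mul, ht]
    exact mul_lt_mul_of_pos_left (h.1.1 i j hij) hr0
  · change ‖t * q.2 i‖ + ‖zt j‖ < ‖t * q.1‖
    rw [norm_mul, norm_mul, ht]
    linarith [hr i j]

/-- Expansion of a rational function with diagonal poles in the variables of the iterate. -/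
theorem DiagRatFn.iterate_expansion {m n : ℕ} (R : DiagRatFn (Fin (m+n))) (zt : Fin n → ℂ) :
    ∃ C : ℤ × (Fin m → ℤ) → ℂ, ∀ q ∈ IterRegion m zt,
      HasSum (fun k => C k * mm q k) (R.eval (Fin.append (fun i => q.1 + q.2 i) zt)) := by
  let U := IterRegion m zt
  let Y : ℂ × (Fin m → ℂ) → Fin (m+1) → ℂ := fun q => Fin.cons q.1 q.2
  have cz : Mo Y U fun q => q.1 := Mo.coord 0
  have cx : ∀ i, Mo Y U fun q => q.2 i := fun i => Mo.coord i.succ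
  have hx : ∀ i j, i < j → ExI Y U fun q => q.2 i - q.2 j := fun i j hij => by
    have ci : Mo Y U fun q => (q.2 i)⁻¹ := Mo.coord_inv i.succ fun q hq =>
      norm_pos_iff.1 ((norm_nonneg _).trans_lt (hq.1 i j hij))
    refine (ExI.dom₁ (cx i) ci (cx j).neg fun q hq => ?_).congr fun q _ => ?_
    · rw [norm_neg]; exact hq.1 i j hij
    · ring
  have hxc : ∀ i j, ExI Y U fun q => q.1 + q.2 i - zt j := fun i j => by
    have cz' : Mo Y U fun q => (q.1)⁻¹ := Mo.coord_inv 0 fun q hq =>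
      norm_pos_iff.1 ((add_nonneg (norm_nonneg _) (norm_nonneg _)).trans_lt (hq.2 i j))
    refine (ExI.dom cz cz' (cx i) (Mo.const (-zt j)) fun q hq => ?_).congr fun q _ => ?_
    · rw [norm_neg]; exact hq.2 i j
    · ring
  let l : ℂ × (Fin m → ℂ) → Fin (m+n) → ℂ := fun q => Fin.append (fun i => q.1 + q.2 i) zt
  have hl : ∀ q i, l q (Fin.castAdd n i) = q.1 + q.2 i := fun q i => Fin.append_left _ _ _
  have hr : ∀ q j, l q (Fin.natAdd m j) = zt j := fun q j => Fin.append_right _ _ _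
  have hex : Ex Y U fun q => R.eval (l q) := by
    refine DiagRatFn.ex (Y := Y) (U := U) R (l := l) (fun a => ?_) fun a b => ?_
    · induction a using Fin.addCases with
      | left i => simpa only [hl] using cz.ex.add (cx i).ex
      | right j => simpa only [hr] using Ex.const (zt j)
    · induction a using Fin.addCases with
      | left i =>
        induction b using Fin.addCases with
        | left j =>
          intro hab
          simp only [hl]
          have hij : i ≠ j := fun e => hab (by rw [e])
          rcases hij.lt_or_gt with hij | hij
          · exact (hx i j hij).2.congr fun q _ => by rw [add_sub_add_left_eq_sub]
          · exact (hx j i hij).neg.2.congr fun q _ => by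
              rw [add_sub_add_left_eq_sub]
              exact congrArg _ (neg_sub _ _)
        | right j =>
          intro _
          simpa only [hl, hr] using (hxc i j).2
      | right i =>
        induction b using Fin.addCases with
        | left j =>
          intro _
          simp only [hl, hr]
          exact (hxc j i).neg.2.congr fun q _ => congrArg _ (neg_sub _ _)
        | right j =>
          intro _
          simpa only [hr] using Ex.const (zt i - zt j)⁻¹
  exact hex.array_cons

theorem conf_append {m n : ℕ} {zo : Fin m → ℂ} {zt : Fin n → ℂ}
    (h1 : ∀ i j : Fin m, i < j → ‖zo i‖ < ‖zo j‖) (h2 : ∀ i j, ‖zt j‖ < ‖zo i‖)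
    (h3 : Conf zt) : Conf (Fin.append zo zt) := by
  have h4 : ∀ i j, zo i ≠ zt j := fun i j e => (h2 i j).ne' (congrArg norm e)
  intro a b
  induction a using Fin.addCases with
  | left i =>
    induction b using Fin.addCases with
    | left j =>
      intro hab
      simp only [Fin.append_left]
      have hij : i ≠ j := fun e => hab (by rw [e])
      rcases hij.lt_or_gt with hij | hij
      · exact fun e => (h1 i j hij).ne (congrArg norm e)
      · exact fun e => (h1 j i hij).ne' (congrArg norm e)
    | right j => intro _; simpa using h4 i j
  | right i =>
    induction b using Fin.addCases with
    | left j => intro _; simpa using (h4 j i).symm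
    | right j =>
      intro hab
      simpa using h3 i j fun e => hab (by rw [e])

variable {V : Type*} [AddCommGroup V] [Module ℂ V]
variable {W : Type*} [AddCommGroup W] [Module ℂ W] {A : MOSVA V}

theorem Bimod.hasSum_iter (B : Bimod A W) {m n : ℕ} (hm : 0 < m) (u : Fin m → V) (w : B.gr.Comp)
    {φ : W →ₗ[ℂ] ℂ} (hφ : InGradedDual B.gr.proj φ) {zt : Fin n → ℂ} (hzt : Conf zt)
    (R : DiagRatFn (Fin (m+n)))
    (hR : ∀ zo : Fin m → ℂ, Conf (Fin.append zo zt) →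
      (∀ i j : Fin m, i < j → ‖zo i‖ < ‖zo j‖) →
      (∀ j : Fin n, ‖zt j‖ < ‖zo ⟨0, hm⟩‖) →
      HasSum (fun K : Fin m → ℤ => B.gr.pair φ (compApply m
        (fun i => B.gr.ext (fun x => B.YsR (u i.rev) x (K i.rev))) w) * pm zo K)
        (R.eval (Fin.append zo zt)))
    {q : ℂ × (Fin m → ℂ)} (hq : q ∈ IterRegion m zt) :
    HasSum (fun k => B.gr.pair φ (B.gr.ext (fun x => B.YsR (A.Yc u k.2 A.vac) x k.1) w) * mm q k)
      (R.eval (Fin.append (fun i => q.1 + q.2 i) zt)) := by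
  obtain ⟨C, hC⟩ := R.iterate_expansion zt
  set F : (Fin m → ℤ) → ℂ := fun K => B.gr.pair φ (compApply m
    (fun i => B.gr.ext (fun x => B.YsR (u i.rev) x (K i.rev))) w) with hF
  set G : ℤ × (Fin m → ℤ) → ℂ := fun k =>
    B.gr.pair φ (B.gr.ext (fun x => B.YsR (A.Yc u k.2 A.vac) x k.1) w) with hG
  have key : (fun (d : ℤ) k => if dg₂ k = d then C k else 0) =
      fun (d : ℤ) k => if dg₂ k = d then G k else 0 := by
    have h0 : OrderedPos (Fin.cons (2 : ℂ) (fun i : Fin m => -(tiny m 1 i : ℂ)) :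
        Fin (m+1) → ℂ) := by
      have h : ∀ i, ‖-(tiny m 1 i : ℂ)‖ = tiny m 1 i := fun i => by
        rw [norm_neg, Complex.norm_real, Real.norm_of_nonneg (tiny_pos one_pos i).le]
      refine orderedPos_cons.2 ⟨orderedPos_of_tiny one_pos h, by norm_num, fun i => ?_⟩
      rw [h, Complex.norm_ofNat]
      linarith [tiny_lt one_pos i]
    refine transfer (mP := pw) (m₁ := pm) (m₂ := mm)
      (g := fun (d : ℤ) K => if dg K = d then F K else 0)
      (R := fun t q => R.eval (Fin.append (fun i => t * (q.1 + q.2 i)) zt))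
      (τ := fun q i => q.1 + q.2 i)
      (U := fun q => {t | t ≠ 0 ∧ (t * q.1, fun i => t * q.2 i) ∈ IterRegion m zt})
      (idP_cons _ _ h0) (fun q hq t ht => ?_) (fun q hq => ?_)
      (fun d q hq => B.summable_iter u hφ w hq d) ?_
    · have h1 := hC _ ht.2
      simp only [← mul_add] at h1
      exact (hasSum_graded dg₂ fun k => mm_smul ht.1 q k).1 h1
    · obtain ⟨r, hr, hr0⟩ := ((eventually_iterRegion zt hq).and (eventually_gt_atTop 0)).exists
      have hn : ‖(r : ℂ)‖ = r := by rw [Complex.norm_real, Real.norm_of_nonneg hr0.le]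
      refine ⟨r, ⟨?_, hr _ hn⟩, fun i => pw_ne_zero ?_ i⟩
      · exact_mod_cast hr0.ne'
      · rwa [hn]
    · have ev1 := eventually_orderedPos
        (f := fun q : ℂ × (Fin m → ℂ) => (Fin.cons q.1 q.2 : Fin (m+1) → ℂ))
        (q₀ := ((2 : ℂ), fun i : Fin m => -(tiny m 1 i : ℂ)))
        (continuous_cons (fun i => by fun_prop) (by fun_prop)) h0
      have ev2 := eventually_orderedPos
        (f := fun q : ℂ × (Fin m → ℂ) =>
          (Fin.cons q.1 (fun i => q.1 + q.2 i.rev) : Fin (m+1) → ℂ))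
        (q₀ := ((2 : ℂ), fun i : Fin m => -(tiny m 1 i : ℂ)))
        (continuous_cons (fun i => by fun_prop) (by fun_prop)) (by
          simpa only [sub_eq_add_neg] using orderedPos_base_sub (p := m))
      filter_upwards [ev1, ev2] with q hq1 hq2
      have h2 := (orderedPos_cons.1 hq2).1
      have hinc : ∀ i j : Fin m, i < j → ‖q.1 + q.2 i‖ < ‖q.1 + q.2 j‖ := fun i j h => by
        simpa using h2.1 j.rev i.rev (Fin.rev_lt_rev.2 h)
      have hpos : ∀ i, 0 < ‖q.1 + q.2 i‖ := fun i => by simpa using h2.2 i.rev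
      have ev3 : ∀ᶠ r : ℝ in atTop, ∀ i : Fin m, ∀ j : Fin n, ‖zt j‖ < r * ‖q.1 + q.2 i‖ :=
        eventually_all.2 fun i => eventually_all.2 fun j => eventually_lt_mul (hpos i) _
      obtain ⟨r, ⟨hr, hr3⟩, hr0⟩ :=
        (((eventually_iterRegion zt hq1).and ev3).and (eventually_gt_atTop 0)).exists
      have hn : ∀ t : ℂ, ‖t‖ = r → t ≠ 0 := fun t ht => norm_pos_iff.1 (by rwa [ht])
      refine ⟨hq1, {t | ‖t‖ = r}, fun t ht => ⟨hn t ht, hr t ht⟩, det_circle r hr0,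
        fun t ht => ?_, fun d => B.slice_comp u hφ w hq2 hq1 d⟩
      have ht' : ‖t‖ = r := ht
      have hlt : ∀ i j, ‖zt j‖ < ‖t * (q.1 + q.2 i)‖ := fun i j => by
        rw [norm_mul, ht']; exact hr3 i j
      have hinc' : ∀ i j : Fin m, i < j → ‖t * (q.1 + q.2 i)‖ < ‖t * (q.1 + q.2 j)‖ :=
        fun i j h => by
          rw [norm_mul, norm_mul, ht']
          exact mul_lt_mul_of_pos_left (hinc i j h) hr0
      exact (hasSum_graded dg fun K => pm_smul (hn t ht) (fun i => q.1 + q.2 i) K).1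
        (hR (fun i => t * (q.1 + q.2 i)) (conf_append hinc' hlt hzt) hinc' (hlt _))
  have hCG : ∀ k, C k = G k := fun k => by
    simpa using congrFun (congrFun key (dg₂ k)) k
  exact (hC q hq).congr_fun fun k => by
    rw [hCG]

end Completion

end RationalExpansions

/-- Let `V` be a MOSVA and `W` a `V`-bimodule, both satisfying the
pole-order condition. Let `u₁,…,u_m ∈ V` and `f ∈ W̃_{z_{m+1},…,z_{m+n}}` be such
that `Y_W^{s(R)}(u_m,z_m)⋯Y_W^{s(R)}(u₁,z₁)f(z_{m+1},…,z_{m+n})` converges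
absolutely to the `W̄`-valued rational function `h` whenever
`|z_m| > ⋯ > |z₁| > |z_i|`. Then
`Y_W^{s(R)}(Y_V(u₁,z₁−ζ)⋯Y_V(u_m,z_m−ζ)𝟏, ζ)f(z_{m+1},…,z_{m+n})` also converges
absolutely to the same `W̄`-valued rational function whenever
`|ζ| > |z₁−ζ| + |z_i|` and `|z₁−ζ| > ⋯ > |z_m−ζ|` (so that the corresponding
`E(⋯)`'s agree as elements of `W̃_{z₁,…,z_{m+n}}`). -/
theorem statement13 {V : Type*} [AddCommGroup V] [Module ℂ V]
    {W : Type*} [AddCommGroup W] [Module ℂ W]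
    (A : MOSVA V) (B : Bimod A W) (hA : A.PoleOrder) (hB : B.PoleOrder)
    (m n : ℕ) (hm : 0 < m) (u : Fin m → V)
    (f : (Fin n → ℂ) → B.gr.Comp) (hfW : B.gr.WTilde f)
    (h : (Fin (m+n) → ℂ) → B.gr.Comp) (hhW : B.gr.WTilde h)
    (hconv : ∀ (zo : Fin m → ℂ) (zt : Fin n → ℂ), Conf (Fin.append zo zt) →
      (∀ i j : Fin m, i < j → ‖zo i‖ < ‖zo j‖) →
      (∀ j : Fin n, ‖zt j‖ < ‖zo ⟨0, hm⟩‖) →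
      ∀ φ : W →ₗ[ℂ] ℂ, InGradedDual B.gr.proj φ →
        AbsConvTo (fun K : Fin m → ℤ =>
            B.gr.pair φ (compApply m
                (fun i => B.gr.ext (fun x => B.YsR (u i.rev) x (K i.rev))) (f zt))
              * ∏ i, zo i ^ (-(K i) - 1))
          (B.gr.pair φ (h (Fin.append zo zt)))) :
    ∀ (zo : Fin m → ℂ) (zt : Fin n → ℂ) (ζ : ℂ), Conf (Fin.append zo zt) →
      (∀ j : Fin n, ‖zo ⟨0, hm⟩ - ζ‖ + ‖zt j‖ < ‖ζ‖) →
      Ordered (fun i => zo i - ζ) →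
      ∀ φ : W →ₗ[ℂ] ℂ, InGradedDual B.gr.proj φ →
        AbsConvTo (fun K : (Fin m → ℤ) × ℤ =>
            B.gr.pair φ (B.gr.ext (fun x =>
                B.YsR (compApply m (fun i y => A.Y (u i) y (K.1 i)) A.vac) x K.2) (f zt))
              * ζ ^ (-K.2 - 1) * ∏ i, (zo i - ζ) ^ (-(K.1 i) - 1))
          (B.gr.pair φ (h (Fin.append zo zt))) := by
  intro zo zt ζ hc hζ ho φ hφ
  obtain ⟨R, hR⟩ := hhW.1 φ hφ
  have hzt : Conf zt := fun i j hij => by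
    simpa using hc (Fin.natAdd m i) (Fin.natAdd m j) (by simpa using hij)
  have hq : (ζ, fun i => zo i - ζ) ∈ IterRegion m zt := by
    refine ⟨ho, fun i j => lt_of_le_of_lt (add_le_add_left ?_ _) (hζ j)⟩
    rcases eq_or_ne i ⟨0, hm⟩ with rfl | hi
    · exact le_rfl
    · exact (ho ⟨0, hm⟩ i (Fin.lt_def.2 (Nat.pos_of_ne_zero fun e => hi (Fin.ext e)))).le
  have h1 := B.hasSum_iter hm u (f zt) hφ hzt R (fun zo' hc' h1 h2 => by
    rw [← hR _ hc']
    exact (hconv zo' zt hc' h1 h2 φ hφ).2) hq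
  simp only [add_sub_cancel] at h1
  rw [← hR _ hc] at h1
  have h2 := ((Equiv.prodComm (Fin m → ℤ) ℤ).hasSum_iff.2 h1).congr_fun
    (g := fun K : (Fin m → ℤ) × ℤ =>
            B.gr.pair φ (B.gr.ext (fun x =>
                B.YsR (compApply m (fun i y => A.Y (u i) y (K.1 i)) A.vac) x K.2) (f zt))
              * ζ ^ (-K.2 - 1) * ∏ i, (zo i - ζ) ^ (-(K.1 i) - 1)) fun K =>
    mul_assoc _ _ _
  exact ⟨h2.summable.norm, h2⟩

end VA
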